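/- For the weighted two-dimensional geometric knapsack problem with guillotine cuts (2GGK) on an N×N knapsack, let OPT be an optimal solution and let OPT_{L&C} be a most profitable subset of the input items that admits a guillotine-separable L&C packing. Then there is a universal constant C such that for every ε ∈ (0,1), p(OPT_{L&C}) ≥ (2/3 − C·ε)·p(OPT). -/

import Mathlib

/-- An axis-aligned rectangle, given by the coordinates of its corners. -/
structure Rect where
  x1 : ℝ
  x2 : ℝ
  y1 : ℝ
  y2 : ℝ

namespace Rect

def width (r : Rect) : ℝ := r.x2 - r.x1

def height (r : Rect) : ℝ := r.y2 - r.y1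

def area (r : Rect) : ℝ := r.width * r.height

/-- The open interior of an axis-aligned rectangle. -/
def toSet (r : Rect) : Set (ℝ × ℝ) :=
  {p : ℝ × ℝ | r.x1 < p.1 ∧ p.1 < r.x2 ∧ r.y1 < p.2 ∧ p.2 < r.y2}

/-- `r.SubRect s` : the rectangle `r` is contained in the rectangle `s`. -/
def SubRect (r s : Rect) : Prop :=
  s.x1 ≤ r.x1 ∧ r.x2 ≤ s.x2 ∧ s.y1 ≤ r.y1 ∧ r.y2 ≤ s.y2

noncomputable instance (r s : Rect) : Decidable (r.SubRect s) :=
  inferInstanceAs (Decidable (s.x1 ≤ r.x1 ∧ r.x2 ≤ s.x2 ∧ s.y1 ≤ r.y1 ∧ r.y2 ≤ s.y2))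

end Rect

/-- The square knapsack `[0,N] × [0,N]`. -/
def knapsack (N : ℝ) : Rect := ⟨0, N, 0, N⟩

/-- A placement of the items of `S` (with prescribed widths and heights) as
pairwise non-overlapping axis-aligned rectangles inside the piece `P`. -/
structure IsPacking {ι : Type*} (wd ht : ι → ℝ) (S : Finset ι)
    (place : ι → Rect) (P : Rect) : Prop where
  hw : ∀ i ∈ S, (place i).width = wd i
  hh : ∀ i ∈ S, (place i).height = ht i
  hin : ∀ i ∈ S, (place i).SubRect P
  hdisj : ∀ i ∈ S, ∀ j ∈ S, i ≠ j → Disjoint (place i).toSet (place j).toSet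

/-- Guillotine separability of the placed items of `S` inside the piece `P`:
either the piece contains at most one item, or some axis-parallel end-to-end cut
splits the piece into two rectangular subpieces, crossing the interior of no item,
and the items of each subpiece are recursively guillotine separable. -/
inductive GuillotineSep {ι : Type*} (place : ι → Rect) : Rect → Finset ι → Prop
  | base (P : Rect) (S : Finset ι) (hS : S.card ≤ 1) : GuillotineSep place P S
  | vcut (P : Rect) (S : Finset ι) (c : ℝ) (h1 : P.x1 < c) (h2 : c < P.x2)
      (hcross : ∀ i ∈ S, (place i).x2 ≤ c ∨ c ≤ (place i).x1)
      (hL : GuillotineSep place ⟨P.x1, c, P.y1, P.y2⟩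
              (S.filter fun i => (place i).x2 ≤ c))
      (hR : GuillotineSep place ⟨c, P.x2, P.y1, P.y2⟩
              (S.filter fun i => ¬ (place i).x2 ≤ c)) :
      GuillotineSep place P S
  | hcut (P : Rect) (S : Finset ι) (c : ℝ) (h1 : P.y1 < c) (h2 : c < P.y2)
      (hcross : ∀ i ∈ S, (place i).y2 ≤ c ∨ c ≤ (place i).y1)
      (hB : GuillotineSep place ⟨P.x1, P.x2, P.y1, c⟩
              (S.filter fun i => (place i).y2 ≤ c))
      (hT : GuillotineSep place ⟨P.x1, P.x2, c, P.y2⟩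
              (S.filter fun i => ¬ (place i).y2 ≤ c)) :
      GuillotineSep place P S

/-- A guillotine-separable packing of the items of `S` into the piece `P`. -/
def GuillotinePacking {ι : Type*} (wd ht : ι → ℝ) (S : Finset ι)
    (place : ι → Rect) (P : Rect) : Prop :=
  IsPacking wd ht S place P ∧ GuillotineSep place P S

/-- Labels of containers. -/
inductive CLabel
  | large
  | horizontal
  | vertical
  | area

/-- The constraints of a container packing: a large container contains a single item,
in a horizontal container the items are stacked one above another, in a vertical
container the items are placed side by side, and every item placed in an area
container has width (resp. height) at most an `ε`-fraction of the container's
width (resp. height). -/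
def ContainerLabelOK {ι : Type*} (T : Finset ι) (place : ι → Rect)
    (k : ℕ) (cont : ℕ → Rect) (lab : ℕ → CLabel) (asg : ι → ℕ) (ε : ℝ) : Prop :=
  (∀ j < k, lab j = CLabel.large →
      ∀ i ∈ T, ∀ i' ∈ T, asg i = j → asg i' = j → i = i') ∧
  (∀ j < k, lab j = CLabel.horizontal →
      ∀ i ∈ T, ∀ i' ∈ T, asg i = j → asg i' = j → i ≠ i' →
        (place i).y2 ≤ (place i').y1 ∨ (place i').y2 ≤ (place i).y1) ∧
  (∀ j < k, lab j = CLabel.vertical →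
      ∀ i ∈ T, ∀ i' ∈ T, asg i = j → asg i' = j → i ≠ i' →
        (place i).x2 ≤ (place i').x1 ∨ (place i').x2 ≤ (place i).x1) ∧
  (∀ j < k, lab j = CLabel.area → ∀ i ∈ T, asg i = j →
      (place i).width ≤ ε * (cont j).width ∧ (place i).height ≤ ε * (cont j).height)

/-- An `L&C` packing of the items of `S` into the `N × N` knapsack: a guillotine
separable packing in which the items of a subset `SL` are long and are placed inside
a boundary-`L` (wide items in the horizontal arm `[0,N] × [0,N1]`, tall items in the
vertical arm `[0,N2] × [0,N]`), while all remaining items are placed inside at most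
`k` pairwise non-overlapping containers contained in the region not occupied by the
boundary-`L`. -/
def IsLCPacking {ι : Type*} [DecidableEq ι] (wd ht : ι → ℝ) (N ε : ℝ)
    (S : Finset ι) (place : ι → Rect) (k : ℕ) : Prop :=
  ∃ (N1 N2 : ℝ) (SL : Finset ι) (cont : ℕ → Rect) (lab : ℕ → CLabel) (asg : ι → ℕ),
    0 ≤ N1 ∧ N1 ≤ N ∧ 0 ≤ N2 ∧ N2 ≤ N ∧ SL ⊆ S ∧
    IsPacking wd ht S place (knapsack N) ∧
    GuillotineSep place (knapsack N) S ∧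
    (∀ i ∈ SL, N / 2 < wd i ∨ N / 2 < ht i) ∧
    (∀ i ∈ SL, N / 2 < wd i → (place i).SubRect ⟨0, N, 0, N1⟩) ∧
    (∀ i ∈ SL, ¬ N / 2 < wd i → (place i).SubRect ⟨0, N2, 0, N⟩) ∧
    (∀ j < k, (cont j).SubRect (knapsack N)) ∧
    (∀ j < k, Disjoint (cont j).toSet
        (Rect.toSet ⟨0, N, 0, N1⟩ ∪ Rect.toSet ⟨0, N2, 0, N⟩)) ∧
    (∀ j < k, ∀ j' < k, j ≠ j' → Disjoint (cont j).toSet (cont j').toSet) ∧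
    (∀ i ∈ S \ SL, asg i < k ∧ (place i).SubRect (cont (asg i))) ∧
    ContainerLabelOK (S \ SL) place k cont lab asg ε

namespace GKP
variable {ι : Type} [DecidableEq ι]

/-- Coordinate-free guillotine packings of `S` into an `a × b` box. -/
inductive GT (wd ht : ι → ℝ) : Finset ι → ℝ → ℝ → Prop
  | empty (a b : ℝ) (ha : 0 ≤ a) (hb : 0 ≤ b) : GT wd ht ∅ a b
  | single (i : ι) (a b : ℝ) (ha : wd i ≤ a) (hb : ht i ≤ b) : GT wd ht {i} a b
  | v (S1 S2 : Finset ι) (a1 a2 b : ℝ) (hd : Disjoint S1 S2)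
      (h1 : GT wd ht S1 a1 b) (h2 : GT wd ht S2 a2 b) : GT wd ht (S1 ∪ S2) (a1 + a2) b
  | h (S1 S2 : Finset ι) (a b1 b2 : ℝ) (hd : Disjoint S1 S2)
      (h1 : GT wd ht S1 a b1) (h2 : GT wd ht S2 a b2) : GT wd ht (S1 ∪ S2) a (b1 + b2)

/-- Coordinate-free guillotine container packings of `S` into an `a × b` box
using at most `k` containers. -/
inductive CP (ε : ℝ) (wd ht : ι → ℝ) : ℕ → Finset ι → ℝ → ℝ → Prop
  | empty (k : ℕ) (a b : ℝ) (ha : 0 ≤ a) (hb : 0 ≤ b) : CP ε wd ht k ∅ a b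
  | hor (S : Finset ι) (a b : ℝ) (ha : 0 ≤ a) (hw : ∀ i ∈ S, wd i ≤ a)
      (hb : ∑ i ∈ S, ht i ≤ b) : CP ε wd ht 1 S a b
  | ver (S : Finset ι) (a b : ℝ) (hb : 0 ≤ b) (hh : ∀ i ∈ S, ht i ≤ b)
      (ha : ∑ i ∈ S, wd i ≤ a) : CP ε wd ht 1 S a b
  | area (S : Finset ι) (a b : ℝ) (hg : GT wd ht S a b)
      (hs : ∀ i ∈ S, wd i ≤ ε * a ∧ ht i ≤ ε * b) : CP ε wd ht 1 S a b
  | v (k1 k2 : ℕ) (S1 S2 : Finset ι) (a1 a2 b : ℝ) (hd : Disjoint S1 S2)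
      (h1 : CP ε wd ht k1 S1 a1 b) (h2 : CP ε wd ht k2 S2 a2 b) :
      CP ε wd ht (k1 + k2) (S1 ∪ S2) (a1 + a2) b
  | h (k1 k2 : ℕ) (S1 S2 : Finset ι) (a b1 b2 : ℝ) (hd : Disjoint S1 S2)
      (h1 : CP ε wd ht k1 S1 a b1) (h2 : CP ε wd ht k2 S2 a b2) :
      CP ε wd ht (k1 + k2) (S1 ∪ S2) a (b1 + b2)

variable {ε : ℝ} {wd ht : ι → ℝ}

theorem GT.nonneg (hw : ∀ i, 0 < wd i) (hh : ∀ i, 0 < ht i) {S : Finset ι} {a b : ℝ}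
    (h : GT wd ht S a b) : 0 ≤ a ∧ 0 ≤ b := by
  induction h with
  | empty a b ha hb => exact ⟨ha, hb⟩
  | single i a b ha hb => exact ⟨(hw i).le.trans ha, (hh i).le.trans hb⟩
  | v S1 S2 a1 a2 b hd h1 h2 i1 i2 => exact ⟨add_nonneg i1.1 i2.1, i1.2⟩
  | h S1 S2 a b1 b2 hd h1 h2 i1 i2 => exact ⟨i1.1, add_nonneg i1.2 i2.2⟩

theorem GT.swap {S : Finset ι} {a b : ℝ} (h : GT wd ht S a b) : GT ht wd S b a := by
  induction h with
  | empty a b ha hb => exact .empty _ _ hb ha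
  | single i a b ha hb => exact .single _ _ _ hb ha
  | v S1 S2 a1 a2 b hd h1 h2 i1 i2 => exact .h _ _ _ _ _ hd i1 i2
  | h S1 S2 a b1 b2 hd h1 h2 i1 i2 => exact .v _ _ _ _ _ hd i1 i2

theorem GT.v' {S S1 S2 : Finset ι} {a a1 a2 b : ℝ} (h1 : GT wd ht S1 a1 b)
    (h2 : GT wd ht S2 a2 b) (hd : Disjoint S1 S2) (hS : S = S1 ∪ S2) (ha : a = a1 + a2) :
    GT wd ht S a b := by
  subst hS ha; exact .v _ _ _ _ _ hd h1 h2

theorem GT.h' {S S1 S2 : Finset ι} {a b b1 b2 : ℝ} (h1 : GT wd ht S1 a b1)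
    (h2 : GT wd ht S2 a b2) (hd : Disjoint S1 S2) (hS : S = S1 ∪ S2) (hb : b = b1 + b2) :
    GT wd ht S a b := by
  subst hS hb; exact .h _ _ _ _ _ hd h1 h2

theorem GT.mono (hw : ∀ i, 0 < wd i) (hh : ∀ i, 0 < ht i) {S : Finset ι} {a b a' b' : ℝ}
    (h : GT wd ht S a b) (ha : a ≤ a') (hb : b ≤ b') : GT wd ht S a' b' := by
  have hn := h.nonneg hw hh
  have h1 : GT wd ht S a' b :=
    h.v' (.empty (a' - a) b (by linarith) hn.2) (by simp) (by simp) (by ring)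
  exact h1.h' (.empty a' (b' - b) (by linarith) (by linarith)) (by simp) (by simp) (by ring)

theorem GT.sub (hw : ∀ i, 0 < wd i) (hh : ∀ i, 0 < ht i) {S : Finset ι} {a b : ℝ}
    (h : GT wd ht S a b) : ∀ T ⊆ S, GT wd ht T a b := by
  induction h with
  | empty a b ha hb =>
    intro T hT
    rw [Finset.subset_empty.1 hT]; exact .empty _ _ ha hb
  | single i a b ha hb =>
    intro T hT
    rcases Finset.subset_singleton_iff.1 hT with rfl | rfl
    · exact .empty _ _ ((hw i).le.trans ha) ((hh i).le.trans hb)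
    · exact .single _ _ _ ha hb
  | v S1 S2 a1 a2 b hd h1 h2 i1 i2 =>
    intro T hT
    refine GT.v' (i1 (T ∩ S1) Finset.inter_subset_right) (i2 (T ∩ S2) Finset.inter_subset_right)
      (hd.mono Finset.inter_subset_right Finset.inter_subset_right) ?_ rfl
    rw [← Finset.inter_union_distrib_left, Finset.inter_eq_left.2 hT]
  | h S1 S2 a b1 b2 hd h1 h2 i1 i2 =>
    intro T hT
    refine GT.h' (i1 (T ∩ S1) Finset.inter_subset_right) (i2 (T ∩ S2) Finset.inter_subset_right)
      (hd.mono Finset.inter_subset_right Finset.inter_subset_right) ?_ rfl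
    rw [← Finset.inter_union_distrib_left, Finset.inter_eq_left.2 hT]

theorem GT.le (hw : ∀ i, 0 < wd i) (hh : ∀ i, 0 < ht i) {S : Finset ι} {a b : ℝ}
    (h : GT wd ht S a b) : ∀ i ∈ S, wd i ≤ a ∧ ht i ≤ b := by
  induction h with
  | empty a b ha hb => simp
  | single i a b ha hb => simp [ha, hb]
  | v S1 S2 a1 a2 b hd h1 h2 i1 i2 =>
    intro i hi
    have n1 := h1.nonneg hw hh
    have n2 := h2.nonneg hw hh
    rcases Finset.mem_union.1 hi with hi | hi
    · exact ⟨by linarith [(i1 i hi).1], (i1 i hi).2⟩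
    · exact ⟨by linarith [(i2 i hi).1], (i2 i hi).2⟩
  | h S1 S2 a b1 b2 hd h1 h2 i1 i2 =>
    intro i hi
    have n1 := h1.nonneg hw hh
    have n2 := h2.nonneg hw hh
    rcases Finset.mem_union.1 hi with hi | hi
    · exact ⟨(i1 i hi).1, by linarith [(i1 i hi).2]⟩
    · exact ⟨(i2 i hi).1, by linarith [(i2 i hi).2]⟩

theorem GT.area_le (hw : ∀ i, 0 < wd i) (hh : ∀ i, 0 < ht i) {S : Finset ι} {a b : ℝ}
    (h : GT wd ht S a b) : ∑ i ∈ S, wd i * ht i ≤ a * b := by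
  induction h with
  | empty a b ha hb => simpa using mul_nonneg ha hb
  | single i a b ha hb =>
    simpa using mul_le_mul ha hb (hh i).le ((hw i).le.trans ha)
  | v S1 S2 a1 a2 b hd h1 h2 i1 i2 => rw [Finset.sum_union hd]; linarith
  | h S1 S2 a b1 b2 hd h1 h2 i1 i2 => rw [Finset.sum_union hd]; linarith

theorem GT.scale {S : Finset ι} {a b : ℝ} (h : GT wd ht S a b) (c e : ℝ) (hc : 0 ≤ c)
    (he : 0 ≤ e) : GT (fun i => c * wd i) (fun i => e * ht i) S (c * a) (e * b) := by
  induction h with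
  | empty a b ha hb => exact .empty _ _ (mul_nonneg hc ha) (mul_nonneg he hb)
  | single i a b ha hb =>
    exact .single _ _ _ (mul_le_mul_of_nonneg_left ha hc) (mul_le_mul_of_nonneg_left hb he)
  | v S1 S2 a1 a2 b hd h1 h2 i1 i2 => exact i1.v' i2 hd rfl (by ring)
  | h S1 S2 a b1 b2 hd h1 h2 i1 i2 => exact i1.h' i2 hd rfl (by ring)

/-- Items side by side. -/
theorem GT.row (hh : ∀ i, 0 < ht i) (S : Finset ι) (b : ℝ) (hb : 0 ≤ b)
    (hS : ∀ i ∈ S, ht i ≤ b) : GT wd ht S (∑ i ∈ S, wd i) b := by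
  induction S using Finset.induction_on with
  | empty => simpa using GT.empty (wd := wd) (ht := ht) 0 b le_rfl hb
  | insert i S hi ih =>
    rw [Finset.sum_insert hi]
    exact GT.v' (.single i (wd i) b le_rfl (hS i (by simp)))
      (ih fun j hj => hS j (by simp [hj])) (by simpa using hi)
      (by rw [Finset.insert_eq]) rfl

theorem CP.nonneg (hw : ∀ i, 0 < wd i) (hh : ∀ i, 0 < ht i) {k : ℕ} {S : Finset ι} {a b : ℝ}
    (h : CP ε wd ht k S a b) : 0 ≤ a ∧ 0 ≤ b := by
  induction h with
  | empty k a b ha hb => exact ⟨ha, hb⟩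
  | hor S a b ha hw' hb => exact ⟨ha, (Finset.sum_nonneg fun i _ => (hh i).le).trans hb⟩
  | ver S a b hb hh' ha => exact ⟨(Finset.sum_nonneg fun i _ => (hw i).le).trans ha, hb⟩
  | area S a b hg hs => exact hg.nonneg hw hh
  | v k1 k2 S1 S2 a1 a2 b hd h1 h2 i1 i2 => exact ⟨add_nonneg i1.1 i2.1, i1.2⟩
  | h k1 k2 S1 S2 a b1 b2 hd h1 h2 i1 i2 => exact ⟨i1.1, add_nonneg i1.2 i2.2⟩

theorem CP.swap {k : ℕ} {S : Finset ι} {a b : ℝ} (h : CP ε wd ht k S a b) :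
    CP ε ht wd k S b a := by
  induction h with
  | empty k a b ha hb => exact .empty _ _ _ hb ha
  | hor S a b ha hw' hb => exact .ver _ _ _ ha hw' hb
  | ver S a b hb hh' ha => exact .hor _ _ _ hb hh' ha
  | area S a b hg hs => exact .area _ _ _ hg.swap fun i hi => (hs i hi).symm
  | v k1 k2 S1 S2 a1 a2 b hd h1 h2 i1 i2 => exact .h _ _ _ _ _ _ _ hd i1 i2
  | h k1 k2 S1 S2 a b1 b2 hd h1 h2 i1 i2 => exact .v _ _ _ _ _ _ _ hd i1 i2

theorem CP.v' {k k1 k2 : ℕ} {S S1 S2 : Finset ι} {a a1 a2 b : ℝ} (h1 : CP ε wd ht k1 S1 a1 b)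
    (h2 : CP ε wd ht k2 S2 a2 b) (hd : Disjoint S1 S2) (hk : k = k1 + k2) (hS : S = S1 ∪ S2)
    (ha : a = a1 + a2) : CP ε wd ht k S a b := by
  subst hk hS ha; exact .v _ _ _ _ _ _ _ hd h1 h2

theorem CP.h' {k k1 k2 : ℕ} {S S1 S2 : Finset ι} {a b b1 b2 : ℝ} (h1 : CP ε wd ht k1 S1 a b1)
    (h2 : CP ε wd ht k2 S2 a b2) (hd : Disjoint S1 S2) (hk : k = k1 + k2) (hS : S = S1 ∪ S2)
    (hb : b = b1 + b2) : CP ε wd ht k S a b := by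
  subst hk hS hb; exact .h _ _ _ _ _ _ _ hd h1 h2

theorem CP.mono (hw : ∀ i, 0 < wd i) (hh : ∀ i, 0 < ht i) {k k' : ℕ} {S : Finset ι}
    {a b a' b' : ℝ} (h : CP ε wd ht k S a b) (hk : k ≤ k') (ha : a ≤ a') (hb : b ≤ b') :
    CP ε wd ht k' S a' b' := by
  have hn := h.nonneg hw hh
  have h1 : CP ε wd ht k' S a' b :=
    h.v' (.empty (k' - k) (a' - a) b (by linarith) hn.2) (by simp) (by omega) (by simp) (by ring)
  exact h1.h' (.empty 0 a' (b' - b) (by linarith) (by linarith)) (by simp) (by simp) (by simp)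
    (by ring)

theorem CP.scale {k : ℕ} {S : Finset ι} {a b : ℝ} (h : CP ε wd ht k S a b) (c e : ℝ)
    (hc : 0 ≤ c) (he : 0 ≤ e) :
    CP ε (fun i => c * wd i) (fun i => e * ht i) k S (c * a) (e * b) := by
  induction h with
  | empty k a b ha hb => exact .empty _ _ _ (mul_nonneg hc ha) (mul_nonneg he hb)
  | hor S a b ha hw' hb =>
    refine .hor _ _ _ (mul_nonneg hc ha) (fun i hi => mul_le_mul_of_nonneg_left (hw' i hi) hc) ?_
    rw [← Finset.mul_sum]; exact mul_le_mul_of_nonneg_left hb he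
  | ver S a b hb hh' ha =>
    refine .ver _ _ _ (mul_nonneg he hb) (fun i hi => mul_le_mul_of_nonneg_left (hh' i hi) he) ?_
    rw [← Finset.mul_sum]; exact mul_le_mul_of_nonneg_left ha hc
  | area S a b hg hs =>
    refine .area _ _ _ (hg.scale c e hc he) fun i hi => ⟨?_, ?_⟩
    · have := mul_le_mul_of_nonneg_left (hs i hi).1 hc
      linarith
    · have := mul_le_mul_of_nonneg_left (hs i hi).2 he
      linarith
  | v k1 k2 S1 S2 a1 a2 b hd h1 h2 i1 i2 => exact i1.v' i2 hd rfl rfl (by ring)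
  | h k1 k2 S1 S2 a b1 b2 hd h1 h2 i1 i2 => exact i1.h' i2 hd rfl rfl (by ring)

/-- Prefix lemma: a prefix, in the order of decreasing `key`, of total size about `a`. -/
theorem exists_prefix (key sz : ι → ℝ) (β a : ℝ) (S : Finset ι)
    (h0 : 0 ≤ a + β) (hsz : ∀ i ∈ S, sz i ≤ β) :
    ∃ T ⊆ S, (∀ i ∈ T, ∀ j ∈ S \ T, key j ≤ key i) ∧ ∑ i ∈ T, sz i ≤ a + β ∧
      (T = S ∨ a ≤ ∑ i ∈ T, sz i) := by
  induction S using Finset.induction_on_max_value (fun i => - key i) with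
  | empty => exact ⟨∅, by simp, by simp, by simpa using h0, Or.inl rfl⟩
  | insert m S hm hmax ih =>
    obtain ⟨T, hTS, hk, hs, hor⟩ := ih fun i hi => hsz i (by simp [hi])
    by_cases hc : a ≤ ∑ i ∈ T, sz i
    · refine ⟨T, hTS.trans (Finset.subset_insert _ _), ?_, hs, Or.inr hc⟩
      intro i hi j hj
      rw [Finset.mem_sdiff, Finset.mem_insert] at hj
      rcases hj with ⟨rfl | hj, hjT⟩
      · have := hmax i (hTS hi); linarith
      · exact hk i hi j (by simp [hj, hjT])
    · have hT : T = S := by tauto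
      subst hT
      refine ⟨insert m T, le_rfl, by simp, ?_, Or.inl rfl⟩
      rw [Finset.sum_insert hm]
      have := hsz m (by simp)
      push Not at hc
      linarith

/-- Next-fit-decreasing-height. -/
theorem nfdh (hw : ∀ i, 0 < wd i) (hh : ∀ i, 0 < ht i) (f σ : ℝ) (hσ : 0 ≤ σ) (hf : σ < f) :
    ∀ (n : ℕ) (S : Finset ι) (ν : ℝ), S.card ≤ n → 0 ≤ ν → (∀ i ∈ S, wd i ≤ σ) →
      (∀ i ∈ S, ht i ≤ ν) → GT wd ht S f (ν + (∑ i ∈ S, wd i * ht i) / (f - σ)) := by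
  intro n
  induction n with
  | zero =>
    intro S ν hS hν _ _
    have : S = ∅ := by simpa using hS
    subst this
    exact .empty _ _ (by linarith) (by simpa using hν)
  | succ n ih =>
    intro S ν hS hν hws hhs
    have hfs : 0 < f - σ := by linarith
    obtain ⟨T, hTS, hk, hs, hor⟩ := exists_prefix ht wd σ (f - σ) S (by linarith) hws
    have hrow : GT wd ht T f ν :=
      (GT.row hh T ν hν fun i hi => hhs i (hTS hi)).mono hw hh (by linarith) le_rfl
    have harea : ∀ U : Finset ι, 0 ≤ (∑ i ∈ U, wd i * ht i) / (f - σ) := fun U =>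
      div_nonneg (Finset.sum_nonneg fun i _ => (mul_pos (hw i) (hh i)).le) hfs.le
    rcases hor with rfl | hge
    · exact hrow.mono hw hh le_rfl (by linarith [harea T])
    · have hTne : T.Nonempty := by
        rw [Finset.nonempty_iff_ne_empty]; rintro rfl; simp at hge; linarith
      obtain ⟨i0, hi0, hmin⟩ := Finset.exists_min_image T ht hTne
      have h2 := ih (S \ T) (ht i0) (by
        have : (S \ T).card < S.card := Finset.card_lt_card (by
          refine Finset.ssubset_iff_subset_ne.2 ⟨Finset.sdiff_subset, fun h => ?_⟩
          have := hTS hi0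
          rw [← h] at this
          exact (Finset.mem_sdiff.1 this).2 hi0)
        omega) (hh i0).le (fun i hi => hws i (Finset.mem_sdiff.1 hi).1)
        (fun j hj => hk i0 hi0 j hj)
      have h3 := hrow.h' h2 (Finset.disjoint_sdiff) (S := S) (by simp [hTS]) rfl
      refine h3.mono hw hh le_rfl ?_
      have hsplit : ∑ i ∈ S, wd i * ht i
          = ∑ i ∈ S \ T, wd i * ht i + ∑ i ∈ T, wd i * ht i :=
        (Finset.sum_sdiff hTS).symm
      have hge2 : (f - σ) * ht i0 ≤ ∑ i ∈ T, wd i * ht i := by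
        calc (f - σ) * ht i0 ≤ (∑ i ∈ T, wd i) * ht i0 :=
              mul_le_mul_of_nonneg_right hge (hh i0).le
          _ = ∑ i ∈ T, wd i * ht i0 := by rw [Finset.sum_mul]
          _ ≤ _ := Finset.sum_le_sum fun i hi =>
              mul_le_mul_of_nonneg_left (hmin i hi) (hw i).le
      have : ht i0 ≤ (∑ i ∈ T, wd i * ht i) / (f - σ) := by
        rw [le_div_iff₀ hfs]; linarith
      rw [hsplit, add_div]; linarith

/-- Filling bins greedily. -/
theorem bins {κ : Type} [DecidableEq κ] (sz : ι → ℝ) (β : ℝ) (B : Finset κ) (hB : B.Nonempty)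
    (C : κ → ℝ) (hC : ∀ b ∈ B, 0 ≤ C b) (hβ : 0 ≤ β) (S : Finset ι)
    (h0 : ∀ i ∈ S, 0 ≤ sz i) (hsz : ∀ i ∈ S, sz i ≤ β) (htot : ∑ i ∈ S, sz i ≤ ∑ b ∈ B, C b) :
    ∃ f : ι → κ, (∀ i, f i ∈ B) ∧
      ∀ b ∈ B, ∑ i ∈ S.filter (fun i => f i = b), sz i ≤ C b + β := by
  induction S using Finset.induction_on with
  | empty =>
    obtain ⟨b, hb⟩ := hB
    exact ⟨fun _ => b, fun _ => hb, fun b hb => by simpa using add_nonneg (hC b hb) hβ⟩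
  | insert m S hm ih =>
    rw [Finset.sum_insert hm] at htot
    have hm0 := h0 m (by simp)
    obtain ⟨f, hf, hl⟩ := ih (fun i hi => h0 i (by simp [hi])) (fun i hi => hsz i (by simp [hi]))
      (by linarith)
    have hsum : ∑ b ∈ B, ∑ i ∈ S.filter (fun i => f i = b), sz i = ∑ i ∈ S, sz i :=
      Finset.sum_fiberwise_of_maps_to (fun i _ => hf i) _
    obtain ⟨b0, hb0, hle⟩ : ∃ b ∈ B, ∑ i ∈ S.filter (fun i => f i = b), sz i ≤ C b := by
      apply Finset.exists_le_of_sum_le hB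
      rw [hsum]; linarith
    refine ⟨Function.update f m b0, ?_, ?_⟩
    · intro i
      by_cases h : i = m
      · subst h; simpa using hb0
      · simpa [h] using hf i
    · intro b hb
      have hfil : S.filter (fun i => Function.update f m b0 i = b)
          = S.filter (fun i => f i = b) := by
        apply Finset.filter_congr
        intro i hi
        have : i ≠ m := by rintro rfl; exact hm hi
        simp [this]
      rw [Finset.filter_insert]
      by_cases h : b0 = b
      · subst h
        simp only [Function.update_self, if_true]
        rw [Finset.sum_insert (by simp [hm]), hfil]
        have := hsz m (by simp)
        linarith
      · simp only [Function.update_self, h, if_false]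
        rw [hfil]; exact hl b hb

/-- Filling bins while dropping a `1/m` fraction of the profit and the capacity. -/
theorem bins_drop {κ : Type} [DecidableEq κ] (sz pr : ι → ℝ) (β : ℝ) (B : Finset κ)
    (hB : B.Nonempty) (m : ℕ) (hm : 0 < m)
    (C : κ → ℝ) (hC : ∀ b ∈ B, 0 ≤ C b) (hβ : 0 ≤ β) (S : Finset ι)
    (h0 : ∀ i ∈ S, 0 ≤ sz i) (hsz : ∀ i ∈ S, sz i ≤ β)
    (htot : ∑ i ∈ S, sz i ≤ ∑ b ∈ B, C b + β) :
    ∃ T ⊆ S, (1 - 1 / (m : ℝ)) * ∑ i ∈ S, pr i ≤ ∑ i ∈ T, pr i ∧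
    ∃ f : ι → κ, (∀ i, f i ∈ B) ∧
      ∀ b ∈ B, ∑ i ∈ T.filter (fun i => f i = b), sz i ≤ (1 - 1 / (m : ℝ)) * C b + m * β := by
  have hmR : (0 : ℝ) < m := by exact_mod_cast hm
  have hm1 : (1 : ℝ) ≤ m := by exact_mod_cast hm
  have hne : (Finset.range m).Nonempty := ⟨0, by simpa using hm⟩
  obtain ⟨f, hf, hl⟩ := bins (κ := κ × ℕ) sz β (B ×ˢ Finset.range m) (hB.product hne)
    (fun b => (C b.1 + β) / m) (fun b hb => div_nonneg
      (add_nonneg (hC _ (Finset.mem_product.1 hb).1) hβ) hmR.le) hβ S h0 hsz (by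
      rw [Finset.sum_product]
      simp only [Finset.sum_const, Finset.card_range, nsmul_eq_mul]
      refine htot.trans ?_
      have : ∀ b, (m : ℝ) * ((C b + β) / m) = C b + β := fun b => by field_simp
      simp only [this, Finset.sum_add_distrib, Finset.sum_const, nsmul_eq_mul]
      have : (1 : ℝ) ≤ B.card := by exact_mod_cast hB.card_pos
      nlinarith)
  have hfib : ∑ s ∈ Finset.range m, ∑ i ∈ S.filter (fun i => (f i).2 = s), pr i
      = ∑ i ∈ S, pr i :=
    Finset.sum_fiberwise_of_maps_to (fun i _ => (Finset.mem_product.1 (hf i)).2) _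
  obtain ⟨s, hs, hle⟩ : ∃ s ∈ Finset.range m,
      ∑ i ∈ S.filter (fun i => (f i).2 = s), pr i ≤ (∑ i ∈ S, pr i) / m := by
    apply Finset.exists_le_of_sum_le hne
    rw [hfib]
    simp only [Finset.sum_const, Finset.card_range, nsmul_eq_mul]
    rw [mul_div_cancel₀ _ hmR.ne']
  refine ⟨S.filter (fun i => ¬ (f i).2 = s), Finset.filter_subset _ _, ?_,
    fun i => (f i).1, fun i => (Finset.mem_product.1 (hf i)).1, ?_⟩
  · have := Finset.sum_filter_add_sum_filter_not S (fun i => (f i).2 = s) pr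
    have e : (1 - 1 / (m : ℝ)) * ∑ i ∈ S, pr i = ∑ i ∈ S, pr i - (∑ i ∈ S, pr i) / m := by ring
    rw [e]; linarith
  · intro b hb
    have hsub : ((S.filter (fun i => ¬ (f i).2 = s)).filter (fun i => (f i).1 = b))
        = ((Finset.range m).erase s).biUnion
          (fun r => S.filter (fun i => f i = (b, r))) := by
      ext i
      simp only [Finset.mem_filter, Finset.mem_biUnion, Finset.mem_erase, Finset.mem_range,
        Prod.ext_iff]
      constructor
      · rintro ⟨⟨hi, h1⟩, h2⟩
        exact ⟨(f i).2, ⟨h1, by simpa using (Finset.mem_product.1 (hf i)).2⟩, hi, h2, rfl⟩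
      · rintro ⟨r, ⟨h1, h2⟩, hi, h3, h4⟩
        exact ⟨⟨hi, by rw [h4]; exact h1⟩, h3⟩
    rw [hsub, Finset.sum_biUnion]
    · calc ∑ r ∈ (Finset.range m).erase s, ∑ i ∈ S.filter (fun i => f i = (b, r)), sz i
          ≤ ∑ r ∈ (Finset.range m).erase s, ((C b + β) / m + β) := by
            apply Finset.sum_le_sum
            intro r hr
            exact hl (b, r) (Finset.mem_product.2 ⟨hb, (Finset.mem_erase.1 hr).2⟩)
        _ = ((m : ℝ) - 1) * ((C b + β) / m + β) := by
            rw [Finset.sum_const, Finset.card_erase_of_mem hs, nsmul_eq_mul, Finset.card_range,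
              Nat.cast_sub hm, Nat.cast_one]
        _ ≤ _ := by
            have e : ((m : ℝ) - 1) * ((C b + β) / m + β)
              = (1 - 1 / (m : ℝ)) * C b + m * β - β / m := by field_simp; ring
            rw [e]
            have := div_nonneg hβ hmR.le
            linarith
    · intro r _ r' _ hrr
      rw [Function.onFun, Finset.disjoint_left]
      intro i hi hi'
      rw [Finset.mem_filter] at hi hi'
      apply hrr
      have := hi.2.symm.trans hi'.2
      simpa using this
end GKP

namespace GKP
variable {ι : Type} [DecidableEq ι] {ε : ℝ} {wd ht : ι → ℝ}

/-- Fractional slicing of a guillotine packing. -/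
theorem GT.family (hw : ∀ i, 0 < wd i) (hh : ∀ i, 0 < ht i) {S : Finset ι} {a b : ℝ}
    (h : GT wd ht S a b) : ∃ (E : Type) (_ : Fintype E) (η : E → ℝ) (I : E → Finset ι),
      (∀ e, 0 ≤ η e) ∧ ∑ e, η e = b ∧ (∀ e, I e ⊆ S) ∧ (∀ e, ∑ i ∈ I e, wd i ≤ a) ∧
      ∀ i ∈ S, ht i ≤ ∑ e, if i ∈ I e then η e else 0 := by
  induction h with
  | empty a b ha hb =>
    exact ⟨Unit, inferInstance, fun _ => b, fun _ => ∅, by simpa, by simp, by simp, by simpa,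
      by simp⟩
  | single i a b ha hb =>
    exact ⟨Unit, inferInstance, fun _ => b, fun _ => {i}, by simpa using (hh i).le.trans hb,
      by simp, by simp, by simpa, by simpa⟩
  | v S1 S2 a1 a2 b hd h1 h2 i1 i2 =>
    obtain ⟨E1, _, η1, I1, p1, s1, t1, w1, c1⟩ := i1
    obtain ⟨E2, _, η2, I2, p2, s2, t2, w2, c2⟩ := i2
    have hb := (h1.nonneg hw hh).2
    have ha1 := (h1.nonneg hw hh).1
    have ha2 := (h2.nonneg hw hh).1
    rcases hb.eq_or_lt with hb0 | hb0
    · refine ⟨Unit, inferInstance, fun _ => 0, fun _ => ∅, by simp, by simpa using hb0, by simp,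
        by simpa using add_nonneg ha1 ha2, ?_⟩
      intro i hi
      exfalso
      have := hh i
      rcases Finset.mem_union.1 hi with hi | hi
      · have := (h1.le hw hh i hi).2; linarith
      · have := (h2.le hw hh i hi).2; linarith
    · refine ⟨E1 × E2, inferInstance, fun e => η1 e.1 * η2 e.2 / b, fun e => I1 e.1 ∪ I2 e.2,
        fun e => div_nonneg (mul_nonneg (p1 _) (p2 _)) hb, ?_, ?_, ?_, ?_⟩
      · rw [Fintype.sum_prod_type]
        simp only [← Finset.sum_div, ← Finset.mul_sum, s2, ← Finset.sum_mul, s1]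
        field_simp
      · exact fun e => Finset.union_subset_union (t1 _) (t2 _)
      · intro e
        rw [Finset.sum_union (hd.mono (t1 _) (t2 _))]
        exact add_le_add (w1 _) (w2 _)
      · intro i hi
        rcases Finset.mem_union.1 hi with hi | hi
        · refine (c1 i hi).trans ?_
          rw [Fintype.sum_prod_type]
          apply Finset.sum_le_sum
          intro e _
          by_cases he : i ∈ I1 e
          · simp only [he, if_true, Finset.mem_union, true_or, ← Finset.sum_div, ← Finset.mul_sum,
              s2]
            rw [mul_div_cancel_right₀ _ hb0.ne']
          · simp only [he, if_false]
            apply Finset.sum_nonneg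
            intro x _
            split_ifs
            · exact div_nonneg (mul_nonneg (p1 _) (p2 _)) hb
            · exact le_rfl
        · refine (c2 i hi).trans ?_
          rw [Fintype.sum_prod_type_right]
          apply Finset.sum_le_sum
          intro e _
          by_cases he : i ∈ I2 e
          · simp only [he, if_true, Finset.mem_union, or_true, ← Finset.sum_div, ← Finset.sum_mul,
              s1]
            rw [mul_div_cancel_left₀ _ hb0.ne']
          · simp only [he, if_false]
            apply Finset.sum_nonneg
            intro x _
            split_ifs
            · exact div_nonneg (mul_nonneg (p1 _) (p2 _)) hb
            · exact le_rfl
  | h S1 S2 a b1 b2 hd h1 h2 i1 i2 =>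
    obtain ⟨E1, _, η1, I1, p1, s1, t1, w1, c1⟩ := i1
    obtain ⟨E2, _, η2, I2, p2, s2, t2, w2, c2⟩ := i2
    refine ⟨E1 ⊕ E2, inferInstance, Sum.elim η1 η2, Sum.elim I1 I2, ?_, ?_, ?_, ?_, ?_⟩
    · rintro (e | e)
      · exact p1 e
      · exact p2 e
    · simp [s1, s2]
    · rintro (e | e)
      · exact (t1 e).trans Finset.subset_union_left
      · exact (t2 e).trans Finset.subset_union_right
    · rintro (e | e)
      · exact w1 e
      · exact w2 e
    · intro i hi
      rw [Fintype.sum_sum_type]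
      simp only [Sum.elim_inl, Sum.elim_inr]
      have n1 : 0 ≤ ∑ e, if i ∈ I1 e then η1 e else 0 :=
        Finset.sum_nonneg fun e _ => by split_ifs; exacts [p1 e, le_rfl]
      have n2 : 0 ≤ ∑ e, if i ∈ I2 e then η2 e else 0 :=
        Finset.sum_nonneg fun e _ => by split_ifs; exacts [p2 e, le_rfl]
      rcases Finset.mem_union.1 hi with hi | hi
      · exact (c1 i hi).trans (le_add_of_nonneg_right n2)
      · exact (c2 i hi).trans (le_add_of_nonneg_left n1)

/-- Linear grouping. -/
theorem grouping (β a : ℝ) (ha : 0 < a) (hβ : 0 ≤ β) (hh : ∀ i, 0 < ht i) (g : ℕ) :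
    ∀ S : Finset ι, (∀ i ∈ S, ht i ≤ β) → ∑ i ∈ S, ht i < (g + 1) * a →
    ∃ c : ι → ℕ, (∀ i ∈ S, c i ≤ g) ∧ (∀ i ∈ S, ∀ j ∈ S, c i < c j → wd j ≤ wd i) ∧
      (∀ k, ∑ i ∈ S.filter (fun i => c i = k), ht i ≤ a + β) ∧
      (∀ j ∈ S, ∀ k < c j, a ≤ ∑ i ∈ S.filter (fun i => c i = k), ht i) := by
  induction g with
  | zero =>
    intro S hS hsum
    refine ⟨fun _ => 0, by simp, by simp, ?_, by simp⟩
    intro k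
    refine (Finset.sum_le_sum_of_subset_of_nonneg (Finset.filter_subset _ _)
      fun i _ _ => (hh i).le).trans ?_
    simp at hsum; linarith
  | succ g ih =>
    intro S hS hsum
    obtain ⟨T, hTS, hk, hs, hor⟩ := exists_prefix wd ht β a S (by linarith) hS
    rcases hor with rfl | hge
    · refine ⟨fun _ => 0, by simp, by simp, ?_, by simp⟩
      intro k
      exact (Finset.sum_le_sum_of_subset_of_nonneg (Finset.filter_subset _ _)
        fun i _ _ => (hh i).le).trans hs
    · have hsplit := Finset.sum_sdiff hTS (f := ht)
      obtain ⟨c, c1, c2, c3, c4⟩ := ih (S \ T) (fun i hi => hS i (Finset.mem_sdiff.1 hi).1)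
        (by push_cast at hsum; linarith)
      have f0 : S.filter (fun i => (if i ∈ T then 0 else c i + 1) = 0) = T := by
        ext i; simp only [Finset.mem_filter]
        by_cases h : i ∈ T
        · simp [h, hTS h]
        · simp [h]
      have fs : ∀ k, S.filter (fun i => (if i ∈ T then 0 else c i + 1) = k + 1)
          = (S \ T).filter (fun i => c i = k) := by
        intro k
        ext i; simp only [Finset.mem_filter, Finset.mem_sdiff]
        by_cases h : i ∈ T
        · simp [h]
        · simp [h]
      refine ⟨fun i => if i ∈ T then 0 else c i + 1, ?_, ?_, ?_, ?_⟩
      · intro i hi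
        dsimp only
        split_ifs with h
        · omega
        · have := c1 i (by simp [hi, h]); omega
      · intro i hi j hj hlt
        dsimp only at hlt
        by_cases hjT : j ∈ T
        · simp [hjT] at hlt
        · by_cases hiT : i ∈ T
          · exact hk i hiT j (by simp [hj, hjT])
          · simp [hjT, hiT] at hlt
            exact c2 i (by simp [hi, hiT]) j (by simp [hj, hjT]) hlt
      · rintro (_ | k)
        · rw [f0]; exact hs
        · rw [fs]; exact c3 k
      · intro j hj k hlt
        rcases k with _ | k
        · rw [f0]; exact hge
        · rw [fs]
          dsimp only at hlt
          by_cases hjT : j ∈ T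
          · simp [hjT] at hlt
          · simp [hjT] at hlt
            exact c4 j (by simp [hj, hjT]) k hlt

theorem CP.hsum {κ : Type} [DecidableEq κ] (F : ι → κ) (S : Finset ι) (W : ℝ) (hW : 0 ≤ W)
    (ℓ : κ → ℝ) (k : ℕ) (B : Finset κ)
    (h : ∀ b ∈ B, CP ε wd ht k (S.filter fun i => F i = b) W (ℓ b)) :
    CP ε wd ht (k * B.card) (S.filter fun i => F i ∈ B) W (∑ b ∈ B, ℓ b) := by
  induction B using Finset.induction_on with
  | empty => simpa using CP.empty (ε := ε) (wd := wd) (ht := ht) 0 W 0 hW le_rfl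
  | insert b B hb ih =>
    refine CP.h' (h b (by simp)) (ih fun c hc => h c (by simp [hc])) ?_ ?_ ?_
      (Finset.sum_insert hb)
    · rw [Finset.disjoint_filter]
      rintro i _ rfl
      exact hb
    · rw [Finset.card_insert_of_notMem hb]; ring
    · rw [← Finset.filter_or]; simp

theorem CP.vsum {κ : Type} [DecidableEq κ] (F : ι → κ) (S : Finset ι) (W : ℝ) (hW : 0 ≤ W)
    (ℓ : κ → ℝ) (k : ℕ) (B : Finset κ)
    (h : ∀ b ∈ B, CP ε wd ht k (S.filter fun i => F i = b) (ℓ b) W) :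
    CP ε wd ht (k * B.card) (S.filter fun i => F i ∈ B) (∑ b ∈ B, ℓ b) W :=
  (CP.hsum F S W hW ℓ k B fun b hb => (h b hb).swap).swap

theorem bins_multi {κ τ : Type} [DecidableEq κ] [DecidableEq τ] [Fintype τ] [Inhabited κ]
    (cls : ι → τ) (sz : τ → ι → ℝ) (pr : ι → ℝ) (β : ℝ)
    (B : τ → Finset κ) (m : ℕ) (hm : 0 < m) (C : τ → κ → ℝ) (hC : ∀ j, ∀ b ∈ B j, 0 ≤ C j b)
    (hβ : 0 ≤ β) (S : Finset ι) (h0 : ∀ i ∈ S, 0 ≤ sz (cls i) i)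
    (hsz : ∀ i ∈ S, sz (cls i) i ≤ β)
    (hB : ∀ i ∈ S, (B (cls i)).Nonempty)
    (htot : ∀ i ∈ S, ∑ i' ∈ S.filter (fun i' => cls i' = cls i), sz (cls i) i'
      ≤ ∑ b ∈ B (cls i), C (cls i) b + β) :
    ∃ T ⊆ S, (1 - 1 / (m : ℝ)) * ∑ i ∈ S, pr i ≤ ∑ i ∈ T, pr i ∧
    ∃ f : ι → κ, (∀ i ∈ T, f i ∈ B (cls i)) ∧
      ∀ j, ∀ b ∈ B j, ∑ i ∈ T.filter (fun i => cls i = j ∧ f i = b), sz j i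
        ≤ (1 - 1 / (m : ℝ)) * C j b + m * β := by
  have hmR : (1 : ℝ) ≤ m := by exact_mod_cast hm
  have hfac : 0 ≤ 1 - 1 / (m : ℝ) := by
    rw [sub_nonneg, div_le_one (by linarith)]; exact hmR
  have key : ∀ j : τ, ∃ T ⊆ S.filter (fun i => cls i = j),
      (1 - 1 / (m : ℝ)) * ∑ i ∈ S.filter (fun i => cls i = j), pr i ≤ ∑ i ∈ T, pr i ∧
      ∃ f : ι → κ, (∀ i ∈ T, f i ∈ B j) ∧
        ∀ b ∈ B j, ∑ i ∈ T.filter (fun i => f i = b), sz j i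
        ≤ (1 - 1 / (m : ℝ)) * C j b + m * β := by
    intro j
    rcases (S.filter (fun i => cls i = j)).eq_empty_or_nonempty with he | ⟨i, hi⟩
    · refine ⟨∅, by simp, by simp [he], fun _ => default, by simp, ?_⟩
      intro b hb
      simp only [Finset.filter_empty, Finset.sum_empty]
      have := hC j b hb
      positivity
    · rw [Finset.mem_filter] at hi
      obtain ⟨hi, rfl⟩ := hi
      obtain ⟨T, hT, hp, f, hf, hl⟩ := bins_drop (sz (cls i)) pr β (B (cls i)) (hB i hi) m hm
        (C (cls i)) (hC _) hβ (S.filter (fun i' => cls i' = cls i))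
        (by intro x hx; rw [Finset.mem_filter] at hx; rw [← hx.2]; exact h0 x hx.1)
        (by intro x hx; rw [Finset.mem_filter] at hx; rw [← hx.2]; exact hsz x hx.1)
        (htot i hi)
      exact ⟨T, hT, hp, f, fun i _ => hf i, hl⟩
  choose T hT hp f hf hl using key
  have hfil : ∀ j, (S.filter (fun i => i ∈ T (cls i))).filter (fun i => cls i = j) = T j := by
    intro j; ext i
    simp only [Finset.mem_filter]
    constructor
    · rintro ⟨⟨_, h⟩, rfl⟩; exact h
    · intro h
      have := Finset.mem_filter.1 (hT j h)
      obtain ⟨h1, rfl⟩ := this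
      exact ⟨⟨h1, h⟩, rfl⟩
  refine ⟨S.filter (fun i => i ∈ T (cls i)), Finset.filter_subset _ _, ?_,
    fun i => f (cls i) i, ?_, ?_⟩
  · rw [← Finset.sum_fiberwise S cls, ← Finset.sum_fiberwise (S.filter _) cls, Finset.mul_sum]
    apply Finset.sum_le_sum
    intro j _
    rw [hfil]; exact hp j
  · intro i hi
    exact hf _ i (Finset.mem_filter.1 hi).2
  · intro j b hb
    rw [← Finset.filter_filter, hfil]
    refine le_trans (le_of_eq ?_) (hl j b hb)
    congr 1
    apply Finset.filter_congr
    intro i hi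
    dsimp only
    rw [(Finset.mem_filter.1 (hT j hi)).2]
end GKP

namespace GKP
variable {ι : Type} [DecidableEq ι] {ε : ℝ} {wd ht : ι → ℝ}

set_option maxHeartbeats 4000000 in
/-- Assembly of rows in the proof of the Kenyon-Remila type lemma. -/
theorem KR_assemble (hw : ∀ i, 0 < wd i) (hh : ∀ i, 0 < ht i) (hε : 0 < ε)
    (m : ℕ) (hm : 0 < m) (lam fmin D : ℝ) (g q : ℕ)
    (hlam : 0 < lam) (hlf : 2 * m * lam ≤ fmin) (hle : lam ≤ ε * fmin) (hf1 : fmin ≤ 1 / 16)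
    (hlame : lam ≤ ε)
    (hD : D = 1 + m / lam + 1 / ε + 2 * m) (β t a : ℝ) (hβ : 0 < β) (ht0 : 0 < t) (ha : 0 < a)
    (T : Finset ι) (hTβ : ∀ i ∈ T, ht i ≤ β) (hw1 : ∀ i ∈ T, wd i ≤ 1)
    (V : Finset (Fin g → Fin (q + 1))) (v : Fin g → ℝ) (fc L : (Fin g → Fin (q + 1)) → ℝ)
    (hfc : ∀ c, fc c = 1 - ∑ j, (c j : ℝ) * v j)
    (hv : ∀ j, 0 ≤ v j) (hV : ∀ c ∈ V, 0 ≤ fc c) (hL : ∀ c, 0 ≤ L c)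
    (cls : ι → Option (Option (Fin g)))
    (f : ι → Option (Option (Fin g → Fin (q + 1))) × Option (Σ _ : Fin g, ℕ))
    (htri : ∀ i ∈ T, (cls i = none ∧ wd i ≤ lam ∧ (f i = (some none, none) ∨
        ∃ c ∈ V, fmin ≤ fc c ∧ f i = (some (some c), none))) ∨
      (cls i = some none ∧ f i = (none, none)) ∨
      (∃ j, cls i = some (some j) ∧ wd i ≤ v j ∧ ∃ c ∈ V, ∃ r < (c j : ℕ),
        f i = (some (some c), some ⟨j, r⟩)))
    (hl0 : ∑ i ∈ T.filter (fun i => cls i = some none ∧ f i = (none, none)), ht i ≤ a + m * β)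
    (hls : ∑ i ∈ T.filter (fun i => cls i = none ∧ f i = (some none, none)), wd i * ht i
      ≤ fmin * t + m * β)
    (hlc : ∀ c ∈ V, fmin ≤ fc c →
      ∑ i ∈ T.filter (fun i => cls i = none ∧ f i = (some (some c), none)), wd i * ht i
      ≤ (1 - 1 / (m : ℝ)) * (L c * fc c) + m * β)
    (hlj : ∀ c ∈ V, ∀ j, ∀ r < (c j : ℕ),
      ∑ i ∈ T.filter (fun i => cls i = some (some j) ∧ f i = (some (some c), some ⟨j, r⟩)), ht i
      ≤ (1 - 1 / (m : ℝ)) * L c + m * β) :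
    CP ε wd ht ((g * q + 1) * ((q + 1) ^ g + 2)) T 1
      ((a + D * β) + ((2 * fmin * t + D * β) +
        ∑ c ∈ V, ((1 - 1 / (2 * m : ℝ)) * L c + D * β))) := by
  have hmR : (1 : ℝ) ≤ m := by exact_mod_cast hm
  have hinvm : 0 < 1 / (m : ℝ) := by positivity
  have hinvm1 : 1 / (m : ℝ) ≤ 1 := by rw [div_le_one (by linarith)]; exact hmR
  have hhalf : 1 / (2 * m : ℝ) = (1 / (m : ℝ)) / 2 := by field_simp
  have hml : 0 < m / lam := by positivity
  have hε' : 0 < 1 / ε := by positivity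
  have hDε : β ≤ ε * (D * β) := by
    have : 1 ≤ ε * D := by
      rw [hD]
      have : ε * (1 / ε) = 1 := by field_simp
      nlinarith
    nlinarith
  have hDm : m * β ≤ D * β := by
    apply mul_le_mul_of_nonneg_right _ hβ.le; rw [hD]; linarith
  have hDpos : 0 < D := by rw [hD]; positivity
  have hlam1 : lam ≤ 1 / 2 := by nlinarith
  have hfpos : 0 < fmin := by nlinarith
  let ℓ : Option (Option (Fin g → Fin (q + 1))) → ℝ := fun b => match b with
    | none => a + D * β
    | some none => 2 * fmin * t + D * β
    | some (some c) => (1 - 1 / (2 * m : ℝ)) * L c + D * β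
  let R : Finset (Option (Option (Fin g → Fin (q + 1)))) :=
    Finset.insertNone (Finset.insertNone V)
  have hcardV : V.card ≤ (q + 1) ^ g := by
    refine (Finset.card_le_univ V).trans (le_of_eq ?_)
    simp
  have hmain : CP ε wd ht ((g * q + 1) * R.card)
      (T.filter fun i => (f i).1 ∈ R) 1 (∑ b ∈ R, ℓ b) := by
    apply CP.hsum (fun i => (f i).1) T 1 zero_le_one ℓ (g * q + 1) R
    rintro (_ | _ | c) hb
    · -- class zero
      have : CP ε wd ht 1 (T.filter fun i => (f i).1 = none) 1 (a + D * β) := by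
        refine .hor _ _ _ zero_le_one (fun i hi => hw1 i (Finset.mem_filter.1 hi).1) ?_
        refine le_trans (Finset.sum_le_sum_of_subset_of_nonneg ?_ fun i _ _ => (hh i).le)
          (hl0.trans (by linarith))
        intro i hi
        rw [Finset.mem_filter] at hi ⊢
        rcases htri i hi.1 with ⟨h1, h2, h3 | ⟨c, _, _, h3⟩⟩ | ⟨h1, h3⟩ | ⟨j, h1, _, c, _, r, _, h3⟩
        · rw [h3] at hi; simp at hi
        · rw [h3] at hi; simp at hi
        · exact ⟨hi.1, h1, h3⟩
        · rw [h3] at hi; simp at hi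
      exact this.mono hw hh (by omega) le_rfl le_rfl
    · have hX : ∀ i ∈ (T.filter fun i => (f i).1 = some none),
          i ∈ T ∧ wd i ≤ lam ∧ cls i = none ∧ f i = (some none, none) := by
        intro i hi
        rw [Finset.mem_filter] at hi
        rcases htri i hi.1 with ⟨h1, h2, h3 | ⟨c, _, _, h3⟩⟩ | ⟨h1, h3⟩ | ⟨j, h1, _, c, _, r, _, h3⟩
        · exact ⟨hi.1, h2, h1, h3⟩
        · rw [h3] at hi; simp at hi
        · rw [h3] at hi; simp at hi
        · rw [h3] at hi; simp at hi
      have : CP ε wd ht 1 (T.filter fun i => (f i).1 = some none) 1 (2 * fmin * t + D * β) := by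
        refine .area _ _ _ ?_ ?_
        · refine (nfdh hw hh 1 lam hlam.le (by linarith) _ _ β le_rfl hβ.le
            (fun i hi => (hX i hi).2.1) (fun i hi => hTβ i (hX i hi).1)).mono hw hh le_rfl ?_
          have hs : ∑ i ∈ (T.filter fun i => (f i).1 = some none), wd i * ht i
              ≤ fmin * t + m * β := by
            refine le_trans (Finset.sum_le_sum_of_subset_of_nonneg ?_
              fun i _ _ => (mul_pos (hw i) (hh i)).le) hls
            intro i hi
            rw [Finset.mem_filter]; exact ⟨(hX i hi).1, (hX i hi).2.2⟩
          have : (∑ i ∈ (T.filter fun i => (f i).1 = some none), wd i * ht i) / (1 - lam)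
              ≤ 2 * (fmin * t + m * β) := by
            rw [div_le_iff₀ (by linarith)]
            have : 0 < fmin * t := by positivity
            have : 0 < m * β := by positivity
            nlinarith
          have h3 : β + 2 * m * β ≤ D * β := by
            have : 1 + 2 * (m : ℝ) ≤ D := by rw [hD]; linarith
            nlinarith
          linarith
        · intro i hi
          refine ⟨(hX i hi).2.1.trans (by simpa using hlame), (hTβ i (hX i hi).1).trans ?_⟩
          have : 0 < fmin * t := by positivity
          have := mul_pos hε this
          linarith
      exact this.mono hw hh (by omega) le_rfl le_rfl
    · have hcV : c ∈ V := by simpa [R] using hb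
      have hLc := hL c
      have hhalf1 : 0 ≤ 1 - 1 / (2 * m : ℝ) := by rw [hhalf]; linarith
      have hlc0 : 0 ≤ (1 - 1 / (2 * m : ℝ)) * L c := mul_nonneg hhalf1 hLc
      let ω : Option (Σ _ : Fin g, ℕ) → ℝ := fun b => match b with
        | none => fc c
        | some x => v x.1
      let B2 : Finset (Option (Σ _ : Fin g, ℕ)) :=
        Finset.insertNone (Finset.univ.sigma fun j => Finset.range (c j : ℕ))
      have hcol : CP ε wd ht (1 * B2.card)
          ((T.filter fun i => (f i).1 = some (some c)).filter fun i => (f i).2 ∈ B2)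
          (∑ b ∈ B2, ω b) (ℓ (some (some c))) := by
        apply CP.vsum (fun i => (f i).2) _ _ (by simp only [ℓ]; positivity) ω 1 B2
        rintro (_ | ⟨j, r⟩) hb2
        · have hX : ∀ i ∈ ((T.filter fun i => (f i).1 = some (some c)).filter
              fun i => (f i).2 = none),
              i ∈ T ∧ wd i ≤ lam ∧ fmin ≤ fc c ∧ cls i = none ∧ f i = (some (some c), none) := by
            intro i hi
            rw [Finset.mem_filter, Finset.mem_filter] at hi
            rcases htri i hi.1.1 with
              ⟨h1, h2, h3 | ⟨c', _, h4, h3⟩⟩ | ⟨h1, h3⟩ | ⟨j, h1, _, c', _, r, _, h3⟩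
            · rw [h3] at hi; simp at hi
            · rw [h3] at hi; simp at hi
              obtain ⟨hi, rfl⟩ := hi
              exact ⟨hi, h2, h4, h1, h3⟩
            · rw [h3] at hi; simp at hi
            · rw [h3] at hi; simp at hi
          by_cases hfm : fmin ≤ fc c
          · have hfl : (1 - 1 / (2 * m : ℝ)) * fc c ≤ fc c - lam := by
              have : 1 / (2 * m : ℝ) * (2 * m * lam) = lam := by field_simp
              have : 1 / (2 * m : ℝ) * (2 * m * lam) ≤ 1 / (2 * m : ℝ) * fc c :=
                mul_le_mul_of_nonneg_left (hlf.trans hfm) (by positivity)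
              linarith
            have hfl2 : lam ≤ fc c - lam := by nlinarith
            have hfcpos : 0 < fc c := hfpos.trans_le hfm
            refine .area _ _ _ ?_ ?_
            · refine (nfdh hw hh (fc c) lam hlam.le (by linarith) _ _ β le_rfl hβ.le
                (fun i hi => (hX i hi).2.1) (fun i hi => hTβ i (hX i hi).1)).mono hw hh le_rfl ?_
              set X := ((T.filter fun i => (f i).1 = some (some c)).filter
                fun i => (f i).2 = none) with hXdef
              have hs : ∑ i ∈ X, wd i * ht i ≤ (1 - 1 / (m : ℝ)) * (L c * fc c) + m * β := by
                refine le_trans (Finset.sum_le_sum_of_subset_of_nonneg ?_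
                  fun i _ _ => (mul_pos (hw i) (hh i)).le) (hlc c hcV hfm)
                intro i hi
                rw [Finset.mem_filter]; exact ⟨(hX i hi).1, (hX i hi).2.2.2⟩
              have : (∑ i ∈ X, wd i * ht i) / (fc c - lam)
                  ≤ (1 - 1 / (2 * m : ℝ)) * L c + m / lam * β := by
                rw [div_le_iff₀ (by linarith)]
                refine hs.trans ?_
                have e1 : (1 - 1 / (m : ℝ)) * (L c * fc c)
                    ≤ (1 - 1 / (2 * m : ℝ)) * L c * (fc c - lam) := by
                  have h1 : (1 - 1 / (2 * m : ℝ)) * L c * ((1 - 1 / (2 * m : ℝ)) * fc c)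
                    ≤ (1 - 1 / (2 * m : ℝ)) * L c * (fc c - lam) :=
                    mul_le_mul_of_nonneg_left hfl hlc0
                  refine le_trans ?_ h1
                  have h2 : (1 - 1 / (m : ℝ)) ≤ (1 - 1 / (2 * m : ℝ)) * (1 - 1 / (2 * m : ℝ)) := by
                    rw [hhalf]; nlinarith [sq_nonneg (1 / (m : ℝ))]
                  have h3 : 0 ≤ L c * fc c := mul_nonneg hLc hfcpos.le
                  nlinarith
                have e2 : m * β ≤ m / lam * β * (fc c - lam) := by
                  have : m * β = m / lam * β * lam := by field_simp
                  rw [this]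
                  exact mul_le_mul_of_nonneg_left hfl2 (by positivity)
                linarith
              have h3 : β + m / lam * β ≤ D * β := by
                have : 1 + m / lam ≤ D := by rw [hD]; linarith
                have := mul_le_mul_of_nonneg_right this hβ.le
                linarith
              simp only [ℓ]
              linarith
            · intro i hi
              refine ⟨(hX i hi).2.1.trans (hle.trans (mul_le_mul_of_nonneg_left hfm hε.le)),
                (hTβ i (hX i hi).1).trans ?_⟩
              have := mul_nonneg hε.le hlc0
              simp only [ℓ]
              linarith
          · have he : ((T.filter fun i => (f i).1 = some (some c)).filter
              fun i => (f i).2 = none) = ∅ := by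
              rw [Finset.eq_empty_iff_forall_notMem]
              intro i hi
              exact hfm (hX i hi).2.2.1
            rw [he]
            exact .empty _ _ _ (hV c hcV) (by simp only [ℓ]; positivity)
        · have hr : r < (c j : ℕ) := by simpa [B2] using hb2
          have hX : ∀ i ∈ ((T.filter fun i => (f i).1 = some (some c)).filter
              fun i => (f i).2 = some ⟨j, r⟩),
              i ∈ T ∧ wd i ≤ v j ∧ cls i = some (some j) ∧ f i = (some (some c), some ⟨j, r⟩) := by
            intro i hi
            rw [Finset.mem_filter, Finset.mem_filter] at hi
            rcases htri i hi.1.1 with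
              ⟨h1, h2, h3 | ⟨c', _, h4, h3⟩⟩ | ⟨h1, h3⟩ | ⟨j', h1, h5, c', _, r', _, h3⟩
            · rw [h3] at hi; simp at hi
            · rw [h3] at hi; simp at hi
            · rw [h3] at hi; simp at hi
            · rw [h3] at hi; simp at hi
              obtain ⟨⟨hi, rfl⟩, rfl, rfl⟩ := hi
              exact ⟨hi, h5, h1, h3⟩
          refine .hor _ _ _ (hv j) (fun i hi => (hX i hi).2.1) ?_
          refine le_trans (Finset.sum_le_sum_of_subset_of_nonneg ?_ fun i _ _ => (hh i).le)
            ((hlj c hcV j r hr).trans ?_)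
          · intro i hi
            rw [Finset.mem_filter]; exact ⟨(hX i hi).1, (hX i hi).2.2⟩
          · simp only [ℓ]
            have : (1 - 1 / (m : ℝ)) * L c ≤ (1 - 1 / (2 * m : ℝ)) * L c :=
              mul_le_mul_of_nonneg_right (by rw [hhalf]; linarith) hLc
            linarith
      have hall : ((T.filter fun i => (f i).1 = some (some c)).filter fun i => (f i).2 ∈ B2)
          = T.filter fun i => (f i).1 = some (some c) := by
        apply Finset.filter_true_of_mem
        intro i hi
        rw [Finset.mem_filter] at hi
        rcases htri i hi.1 with
          ⟨h1, h2, h3 | ⟨c', _, h4, h3⟩⟩ | ⟨h1, h3⟩ | ⟨j', h1, h5, c', _, r', hr', h3⟩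
        · rw [h3]; simp [B2]
        · rw [h3]; simp [B2]
        · rw [h3]; simp [B2]
        · rw [h3] at hi ⊢; simp at hi
          obtain ⟨hi, rfl⟩ := hi
          simpa [B2] using hr'
      rw [hall] at hcol
      have hwid : ∑ b ∈ B2, ω b = 1 := by
        simp only [B2, Finset.sum_insertNone, ω, Finset.sum_sigma, Finset.sum_const,
          Finset.card_range, nsmul_eq_mul, hfc]
        ring
      rw [hwid] at hcol
      refine hcol.mono hw hh ?_ le_rfl le_rfl
      simp only [B2, Finset.card_insertNone, Finset.card_sigma, Finset.card_range, one_mul]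
      have : ∑ j : Fin g, (c j : ℕ) ≤ ∑ j : Fin g, q :=
        Finset.sum_le_sum fun j _ => by have := (c j).2; omega
      simp at this
      omega
  have hall : (T.filter fun i => (f i).1 ∈ R) = T := by
    apply Finset.filter_true_of_mem
    intro i hi
    rcases htri i hi with
      ⟨h1, h2, h3 | ⟨c', hc, h4, h3⟩⟩ | ⟨h1, h3⟩ | ⟨j', h1, h5, c', hc, r', hr', h3⟩
    · rw [h3]; simp [R]
    · rw [h3]; simpa [R] using hc
    · rw [h3]; simp [R]
    · rw [h3]; simpa [R] using hc
  rw [hall] at hmain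
  have hsum : ∑ b ∈ R, ℓ b = ((a + D * β) + ((2 * fmin * t + D * β) +
        ∑ c ∈ V, ((1 - 1 / (2 * m : ℝ)) * L c + D * β))) := by
    simp only [R, Finset.sum_insertNone, ℓ]
  rw [hsum] at hmain
  refine hmain.mono hw hh ?_ le_rfl le_rfl
  apply Nat.mul_le_mul_left
  simp only [R, Finset.card_insertNone]
  omega
end GKP

namespace GKP
variable {ι : Type} [DecidableEq ι] {ε : ℝ} {wd ht : ι → ℝ}

theorem sum_fin_fiber_le (g : ℕ) (c : ι → ℕ) (S : Finset ι) (u : ι → ℝ) (hu : ∀ i, 0 ≤ u i) :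
    ∑ j : Fin g, ∑ i ∈ S.filter (fun i => c i = j), u i ≤ ∑ i ∈ S, u i := by
  have := Finset.sum_range (fun j => ∑ i ∈ S.filter (fun i => c i = j), u i) (n := g)
  rw [← this]
  exact Finset.sum_fiberwise_le_sum_of_sum_fiber_nonneg
    (fun y _ => Finset.sum_nonneg fun i _ => hu i)

set_option maxHeartbeats 4000000 in
theorem KR_aux (hw : ∀ i, 0 < wd i) (hh : ∀ i, 0 < ht i) (hε : 0 < ε)
    (m : ℕ) (hm : 0 < m) (lam fmin D : ℝ) (g q : ℕ)
    (hlam : 0 < lam) (hlf : 2 * m * lam ≤ fmin) (hle : lam ≤ ε * fmin)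
    (hf1 : fmin = 1 / (16 * m)) (hlame : lam ≤ ε)
    (hg : 8 * m < lam * (g + 1)) (hq : 1 ≤ lam * q)
    (hD : D = 1 + m / lam + 1 / ε + 2 * m) (pr : ι → ℝ) (β t : ℝ) (hβ : 0 < β) (ht0 : 0 < t)
    (S : Finset ι) (hS : GT wd ht S 1 t) (hSβ : ∀ i ∈ S, ht i ≤ β) :
    ∃ T ⊆ S, (1 - 1 / (m : ℝ)) * ∑ i ∈ S, pr i ≤ ∑ i ∈ T, pr i ∧
      CP ε wd ht ((g * q + 1) * ((q + 1) ^ g + 2)) T 1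
        ((1 - 1 / (4 * m)) * t + (((q + 1) ^ g + 2 : ℕ) * D) * β) := by
  have hmR : (1 : ℝ) ≤ m := by exact_mod_cast hm
  have hinvm : 0 < 1 / (m : ℝ) := by positivity
  have hinvm1 : 1 / (m : ℝ) ≤ 1 := by rw [div_le_one (by linarith)]; exact hmR
  have hf16 : fmin ≤ 1 / 16 := by
    rw [hf1]; apply div_le_div_of_nonneg_left <;> linarith
  have hfpos : 0 < fmin := by rw [hf1]; positivity
  have hlam1 : lam ≤ 1 := by nlinarith
  obtain ⟨E, _, η, I, hη, hηt, hIS, hIw, hIh⟩ := hS.family hw hh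
  set a := t / (8 * m) with ha
  have ha0 : 0 < a := by positivity
  set Sw := S.filter (fun i => lam < wd i) with hSw
  have hSwS : Sw ⊆ S := Finset.filter_subset _ _
  have hSwl : ∀ i ∈ Sw, lam < wd i := fun i hi => (Finset.mem_filter.1 hi).2
  have hsumw : ∑ i ∈ Sw, ht i < (g + 1) * a := by
    have h1 : lam * ∑ i ∈ Sw, ht i ≤ t := by
      rw [Finset.mul_sum]
      calc ∑ i ∈ Sw, lam * ht i ≤ ∑ i ∈ Sw, wd i * ht i :=
            Finset.sum_le_sum fun i hi => mul_le_mul_of_nonneg_right (hSwl i hi).le (hh i).le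
        _ ≤ ∑ i ∈ S, wd i * ht i := Finset.sum_le_sum_of_subset_of_nonneg hSwS
            fun i _ _ => (mul_pos (hw i) (hh i)).le
        _ ≤ t := by simpa using hS.area_le hw hh
    have h2 : t = (8 * m) * a := by rw [ha]; field_simp
    have h3 : lam * ∑ i ∈ Sw, ht i < lam * ((g + 1) * a) := by
      calc lam * ∑ i ∈ Sw, ht i ≤ (8 * m) * a := by rw [← h2]; exact h1
        _ < lam * (g + 1) * a := mul_lt_mul_of_pos_right hg ha0
        _ = _ := by ring
    exact lt_of_mul_lt_mul_left h3 hlam.le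
  obtain ⟨c, c1, c2, c3, c4⟩ := grouping (wd := wd) β a ha0 hβ.le hh g Sw
    (fun i hi => hSβ i (hSwS hi)) hsumw
  have hv : ∀ j : Fin g, ∃ v : ℝ, 0 ≤ v ∧ (∀ i ∈ Sw, c i = j + 1 → wd i ≤ v) ∧
      (∀ i ∈ Sw, c i = j → v ≤ wd i) := by
    intro j
    rcases (Sw.filter (fun i => c i = j + 1)).eq_empty_or_nonempty with he | hne
    · refine ⟨0, le_rfl, ?_, fun i _ _ => (hw i).le⟩
      intro i hi hc
      exfalso
      have : i ∈ Sw.filter (fun i => c i = j + 1) := Finset.mem_filter.2 ⟨hi, hc⟩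
      rw [he] at this; simp at this
    · obtain ⟨x, hx, hmax⟩ := Finset.exists_max_image _ wd hne
      rw [Finset.mem_filter] at hx
      refine ⟨wd x, (hw x).le, fun i hi hc => hmax i (Finset.mem_filter.2 ⟨hi, hc⟩), ?_⟩
      intro i hi hc
      exact c2 i hi x hx.1 (by omega)
  choose v hv0 hvu hvl using hv
  -- configurations
  have hcnt : ∀ (e : E) (j : Fin g), ((I e ∩ Sw).filter (fun i => c i = j)).card < q + 1 := by
    intro e j
    have h1 : ((((I e ∩ Sw).filter (fun i => c i = j)).card : ℕ) : ℝ) * lam ≤ 1 := by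
      rw [← nsmul_eq_mul, ← Finset.sum_const]
      calc ∑ i ∈ (I e ∩ Sw).filter (fun i => c i = j), lam
          ≤ ∑ i ∈ (I e ∩ Sw).filter (fun i => c i = j), wd i := by
            apply Finset.sum_le_sum
            intro i hi
            rw [Finset.mem_filter, Finset.mem_inter] at hi
            exact (hSwl i hi.1.2).le
        _ ≤ ∑ i ∈ I e, wd i := Finset.sum_le_sum_of_subset_of_nonneg
            ((Finset.filter_subset _ _).trans Finset.inter_subset_left) fun i _ _ => (hw i).le
        _ ≤ 1 := hIw e
    have h2 : ((((I e ∩ Sw).filter (fun i => c i = j)).card : ℕ) : ℝ) ≤ q := by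
      by_contra hcon
      push Not at hcon
      have := mul_lt_mul_of_pos_right hcon hlam
      linarith
    have : ((I e ∩ Sw).filter (fun i => c i = j)).card ≤ q := by exact_mod_cast h2
    omega
  let conf : E → (Fin g → Fin (q + 1)) := fun e j => ⟨_, hcnt e j⟩
  let fc : (Fin g → Fin (q + 1)) → ℝ := fun c => 1 - ∑ j, (c j : ℝ) * v j
  have hconf : ∀ e, ∑ i ∈ (I e).filter (fun i => ¬ lam < wd i), wd i ≤ fc (conf e) := by
    intro e
    have h1 : ∑ j, ((conf e j : ℕ) : ℝ) * v j ≤ ∑ i ∈ I e ∩ Sw, wd i := by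
      refine le_trans ?_ (sum_fin_fiber_le g c (I e ∩ Sw) wd fun i => (hw i).le)
      apply Finset.sum_le_sum
      intro j _
      simp only [conf]
      rw [← nsmul_eq_mul, ← Finset.sum_const]
      apply Finset.sum_le_sum
      intro i hi
      rw [Finset.mem_filter, Finset.mem_inter] at hi
      exact hvl j i hi.1.2 hi.2
    have h2 : I e ∩ Sw = (I e).filter (fun i => lam < wd i) := by
      ext i; simp only [hSw, Finset.mem_inter, Finset.mem_filter]
      constructor
      · rintro ⟨h1, _, h2⟩; exact ⟨h1, h2⟩
      · rintro ⟨h1, h2⟩; exact ⟨h1, hIS e h1, h2⟩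
    have h3 := Finset.sum_filter_add_sum_filter_not (I e) (fun i => lam < wd i) wd
    have h4 := hIw e
    simp only [fc]
    rw [h2] at h1
    linarith
  let L : (Fin g → Fin (q + 1)) → ℝ := fun c => ∑ e, if conf e = c then η e else 0
  have hL : ∀ c, 0 ≤ L c := fun c => Finset.sum_nonneg fun e _ => by
    split_ifs; exacts [hη e, le_rfl]
  let V : Finset (Fin g → Fin (q + 1)) := Finset.univ.filter (fun c => 0 ≤ fc c)
  have hconfV : ∀ e, conf e ∈ V := fun e => by
    simp only [V, Finset.mem_filter, Finset.mem_univ, true_and]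
    exact (Finset.sum_nonneg fun i _ => (hw i).le).trans (hconf e)
  have hLsum : ∀ F : (Fin g → Fin (q + 1)) → ℝ,
      ∑ c ∈ V, L c * F c = ∑ e, η e * F (conf e) := by
    intro F
    simp only [L, Finset.sum_mul]
    rw [Finset.sum_comm]
    apply Finset.sum_congr rfl
    intro e _
    rw [Finset.sum_eq_single (conf e)]
    · simp
    · intro b _ hb; rw [if_neg (Ne.symm hb), zero_mul]
    · intro h; exact absurd (hconfV e) h
  have hLt : ∑ c ∈ V, L c = t := by
    have := hLsum fun _ => 1
    simpa [hηt] using this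
  have hcap : ∀ j : Fin g, ∑ i ∈ Sw.filter (fun i => c i = j), ht i
      ≤ ∑ c ∈ V, L c * (c j : ℕ) := by
    intro j
    rw [hLsum fun c => ((c j : ℕ) : ℝ)]
    calc ∑ i ∈ Sw.filter (fun i => c i = j), ht i
        ≤ ∑ i ∈ Sw.filter (fun i => c i = j), ∑ e, (if i ∈ I e then η e else 0) :=
          Finset.sum_le_sum fun i hi => hIh i (hSwS (Finset.mem_filter.1 hi).1)
      _ = ∑ e, ∑ i ∈ Sw.filter (fun i => c i = j), (if i ∈ I e then η e else 0) :=
          Finset.sum_comm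
      _ = _ := by
          apply Finset.sum_congr rfl
          intro e _
          rw [← Finset.sum_filter, Finset.sum_const, nsmul_eq_mul, mul_comm]
          congr 2
          simp only [conf]
          congr 1
          ext i
          simp only [Finset.mem_filter, Finset.mem_inter]
          tauto
  have hcaps : ∑ i ∈ S.filter (fun i => ¬ lam < wd i), wd i * ht i ≤ ∑ c ∈ V, L c * fc c := by
    rw [hLsum]
    calc ∑ i ∈ S.filter (fun i => ¬ lam < wd i), wd i * ht i
        ≤ ∑ i ∈ S.filter (fun i => ¬ lam < wd i), ∑ e, wd i * (if i ∈ I e then η e else 0) := by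
          apply Finset.sum_le_sum
          intro i hi
          rw [← Finset.mul_sum]
          exact mul_le_mul_of_nonneg_left (hIh i (Finset.mem_filter.1 hi).1) (hw i).le
      _ = ∑ e, ∑ i ∈ S.filter (fun i => ¬ lam < wd i), wd i * (if i ∈ I e then η e else 0) :=
          Finset.sum_comm
      _ = ∑ e, η e * ∑ i ∈ (I e).filter (fun i => ¬ lam < wd i), wd i := by
          apply Finset.sum_congr rfl
          intro e _
          have : ∀ i, wd i * (if i ∈ I e then η e else 0) = if i ∈ I e then η e * wd i else 0 := by
            intro i; split_ifs
            · ring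
            · simp
          simp only [this]
          rw [← Finset.sum_filter, Finset.mul_sum]
          congr 1
          ext i
          simp only [Finset.mem_filter]
          constructor
          · rintro ⟨⟨h1, h2⟩, h3⟩; exact ⟨h3, h2⟩
          · rintro ⟨h1, h2⟩; exact ⟨⟨hIS e h1, h2⟩, h1⟩
      _ ≤ _ := Finset.sum_le_sum fun e _ => mul_le_mul_of_nonneg_left (hconf e) (hη e)
  -- bins
  let cls : ι → Option (Option (Fin g)) := fun i =>
    if lam < wd i then (if h : c i - 1 < g ∧ c i ≠ 0 then some (some ⟨c i - 1, h.1⟩) else some none)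
    else none
  have hcls0 : ∀ i, cls i = none ↔ ¬ lam < wd i := by
    intro i; simp only [cls]; split_ifs <;> simp_all
  have hcls1 : ∀ i ∈ S, cls i = some none → i ∈ Sw ∧ c i = 0 := by
    intro i hi h
    simp only [cls] at h
    split_ifs at h with h1 h2
    · simp at h
    · have hiw : i ∈ Sw := Finset.mem_filter.2 ⟨hi, h1⟩
      refine ⟨hiw, ?_⟩
      have := c1 i hiw
      by_contra h3
      exact h2 ⟨by omega, h3⟩
  have hcls2 : ∀ i ∈ S, ∀ j, cls i = some (some j) → i ∈ Sw ∧ c i = j + 1 := by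
    intro i hi j h
    simp only [cls] at h
    split_ifs at h with h1 h2
    · have hiw : i ∈ Sw := Finset.mem_filter.2 ⟨hi, h1⟩
      refine ⟨hiw, ?_⟩
      simp at h
      rw [← h]
      have := h2.2
      simp only
      omega
    · simp at h
  let B : Option (Option (Fin g)) →
      Finset (Option (Option (Fin g → Fin (q + 1))) × Option (Σ _ : Fin g, ℕ)) := fun x =>
    match x with
    | none => (Finset.insertNone (V.filter (fun c => fmin ≤ fc c))).image (fun b => (some b, none))
    | some none => {(none, none)}
    | some (some j) => (V.sigma fun c => Finset.range (c j : ℕ)).image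
        (fun x => (some (some x.1), some ⟨j, x.2⟩))
  let C : Option (Option (Fin g)) →
      Option (Option (Fin g → Fin (q + 1))) × Option (Σ _ : Fin g, ℕ) → ℝ := fun x b =>
    match x, b.1 with
    | none, some (some c) => L c * fc c
    | none, _ => fmin * t
    | some none, _ => a
    | some (some j), some (some c) => L c
    | some (some j), _ => 0
  let sz : Option (Option (Fin g)) → ι → ℝ := fun x i => match x with
    | none => wd i * ht i
    | some _ => ht i
  have hBs : ∀ j : Fin g, ∑ b ∈ B (some (some j)), C (some (some j)) b
      = ∑ c ∈ V, L c * (c j : ℕ) := by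
    intro j
    simp only [B]
    rw [Finset.sum_image]
    · simp only [C, Finset.sum_sigma, Finset.sum_const, Finset.card_range, nsmul_eq_mul]
      exact Finset.sum_congr rfl fun _ _ => mul_comm _ _
    · rintro ⟨x1, x2⟩ _ ⟨y1, y2⟩ _ h
      simp at h
      obtain ⟨rfl, rfl⟩ := h
      rfl
  have hBn : ∑ c ∈ V, L c * fc c ≤ ∑ b ∈ B none, C none b := by
    simp only [B]
    rw [Finset.sum_image]
    · rw [Finset.sum_insertNone]
      simp only [C]
      rw [← Finset.sum_filter_add_sum_filter_not V (fun c => fmin ≤ fc c), add_comm]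
      apply add_le_add_left
      calc ∑ c ∈ V.filter (fun c => ¬ fmin ≤ fc c), L c * fc c
          ≤ ∑ c ∈ V.filter (fun c => ¬ fmin ≤ fc c), L c * fmin := by
            apply Finset.sum_le_sum
            intro c hc
            rw [Finset.mem_filter] at hc
            exact mul_le_mul_of_nonneg_left (by linarith [hc.2]) (hL c)
        _ ≤ ∑ c ∈ V, L c * fmin := Finset.sum_le_sum_of_subset_of_nonneg
            (Finset.filter_subset _ _) fun c _ _ => mul_nonneg (hL c) hfpos.le
        _ = fmin * t := by rw [← Finset.sum_mul, hLt, mul_comm]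
    · intro x _ y _ h
      simpa using h
  have hCnn : ∀ j, ∀ b ∈ B j, 0 ≤ C j b := by
    rintro (_ | _ | j) b hb
    · simp only [B, Finset.mem_image] at hb
      obtain ⟨x, hx, rfl⟩ := hb
      rcases x with _ | x
      · simp only [C]; positivity
      · simp [V] at hx
        simp only [C]; exact mul_nonneg (hL x) hx.1
    · simp only [C]; positivity
    · simp only [B, Finset.mem_image] at hb
      obtain ⟨x, hx, rfl⟩ := hb
      simp only [C]; exact hL _
  have hclass : ∀ i ∈ S, ∀ j, cls i = some (some j) →
      a ≤ ∑ b ∈ B (some (some j)), C (some (some j)) b := by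
    intro i hi j hj
    rw [hBs]
    obtain ⟨h1, h2⟩ := hcls2 i hi j hj
    exact (c4 i h1 j (by omega)).trans (hcap j)
  have hsumcls : ∀ k : ℕ, ∀ x, (∀ i ∈ S, cls i = some x → i ∈ Sw ∧ c i = k) →
      ∑ i ∈ S.filter (fun i => cls i = some x), ht i ≤ a + β := by
    intro k x hx
    refine le_trans (Finset.sum_le_sum_of_subset_of_nonneg ?_ fun i _ _ => (hh i).le) (c3 k)
    intro i hi
    rw [Finset.mem_filter] at hi ⊢
    exact hx i hi.1 hi.2
  haveI : Inhabited (Option (Option (Fin g → Fin (q + 1))) × Option (Σ _ : Fin g, ℕ)) :=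
    ⟨(none, none)⟩
  obtain ⟨T, hTS, hTp, f, hf, hload⟩ := bins_multi cls sz pr β B m hm C hCnn hβ.le S
    (by
      intro i _
      rcases cls i with _ | x
      · simp only [sz]; exact (mul_pos (hw i) (hh i)).le
      · simp only [sz]; exact (hh i).le)
    (by
      intro i hi
      rcases hx : cls i with _ | x
      · simp only [sz]
        have h1 := (hcls0 i).1 hx
        have h2 := hSβ i hi
        have := hh i
        have := hw i
        nlinarith
      · simp only [sz]; exact hSβ i hi)
    (by
      intro i hi
      rcases hx : cls i with _ | _ | j
      · refine ⟨(some none, none), ?_⟩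
        simp [B]
      · exact ⟨(none, none), by simp [B]⟩
      · have h1 := hclass i hi j hx
        by_contra hne
        rw [Finset.not_nonempty_iff_eq_empty] at hne
        rw [hne, Finset.sum_empty] at h1
        linarith)
    (by
      intro i hi
      rcases hx : cls i with _ | _ | j
      · simp only [sz]
        have : (S.filter fun i' => cls i' = none) = S.filter (fun i => ¬ lam < wd i) :=
          Finset.filter_congr fun i _ => hcls0 i
        rw [this]
        linarith
      · simp only [sz]
        refine (hsumcls 0 none hcls1).trans ?_
        simp [B, C]
      · simp only [sz]
        refine (hsumcls (j + 1) (some j) (fun i hi => hcls2 i hi j)).trans ?_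
        linarith [hclass i hi j hx])
  refine ⟨T, hTS, hTp, ?_⟩
  have hfac : (1 - 1 / (m : ℝ)) ≤ 1 := by linarith
  have hfin := KR_assemble hw hh hε m hm lam fmin D g q hlam hlf hle hf16 hlame hD β t a hβ ht0 ha0
    T (fun i hi => hSβ i (hTS hi)) (fun i hi => (hS.le hw hh i (hTS hi)).1) V v fc L
    (fun c => rfl) hv0 (fun c hc => by simpa [V] using hc) hL cls f
    (by
      intro i hi
      have hfi := hf i hi
      rcases hx : cls i with _ | _ | j
      · left
        refine ⟨rfl, not_lt.1 ((hcls0 i).1 hx), ?_⟩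
        rw [hx] at hfi
        simp only [B, Finset.mem_image] at hfi
        obtain ⟨b, hb, hb2⟩ := hfi
        rcases b with _ | b
        · exact Or.inl hb2.symm
        · right
          simp only [Finset.some_mem_insertNone, Finset.mem_filter] at hb
          exact ⟨b, hb.1, hb.2, hb2.symm⟩
      · right; left
        rw [hx] at hfi
        simp only [B, Finset.mem_singleton] at hfi
        exact ⟨rfl, hfi⟩
      · right; right
        rw [hx] at hfi
        simp only [B, Finset.mem_image, Finset.mem_sigma, Finset.mem_range] at hfi
        obtain ⟨b, hb, hb2⟩ := hfi
        have := hcls2 i (hTS hi) j hx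
        exact ⟨j, rfl, hvu j i this.1 this.2, b.1, hb.1, b.2, hb.2, hb2.symm⟩)
    (by
      have := hload (some none) (none, none) (by simp [B])
      simp only [sz, C] at this
      nlinarith)
    (by
      have := hload none (some none, none) (by simp [B])
      simp only [sz, C] at this
      have : 0 < fmin * t := by positivity
      nlinarith)
    (by
      intro c hc hfm
      exact hload none (some (some c), none) (by simp [B, hc, hfm]))
    (by
      intro c hc j r hr
      exact hload (some (some j)) (some (some c), some ⟨j, r⟩) (by
        simp only [B, Finset.mem_image, Finset.mem_sigma, Finset.mem_range]
        exact ⟨⟨c, r⟩, ⟨hc, hr⟩, rfl⟩))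
  refine hfin.mono hw hh le_rfl le_rfl ?_
  have hDpos : 0 < D := by rw [hD]; positivity
  rw [Finset.sum_add_distrib, ← Finset.mul_sum, hLt, Finset.sum_const, nsmul_eq_mul]
  have hcardV : (V.card : ℝ) ≤ ((q + 1) ^ g : ℕ) := by
    have : V.card ≤ (q + 1) ^ g := by
      refine (Finset.card_le_univ V).trans (le_of_eq ?_)
      simp
    exact_mod_cast this
  have e1 : a + 2 * fmin * t + (1 - 1 / (2 * m : ℝ)) * t = (1 - 1 / (4 * m)) * t := by
    rw [ha, hf1]; field_simp; ring
  have e2 : (V.card : ℝ) * (D * β) ≤ ((q + 1) ^ g : ℕ) * (D * β) :=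
    mul_le_mul_of_nonneg_right hcardV (by positivity)
  push_cast at e2 ⊢
  linarith

theorem KR1 (m : ℕ) (hm : 0 < m) (ε : ℝ) (hε : 0 < ε) (hε1 : ε < 1) : ∃ (K0 : ℝ) (kK : ℕ), 0 < K0 ∧
    ∀ (ι : Type) [DecidableEq ι] (wd ht pr : ι → ℝ), (∀ i, 0 < wd i) → (∀ i, 0 < ht i) →
    ∀ (S : Finset ι) (t β : ℝ), 0 < β → GT wd ht S 1 t → (∀ i ∈ S, ht i ≤ β) →
    ∃ T ⊆ S, (1 - 1 / (m : ℝ)) * ∑ i ∈ S, pr i ≤ ∑ i ∈ T, pr i ∧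
      CP ε wd ht kK T 1 ((1 - 1 / (4 * m)) * t + K0 * β) := by
  have hmR : (1 : ℝ) ≤ m := by exact_mod_cast hm
  set lam := ε / (32 * m ^ 2) with hlam
  have hlam0 : 0 < lam := by positivity
  obtain ⟨g, hg⟩ := exists_nat_gt (8 * m / lam)
  obtain ⟨q, hq⟩ := exists_nat_gt (1 / lam)
  rw [div_lt_iff₀ hlam0] at hg hq
  refine ⟨((q + 1) ^ g + 2 : ℕ) * (1 + m / lam + 1 / ε + 2 * m),
    ((g * q + 1) * ((q + 1) ^ g + 2)), by positivity, ?_⟩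
  intro ι _ wd ht pr hw hh S t β hβ hS hSβ
  have ht0 := (hS.nonneg hw hh).2
  rcases ht0.eq_or_lt with ht1 | ht1
  · have hSe : S = ∅ := by
      rw [Finset.eq_empty_iff_forall_notMem]
      intro i hi
      have := (hS.le hw hh i hi).2
      have := hh i
      linarith
    subst hSe
    refine ⟨∅, le_rfl, by simp, .empty _ _ _ zero_le_one ?_⟩
    rw [← ht1, mul_zero, zero_add]
    positivity
  · refine KR_aux hw hh hε m hm lam (1 / (16 * m)) _ g q hlam0 ?_ ?_ rfl ?_ ?_ ?_ rfl pr β t hβ ht1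
      S hS hSβ
    · rw [hlam]
      have : 2 * (m : ℝ) * (ε / (32 * m ^ 2)) = ε * (1 / (16 * m)) := by field_simp; ring
      rw [this]
      have : 0 < 1 / (16 * (m : ℝ)) := by positivity
      nlinarith
    · rw [hlam, div_eq_mul_one_div]
      apply mul_le_mul_of_nonneg_left _ hε.le
      apply one_div_le_one_div_of_le (by positivity)
      nlinarith
    · rw [hlam, div_le_iff₀ (by positivity)]
      have : (1 : ℝ) ≤ 32 * m ^ 2 := by nlinarith
      nlinarith
    · linarith
    · linarith

/-- The Kenyon-Remila type lemma for a strip of arbitrary width. -/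
theorem KR (m : ℕ) (hm : 0 < m) (ε : ℝ) (hε : 0 < ε) (hε1 : ε < 1) : ∃ (K0 : ℝ) (kK : ℕ), 0 < K0 ∧
    ∀ (ι : Type) [DecidableEq ι] (wd ht pr : ι → ℝ), (∀ i, 0 < wd i) → (∀ i, 0 < ht i) →
    ∀ (S : Finset ι) (W t β : ℝ), 0 < β → GT wd ht S W t → (∀ i ∈ S, ht i ≤ β) →
    ∃ T ⊆ S, (1 - 1 / (m : ℝ)) * ∑ i ∈ S, pr i ≤ ∑ i ∈ T, pr i ∧
      CP ε wd ht kK T W ((1 - 1 / (4 * m)) * t + K0 * β) := by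
  obtain ⟨K0, kK, hK, h⟩ := KR1 m hm ε hε hε1
  refine ⟨K0, kK, hK, ?_⟩
  intro ι _ wd ht pr hw hh S W t β hβ hS hSβ
  obtain ⟨hW0, ht0⟩ := hS.nonneg hw hh
  have hmR : (1 : ℝ) ≤ m := by exact_mod_cast hm
  rcases hW0.eq_or_lt with hW1 | hW1
  · have hSe : S = ∅ := by
      rw [Finset.eq_empty_iff_forall_notMem]
      intro i hi
      have := (hS.le hw hh i hi).1
      have := hw i
      linarith
    subst hSe
    refine ⟨∅, le_rfl, by simp, .empty _ _ _ hW0 ?_⟩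
    have : 1 / (4 * m : ℝ) ≤ 1 := by rw [div_le_one (by positivity)]; linarith
    have : 0 ≤ (1 - 1 / (4 * m : ℝ)) * t := mul_nonneg (by linarith) ht0
    positivity
  · have h1 := hS.scale (1 / W) 1 (by positivity) zero_le_one
    rw [one_mul, one_div_mul_cancel hW1.ne'] at h1
    simp only [one_mul] at h1
    obtain ⟨T, hT, hp, hc⟩ := h ι (fun i => 1 / W * wd i) ht pr
      (fun i => mul_pos (by positivity) (hw i)) hh S t β hβ h1 hSβ
    refine ⟨T, hT, hp, ?_⟩
    have h2 := hc.scale W 1 hW0 zero_le_one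
    have e : ∀ i, W * (1 / W * wd i) = wd i := fun i => by field_simp
    simpa only [e, one_mul, mul_one] using h2
end GKP

namespace GKP

/-- The conclusion of the Kenyon-Remila type lemma with explicit constants. -/
def KRP (ε : ℝ) (m : ℕ) (K0 : ℝ) (kK : ℕ) : Prop :=
  ∀ (ι : Type) [DecidableEq ι] (wd ht pr : ι → ℝ), (∀ i, 0 < wd i) → (∀ i, 0 < ht i) →
    ∀ (S : Finset ι) (W t β : ℝ), 0 < β → GT wd ht S W t → (∀ i ∈ S, ht i ≤ β) →
    ∃ T ⊆ S, (1 - 1 / (m : ℝ)) * ∑ i ∈ S, pr i ≤ ∑ i ∈ T, pr i ∧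
      CP ε wd ht kK T W ((1 - 1 / (4 * m)) * t + K0 * β)

variable {ι : Type} [DecidableEq ι] {ε : ℝ} {wd ht pr : ι → ℝ}

/-- There is a container packing losing a `ρ` fraction of the profit. -/
def Has (ε : ℝ) (wd ht pr : ι → ℝ) (k : ℕ) (ρ : ℝ) (S : Finset ι) (W t : ℝ) : Prop :=
  ∃ T ⊆ S, (1 - ρ) * ∑ i ∈ S, pr i ≤ ∑ i ∈ T, pr i ∧ CP ε wd ht k T W t

theorem Has.empty (k : ℕ) (ρ W t : ℝ) (hW : 0 ≤ W) (ht0 : 0 ≤ t) :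
    Has ε wd ht pr k ρ ∅ W t := ⟨∅, le_rfl, by simp, .empty _ _ _ hW ht0⟩

theorem Has.mono (hw : ∀ i, 0 < wd i) (hh : ∀ i, 0 < ht i) (hp : ∀ i, 0 ≤ pr i)
    {k k' : ℕ} {ρ ρ' : ℝ} {S : Finset ι} {W t W' t' : ℝ} (h : Has ε wd ht pr k ρ S W t)
    (hk : k ≤ k') (hρ : ρ ≤ ρ') (hW : W ≤ W') (ht' : t ≤ t') :
    Has ε wd ht pr k' ρ' S W' t' := by
  obtain ⟨T, h1, h2, h3⟩ := h
  refine ⟨T, h1, le_trans ?_ h2, h3.mono hw hh hk hW ht'⟩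
  have : 0 ≤ ∑ i ∈ S, pr i := Finset.sum_nonneg fun i _ => hp i
  nlinarith

theorem Has.h {k1 k2 : ℕ} {ρ : ℝ} {S1 S2 : Finset ι} {W t1 t2 : ℝ} (hd : Disjoint S1 S2)
    (h1 : Has ε wd ht pr k1 ρ S1 W t1) (h2 : Has ε wd ht pr k2 ρ S2 W t2) :
    Has ε wd ht pr (k1 + k2) ρ (S1 ∪ S2) W (t1 + t2) := by
  obtain ⟨T1, a1, b1, c1⟩ := h1
  obtain ⟨T2, a2, b2, c2⟩ := h2
  refine ⟨T1 ∪ T2, Finset.union_subset_union a1 a2, ?_, .h _ _ _ _ _ _ _ (hd.mono a1 a2) c1 c2⟩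
  rw [Finset.sum_union hd, Finset.sum_union (hd.mono a1 a2)]
  linarith

theorem Has.v {k1 k2 : ℕ} {ρ : ℝ} {S1 S2 : Finset ι} {W1 W2 t : ℝ} (hd : Disjoint S1 S2)
    (h1 : Has ε wd ht pr k1 ρ S1 W1 t) (h2 : Has ε wd ht pr k2 ρ S2 W2 t) :
    Has ε wd ht pr (k1 + k2) ρ (S1 ∪ S2) (W1 + W2) t := by
  obtain ⟨T1, a1, b1, c1⟩ := h1
  obtain ⟨T2, a2, b2, c2⟩ := h2
  refine ⟨T1 ∪ T2, Finset.union_subset_union a1 a2, ?_, .v _ _ _ _ _ _ _ (hd.mono a1 a2) c1 c2⟩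
  rw [Finset.sum_union hd, Finset.sum_union (hd.mono a1 a2)]
  linarith

/-- A stack of good rows. -/
inductive Rows (ε : ℝ) (wd ht pr : ι → ℝ) (k : ℕ) (ρ W : ℝ) : Finset ι → ℝ → Prop
  | nil (R : ℝ) (hR : 0 ≤ R) : Rows ε wd ht pr k ρ W ∅ R
  | cons (S1 S2 : Finset ι) (h R : ℝ) (h1 : GT wd ht S1 W h) (h2 : Has ε wd ht pr k ρ S1 W h)
      (hd : Disjoint S1 S2) (hr : Rows ε wd ht pr k ρ W S2 R) :
      Rows ε wd ht pr k ρ W (S1 ∪ S2) (h + R)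

theorem Rows.nonneg (hw : ∀ i, 0 < wd i) (hh : ∀ i, 0 < ht i) {k : ℕ} {ρ W R : ℝ} {S : Finset ι}
    (h : Rows ε wd ht pr k ρ W S R) : 0 ≤ R := by
  induction h with
  | nil R hR => exact hR
  | cons S1 S2 h R h1 h2 hd hr ih => exact add_nonneg (h1.nonneg hw hh).2 ih

theorem Rows.gt {k : ℕ} {ρ W R : ℝ} {S : Finset ι} (hW : 0 ≤ W)
    (h : Rows ε wd ht pr k ρ W S R) : GT wd ht S W R := by
  induction h with
  | nil R hR => exact .empty _ _ hW hR
  | cons S1 S2 h R h1 h2 hd hr ih => exact .h _ _ _ _ _ hd h1 ih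

theorem Rows.mono (hw : ∀ i, 0 < wd i) (hh : ∀ i, 0 < ht i) (hp : ∀ i, 0 ≤ pr i)
    {k : ℕ} {ρ W W' R : ℝ} {S : Finset ι}
    (h : Rows ε wd ht pr k ρ W S R) (hW : W ≤ W') : Rows ε wd ht pr k ρ W' S R := by
  induction h with
  | nil R hR => exact .nil _ hR
  | cons S1 S2 h R h1 h2 hd hr ih =>
    exact .cons _ _ _ _ (h1.mono hw hh hW le_rfl)
      (h2.mono hw hh hp le_rfl le_rfl hW le_rfl) hd ih

theorem Rows.more (hw : ∀ i, 0 < wd i) (hh : ∀ i, 0 < ht i) {k : ℕ} {ρ W R : ℝ} {S : Finset ι}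
    (h : Rows ε wd ht pr k ρ W S R) : ∀ x, 0 ≤ x → Rows ε wd ht pr k ρ W S (R + x) := by
  induction h with
  | nil R hR => exact fun x hx => .nil _ (by linarith)
  | cons S1 S2 h R h1 h2 hd hr ih =>
    intro x hx
    rw [add_assoc]
    exact .cons _ _ _ _ h1 h2 hd (ih x hx)

theorem Rows.append (hw : ∀ i, 0 < wd i) (hh : ∀ i, 0 < ht i)
    {k : ℕ} {ρ W R R' : ℝ} {S S' : Finset ι}
    (h : Rows ε wd ht pr k ρ W S R) (h' : Rows ε wd ht pr k ρ W S' R') (hd : Disjoint S S') :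
    Rows ε wd ht pr k ρ W (S ∪ S') (R + R') := by
  induction h with
  | nil R hR =>
    rw [Finset.empty_union, add_comm]
    exact h'.more hw hh _ hR
  | cons S1 S2 h R h1 h2 hd' hr ih =>
    rw [Finset.disjoint_union_left] at hd
    rw [Finset.union_assoc, add_assoc]
    exact .cons _ _ _ _ h1 h2 (Finset.disjoint_union_right.2 ⟨hd', hd.1⟩) (ih hd.2)

theorem Rows.extract (hw : ∀ i, 0 < wd i) (hh : ∀ i, 0 < ht i)
    {k : ℕ} {ρ W R : ℝ} {S : Finset ι} (x : ℝ)
    (h : Rows ε wd ht pr k ρ W S R) : (∀ i ∈ S, ht i ≤ x) ∨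
      ∃ S1 S2 h R2, S = S1 ∪ S2 ∧ Disjoint S1 S2 ∧ GT wd ht S1 W h ∧ Has ε wd ht pr k ρ S1 W h ∧
        Rows ε wd ht pr k ρ W S2 R2 ∧ R = h + R2 ∧ x < h := by
  induction h with
  | nil R hR => left; simp
  | cons S1 S2 h R h1 h2 hd hr ih =>
    by_cases hx : x < h
    · right; exact ⟨S1, S2, h, R, rfl, hd, h1, h2, hr, rfl, hx⟩
    · rcases ih with ih | ⟨A, B, h', R2, rfl, hd', a, b, c, rfl, e⟩
      · left
        intro i hi
        rcases Finset.mem_union.1 hi with hi | hi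
        · exact (h1.le hw hh i hi).2.trans (not_lt.1 hx)
        · exact ih i hi
      · right
        rw [Finset.disjoint_union_right] at hd
        refine ⟨A, S1 ∪ B, h', h + R2, ?_, ?_, a, b, .cons _ _ _ _ h1 h2 hd.2 c, by ring, e⟩
        · rw [← Finset.union_assoc, Finset.union_comm S1 A, Finset.union_assoc]
        · exact Finset.disjoint_union_right.2 ⟨hd.1.symm, hd'⟩

theorem Rows.window (hw : ∀ i, 0 < wd i) (hh : ∀ i, 0 < ht i)
    {k : ℕ} {ρ W R : ℝ} {S : Finset ι} (hW : 0 ≤ W) (ν : ℝ) (hν1 : ν ≤ 1)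
    (h : Rows ε wd ht pr k ρ W S R) (J : ℕ) :
    ∃ A B hA R', S = A ∪ B ∧ Disjoint A B ∧ Has ε wd ht pr (J * k) ρ A W hA ∧
      Rows ε wd ht pr k ρ W B R' ∧ hA + R' = R ∧ 0 ≤ hA ∧
      (R' ≤ (1 - ν) ^ J * R ∨ ∀ i ∈ B, ht i ≤ ν * R') := by
  induction J with
  | zero =>
    exact ⟨∅, S, 0, R, by simp, by simp, .empty _ _ _ _ hW le_rfl, h, by ring, le_rfl,
      Or.inl (by simp)⟩
  | succ J ih =>
    obtain ⟨A, B, hA, R', h1, h2, h3, h4, h5, h5', h6⟩ := ih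
    have hdone : (∀ i ∈ B, ht i ≤ ν * R') → ∃ A B hA R', S = A ∪ B ∧ Disjoint A B ∧
      Has ε wd ht pr ((J + 1) * k) ρ A W hA ∧
      Rows ε wd ht pr k ρ W B R' ∧ hA + R' = R ∧ 0 ≤ hA ∧
      (R' ≤ (1 - ν) ^ (J + 1) * R ∨ ∀ i ∈ B, ht i ≤ ν * R') := by
      intro h7
      refine ⟨A, B, hA, R', h1, h2, ?_, h4, h5, h5', Or.inr h7⟩
      obtain ⟨T, a, b, c⟩ := h3
      exact ⟨T, a, b, c.mono hw hh (Nat.mul_le_mul_right _ (Nat.le_succ J)) le_rfl le_rfl⟩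
    rcases h6 with h6 | h6
    · rcases h4.extract hw hh (ν * R') with h7 | ⟨S1, S2, h, R2, e1, e2, e3, e4, e5, e6, e7⟩
      · exact hdone h7
      · subst e1
        rw [Finset.disjoint_union_right] at h2
        refine ⟨A ∪ S1, S2, hA + h, R2, ?_, Finset.disjoint_union_left.2 ⟨h2.2, e2⟩, ?_, e5,
          by linarith, by linarith [(e3.nonneg hw hh).2], Or.inl ?_⟩
        · rw [h1, Finset.union_assoc]
        · rw [add_mul, one_mul]
          exact h3.h h2.1 e4
        · rw [pow_succ]
          have : (1 - ν) * R' ≤ (1 - ν) * ((1 - ν) ^ J * R) :=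
            mul_le_mul_of_nonneg_left h6 (by linarith)
          nlinarith
    · exact hdone h6

theorem Rows.Q (hw : ∀ i, 0 < wd i) (hh : ∀ i, 0 < ht i) (hp : ∀ i, 0 ≤ pr i)
    {m : ℕ} {K0 : ℝ} {kK : ℕ} (hm : 0 < m)
    (hKR : KRP ε m K0 kK) {k : ℕ} {ρ W α ν : ℝ} (hρ : 1 / (m : ℝ) ≤ ρ) (hW : 0 ≤ W) (hW1 : W ≤ 1)
    (hα : 0 < α) (hν : 0 < ν) (hν1 : ν ≤ 1) (hK0ν : K0 * ν ≤ 1 / (4 * m)) (J : ℕ)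
    (hJ : (1 - ν) ^ J ≤ α) (n : ℕ) :
    ∀ {S : Finset ι} {R : ℝ}, Rows ε wd ht pr k ρ W S R → (∀ i ∈ S, α < wd i) →
      Has ε wd ht pr (n * (J * k) + J * k + kK + 1) (ρ + 1 / ((n + 1 : ℕ) : ℝ)) S W R := by
  have hmR : (0 : ℝ) < m := by exact_mod_cast hm
  have hρ0 : 0 ≤ ρ := le_trans (by positivity) hρ
  induction n with
  | zero =>
    intro S R h _
    refine ⟨∅, by simp, ?_, .empty _ _ _ hW (h.nonneg hw hh)⟩
    have : 0 ≤ ∑ i ∈ S, pr i := Finset.sum_nonneg fun i _ => hp i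
    simp
    nlinarith
  | succ n ih =>
    intro S R h hS
    obtain ⟨A, B, hA, R', rfl, h2, h3, h4, h5, h5', h6⟩ := h.window hw hh hW ν hν1 J
    have hR' := h4.nonneg hw hh
    have hpA : 0 ≤ ∑ i ∈ A, pr i := Finset.sum_nonneg fun i _ => hp i
    have hpB : 0 ≤ ∑ i ∈ B, pr i := Finset.sum_nonneg fun i _ => hp i
    have hnpos : (0 : ℝ) < ((n + 1 + 1 : ℕ) : ℝ) := by positivity
    have hn1 : 0 < 1 / ((n + 1 + 1 : ℕ) : ℝ) := by positivity
    rcases h6 with h6 | h6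
    · by_cases hc : ∑ i ∈ A, pr i ≤ (∑ i ∈ A ∪ B, pr i) / ((n + 1 + 1 : ℕ) : ℝ)
      · refine ⟨B, Finset.subset_union_right, ?_, ?_⟩
        · rw [Finset.sum_union h2] at hc ⊢
          rw [div_eq_mul_one_div] at hc
          have := mul_nonneg hρ0 (add_nonneg hpA hpB)
          linarith
        · have hR : R' ≤ α * R := h6.trans (mul_le_mul_of_nonneg_right hJ (by linarith))
          have harea := (h4.gt hW).area_le hw hh
          have h7 : α * ∑ i ∈ B, ht i ≤ α * R := by
            calc α * ∑ i ∈ B, ht i = ∑ i ∈ B, α * ht i := Finset.mul_sum _ _ _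
              _ ≤ ∑ i ∈ B, wd i * ht i := Finset.sum_le_sum fun i hi =>
                  mul_le_mul_of_nonneg_right (hS i (Finset.mem_union_right _ hi)).le (hh i).le
              _ ≤ W * R' := harea
              _ ≤ 1 * R' := mul_le_mul_of_nonneg_right hW1 hR'
              _ ≤ α * R := by linarith
          have : CP ε wd ht 1 B W R := .hor _ _ _ hW
            (fun i hi => ((h4.gt hW).le hw hh i hi).1) (le_of_mul_le_mul_left h7 hα)
          exact this.mono hw hh (by omega) le_rfl le_rfl
      · push Not at hc
        obtain ⟨T, a1, b1, c1⟩ := h3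
        obtain ⟨T2, a2, b2, c2⟩ := ih h4 (fun i hi => hS i (Finset.mem_union_right _ hi))
        refine ⟨T ∪ T2, Finset.union_subset_union a1 a2, ?_,
          (CP.h' c1 c2 (h2.mono a1 a2) rfl rfl rfl).mono hw hh ?_ le_rfl (by linarith)⟩
        · rw [Finset.sum_union (h2.mono a1 a2)]
          rw [Finset.sum_union h2] at hc ⊢
          set PA := ∑ i ∈ A, pr i
          set PB := ∑ i ∈ B, pr i
          rw [div_lt_iff₀ hnpos] at hc
          push_cast at hc b2 ⊢
          have hn0 : (0 : ℝ) ≤ n := by positivity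
          have e1 : PB / (n + 1) ≤ (PA + PB) / (n + 1 + 1) := by
            rw [div_le_div_iff₀ (by positivity) (by positivity)]
            nlinarith
          have e2 : (1 - (ρ + 1 / ((n : ℝ) + 1))) * PB = (1 - ρ) * PB - PB / (n + 1) := by ring
          have e3 : (1 - (ρ + 1 / ((n : ℝ) + 1 + 1))) * (PA + PB)
            = (1 - ρ) * PA + (1 - ρ) * PB - (PA + PB) / (n + 1 + 1) := by ring
          rw [e2] at b2
          rw [e3]
          linarith
        · rw [add_mul, one_mul]; omega
    · -- uniform
      have hB : Has ε wd ht pr kK ρ B W R' := by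
        rcases hR'.eq_or_lt with h0 | h0
        · have : B = ∅ := by
            rw [Finset.eq_empty_iff_forall_notMem]
            intro i hi
            have := h6 i hi
            rw [← h0, mul_zero] at this
            have := hh i
            linarith
          rw [this]
          exact .empty _ _ _ _ hW hR'
        · obtain ⟨T, a, b, c⟩ := hKR ι wd ht pr hw hh B W R' (ν * R') (by positivity) (h4.gt hW) h6
          have : Has ε wd ht pr kK (1 / (m : ℝ)) B W _ := ⟨T, a, b, c⟩
          refine this.mono hw hh hp le_rfl hρ le_rfl ?_
          have := mul_le_mul_of_nonneg_right hK0ν hR'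
          linarith
      refine (h3.h h2 hB).mono hw hh hp ?_ (by linarith) le_rfl (by linarith)
      omega

theorem GT.rows (hw : ∀ i, 0 < wd i) (hh : ∀ i, 0 < ht i) (hp : ∀ i, 0 ≤ pr i)
    {k : ℕ} {ρ α : ℝ} (hα : 0 < α) (hρ : 0 ≤ ρ) (c : ℕ)
    (hR : ∀ (S : Finset ι) (W t : ℝ), GT wd ht S W t → W ≤ c * α →
      W ≤ 1 → (∀ i ∈ S, α < wd i) → Has ε wd ht pr k ρ S W t)
    {S : Finset ι} {a b : ℝ} (h : GT wd ht S a b) : (∀ i ∈ S, α < wd i) → a ≤ (c + 1) * α →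
      a ≤ 1 → Rows ε wd ht pr (k + k + 1) ρ a S b := by
  induction h with
  | empty a b ha hb => intro _ _ _; exact .nil _ hb
  | single i a b ha hb =>
    intro _ _ _
    have := Rows.cons (ε := ε) (pr := pr) (k := k + k + 1) (ρ := ρ) {i} ∅ b 0 (.single i a b ha hb)
      (by
        have hp0 := hp i
        refine ⟨{i}, le_rfl, ?_, ?_⟩
        · simp; nlinarith
        · have : CP ε wd ht 1 {i} a b := .hor _ _ _ ((hw i).le.trans ha) (by simpa) (by simpa)
          exact this.mono hw hh (by omega) le_rfl le_rfl)
      (by simp) (.nil 0 le_rfl)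
    simpa using this
  | v S1 S2 a1 a2 b hd h1 h2 i1 i2 =>
    intro hS ha ha1
    have n1 := h1.nonneg hw hh
    have n2 := h2.nonneg hw hh
    rcases S1.eq_empty_or_nonempty with rfl | ⟨x, hx⟩
    · rw [Finset.empty_union] at hS ⊢
      exact (i2 hS (by linarith) (by linarith)).mono hw hh hp (by linarith)
    rcases S2.eq_empty_or_nonempty with rfl | ⟨y, hy⟩
    · rw [Finset.union_empty] at hS ⊢
      exact (i1 hS (by linarith) (by linarith)).mono hw hh hp (by linarith)
    have hx1 := hS x (Finset.mem_union_left _ hx)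
    have hx2 := (h1.le hw hh x hx).1
    have hy1 := hS y (Finset.mem_union_right _ hy)
    have hy2 := (h2.le hw hh y hy).1
    have r1 := hR S1 a1 b h1 (by linarith) (by linarith)
      fun i hi => hS i (Finset.mem_union_left _ hi)
    have r2 := hR S2 a2 b h2 (by linarith) (by linarith)
      fun i hi => hS i (Finset.mem_union_right _ hi)
    have := Rows.cons (ε := ε) (pr := pr) (k := k + k + 1) (ρ := ρ) (S1 ∪ S2) ∅ b 0
      (.v _ _ _ _ _ hd h1 h2)
      ((r1.v hd r2).mono hw hh hp (by omega) le_rfl le_rfl le_rfl) (by simp) (.nil 0 le_rfl)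
    simpa using this
  | h S1 S2 a b1 b2 hd h1 h2 i1 i2 =>
    intro hS ha ha1
    exact (i1 (fun i hi => hS i (Finset.mem_union_left _ hi)) ha ha1).append hw hh
      (i2 (fun i hi => hS i (Finset.mem_union_right _ hi)) ha ha1) hd

theorem lemmaR (hε : 0 < ε) {m : ℕ} (hm : 0 < m) {K0 : ℝ} {kK : ℕ} (hK0 : 0 < K0)
    (hKR : KRP ε m K0 kK) (α : ℝ) (hα : 0 < α) : ∃ kR : ℕ,
    ∀ (ι : Type) [DecidableEq ι] (wd ht pr : ι → ℝ), (∀ i, 0 < wd i) → (∀ i, 0 < ht i) →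
    (∀ i, 0 ≤ pr i) → ∀ (S : Finset ι) (W t : ℝ), GT wd ht S W t → W ≤ 1 →
    (∀ i ∈ S, α < wd i) → Has ε wd ht pr kR (2 / m) S W t := by
  have hmR : (1 : ℝ) ≤ m := by exact_mod_cast hm
  obtain ⟨C0, hC0⟩ := exists_nat_gt (1 / α)
  rw [div_lt_iff₀ hα] at hC0
  have hC0pos : 0 < C0 := by
    rcases Nat.eq_zero_or_pos C0 with h | h
    · rw [h] at hC0; simp at hC0; linarith
    · exact h
  set D := m * C0 with hD
  have hDpos : 0 < D := Nat.mul_pos hm hC0pos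
  set ν := min 1 (1 / (4 * m) / K0) with hνdef
  have hν : 0 < ν := by positivity
  have hν1 : ν ≤ 1 := min_le_left _ _
  have hK0ν : K0 * ν ≤ 1 / (4 * m) := by
    have : ν ≤ 1 / (4 * m) / K0 := min_le_right _ _
    rw [le_div_iff₀ hK0] at this
    linarith
  obtain ⟨J, hJ⟩ := exists_pow_lt_of_lt_one hα (by linarith : 1 - ν < 1)
  have key : ∀ c : ℕ, ∃ k : ℕ, ∀ (ι : Type) [DecidableEq ι] (wd ht pr : ι → ℝ),
    (∀ i, 0 < wd i) → (∀ i, 0 < ht i) →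
    (∀ i, 0 ≤ pr i) → ∀ (S : Finset ι) (W t : ℝ), GT wd ht S W t → W ≤ c * α → W ≤ 1 →
    (∀ i ∈ S, α < wd i) → Has ε wd ht pr k (1 / m + c / D) S W t := by
    intro c
    induction c with
    | zero =>
      refine ⟨0, ?_⟩
      intro ι _ wd ht pr hw hh hp S W t hS hW _ hSα
      have : S = ∅ := by
        rw [Finset.eq_empty_iff_forall_notMem]
        intro i hi
        have := (hS.le hw hh i hi).1
        have := hSα i hi
        simp at hW
        linarith
      rw [this]
      exact .empty _ _ _ _ (hS.nonneg hw hh).1 (hS.nonneg hw hh).2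
    | succ c ih =>
      obtain ⟨k, hk⟩ := ih
      refine ⟨(D - 1) * (J * (k + k + 1)) + J * (k + k + 1) + kK + 1, ?_⟩
      · intro ι _ wd ht pr hw hh hp S W t hS hW hW1 hSα
        have hrows := hS.rows (ε := ε) hw hh hp (k := k) (ρ := 1 / m + c / D) hα (by positivity) c
          (fun S W t h1 h2 h3 h4 => hk ι wd ht pr hw hh hp S W t h1 h2 h3 h4) hSα
          (by push_cast at hW; exact hW) hW1
        have := Rows.Q hw hh hp hm hKR (by
          have : (0 : ℝ) ≤ c / D := by positivity
          linarith) (hS.nonneg hw hh).1 hW1 hα hν hν1 hK0ν J hJ.le (D - 1) hrows hSα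
        have e : D - 1 + 1 = D := by omega
        rw [e] at this
        have e2 : 1 / (m : ℝ) + c / D + 1 / D = 1 / m + ((c + 1 : ℕ) : ℝ) / D := by
          push_cast; ring
        rw [e2] at this
        exact this
  obtain ⟨k, hk⟩ := key C0
  refine ⟨k, ?_⟩
  intro ι _ wd ht pr hw hh hp S W t hS hW1 hSα
  have := hk ι wd ht pr hw hh hp S W t hS (by linarith) hW1 hSα
  have e : 1 / (m : ℝ) + C0 / D = 2 / m := by
    rw [hD]; push_cast
    have : (C0 : ℝ) ≠ 0 := by positivity
    field_simp; norm_num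
  rwa [e] at this
end GKP

namespace GKP
variable {ι : Type} [DecidableEq ι] {ε : ℝ} {wd ht pr : ι → ℝ}

/-- A box `W × H` from which thin strips are cut one after another, leaving `W' × H'`. -/
inductive Ring (wd ht : ι → ℝ) (β : ℝ) : ℝ → ℝ → ℝ → ℝ → Finset ι → Prop
  | nil (W H : ℝ) : Ring wd ht β W H W H ∅
  | consH (S R : Finset ι) (W H W' H' t : ℝ) (h1 : GT wd ht S W t) (h2 : 0 ≤ t)
      (h3 : ∀ i ∈ S, ht i ≤ β) (hd : Disjoint S R) (hr : Ring wd ht β W H W' H' R) :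
      Ring wd ht β W (H + t) W' H' (S ∪ R)
  | consV (S R : Finset ι) (W H W' H' t : ℝ) (h1 : GT wd ht S t H) (h2 : 0 ≤ t)
      (h3 : ∀ i ∈ S, wd i ≤ β) (hd : Disjoint S R) (hr : Ring wd ht β W H W' H' R) :
      Ring wd ht β (W + t) H W' H' (S ∪ R)

theorem Ring.swap {β W H W' H' : ℝ} {R : Finset ι} (h : Ring wd ht β W H W' H' R) :
    Ring ht wd β H W H' W' R := by
  induction h with
  | nil W H => exact .nil _ _
  | consH S R W H W' H' t h1 h2 h3 hd hr ih => exact .consV _ _ _ _ _ _ _ h1.swap h2 h3 hd ih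
  | consV S R W H W' H' t h1 h2 h3 hd hr ih => exact .consH _ _ _ _ _ _ _ h1.swap h2 h3 hd ih

theorem Ring.le {β W H W' H' : ℝ} {R : Finset ι} (h : Ring wd ht β W H W' H' R) :
    W' ≤ W ∧ H' ≤ H := by
  induction h with
  | nil W H => exact ⟨le_rfl, le_rfl⟩
  | consH S R W H W' H' t h1 h2 h3 hd hr ih => exact ⟨ih.1, by linarith⟩
  | consV S R W H W' H' t h1 h2 h3 hd hr ih => exact ⟨by linarith, ih.2⟩

set_option maxHeartbeats 2000000 in
/-- The three ways in which accumulating the strips of a ring can stop. -/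
theorem Ring.split (hw : ∀ i, 0 < wd i) (hh : ∀ i, 0 < ht i) {β W H W' H' : ℝ} {R : Finset ι}
    (h : Ring wd ht β W H W' H' R) (hW' : 0 ≤ W') (hH' : 0 ≤ H') :
    ∀ dT dU : ℝ, 0 ≤ dT → 0 ≤ dU → ∃ (SH SV : Finset ι) (T U : ℝ), 0 ≤ T ∧ T ≤ dT ∧ 0 ≤ U ∧ U ≤ dU ∧
      GT wd ht SH W T ∧ GT wd ht SV U H ∧ (∀ i ∈ SH, ht i ≤ β) ∧ (∀ i ∈ SV, wd i ≤ β) ∧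
      Disjoint SH SV ∧
      ((R = SH ∪ SV ∧ W' = W - U ∧ H' = H - T) ∨
       (∃ (S1 R1 : Finset ι) (t : ℝ), R = SH ∪ SV ∪ S1 ∪ R1 ∧ Disjoint (SH ∪ SV) S1 ∧
          Disjoint (SH ∪ SV ∪ S1) R1 ∧ GT wd ht S1 (W - U) t ∧ 0 ≤ t ∧ (∀ i ∈ S1, ht i ≤ β) ∧
          dT < T + t ∧ Ring wd ht β (W - U) (H - T - t) W' H' R1) ∨
       (∃ (S1 R1 : Finset ι) (t : ℝ), R = SH ∪ SV ∪ S1 ∪ R1 ∧ Disjoint (SH ∪ SV) S1 ∧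
          Disjoint (SH ∪ SV ∪ S1) R1 ∧ GT wd ht S1 t (H - T) ∧ 0 ≤ t ∧ (∀ i ∈ S1, wd i ≤ β) ∧
          dU < U + t ∧ Ring wd ht β (W - U - t) (H - T) W' H' R1)) := by
  induction h with
  | nil W H =>
    intro dT dU hT hU
    exact ⟨∅, ∅, 0, 0, le_rfl, hT, le_rfl, hU, .empty _ _ hW' le_rfl, .empty _ _ le_rfl hH',
      by simp, by simp, by simp, Or.inl (by simp)⟩
  | consH S R W H W' H' t h1 h2 h3 hd hr ih =>
    intro dT dU hT hU
    have hle := hr.le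
    by_cases htd : t ≤ dT
    · obtain ⟨SH, SV, T, U, a1, a2, a3, a4, a5, a6, a7, a8, a9, a10⟩ :=
        ih hW' hH' (dT - t) dU (by linarith) hU
      have hsub : SH ⊆ R ∧ SV ⊆ R := by
        rcases a10 with ⟨h, _⟩ | ⟨_, _, _, h, _⟩ | ⟨_, _, _, h, _⟩ <;> subst h <;> grind
      rw [Finset.disjoint_left] at hd a9
      refine ⟨S ∪ SH, SV, t + T, U, by linarith, by linarith, a3, a4,
        .h _ _ _ _ _ (by rw [Finset.disjoint_left]; grind) h1 a5,
        a6.mono hw hh le_rfl (by linarith), by grind, a8,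
        by rw [Finset.disjoint_left]; grind, ?_⟩
      rcases a10 with ⟨b1, b2, b3⟩ | ⟨S1, R1, s, b1, b2, b3, b4, b5, b6, b7, b8⟩ |
          ⟨S1, R1, s, b1, b2, b3, b4, b5, b6, b7, b8⟩
      · left
        exact ⟨by rw [b1]; ext; simp only [Finset.mem_union]; tauto, b2, by linarith⟩
      · right; left
        rw [Finset.disjoint_left] at b2 b3
        refine ⟨S1, R1, s, by rw [b1]; ext; simp only [Finset.mem_union]; tauto, by rw [Finset.disjoint_left]; grind,
          by rw [Finset.disjoint_left]; grind, b4, b5, b6, by linarith, ?_⟩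
        have e : H + t - (t + T) - s = H - T - s := by ring
        rw [e]; exact b8
      · right; right
        rw [Finset.disjoint_left] at b2 b3
        have e : H + t - (t + T) = H - T := by ring
        refine ⟨S1, R1, s, by rw [b1]; ext; simp only [Finset.mem_union]; tauto, by rw [Finset.disjoint_left]; grind,
          by rw [Finset.disjoint_left]; grind, by rw [e]; exact b4, b5, b6, by linarith, ?_⟩
        rw [e]; exact b8
    · push Not at htd
      refine ⟨∅, ∅, 0, 0, le_rfl, hT, le_rfl, hU, .empty _ _ (by linarith) le_rfl,
        .empty _ _ le_rfl (by linarith), by simp, by simp, by simp, Or.inr (Or.inl ?_)⟩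
      exact ⟨S, R, t, by simp, by simp, by simpa using hd, by simpa using h1, h2, h3, by simpa using htd,
        by simpa using hr⟩
  | consV S R W H W' H' t h1 h2 h3 hd hr ih =>
    intro dT dU hT hU
    have hle := hr.le
    by_cases htd : t ≤ dU
    · obtain ⟨SH, SV, T, U, a1, a2, a3, a4, a5, a6, a7, a8, a9, a10⟩ :=
        ih hW' hH' dT (dU - t) hT (by linarith)
      have hsub : SH ⊆ R ∧ SV ⊆ R := by
        rcases a10 with ⟨h, _⟩ | ⟨_, _, _, h, _⟩ | ⟨_, _, _, h, _⟩ <;> subst h <;> grind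
      rw [Finset.disjoint_left] at hd a9
      refine ⟨SH, S ∪ SV, T, t + U, a1, a2, by linarith, by linarith,
        a5.mono hw hh (by linarith) le_rfl,
        .v _ _ _ _ _ (by rw [Finset.disjoint_left]; grind) h1 a6, a7, by grind,
        by rw [Finset.disjoint_left]; grind, ?_⟩
      rcases a10 with ⟨b1, b2, b3⟩ | ⟨S1, R1, s, b1, b2, b3, b4, b5, b6, b7, b8⟩ |
          ⟨S1, R1, s, b1, b2, b3, b4, b5, b6, b7, b8⟩
      · left
        exact ⟨by rw [b1]; ext; simp only [Finset.mem_union]; tauto, by linarith, b3⟩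
      · right; left
        rw [Finset.disjoint_left] at b2 b3
        have e : W + t - (t + U) = W - U := by ring
        refine ⟨S1, R1, s, by rw [b1]; ext; simp only [Finset.mem_union]; tauto, by rw [Finset.disjoint_left]; grind,
          by rw [Finset.disjoint_left]; grind, by rw [e]; exact b4, b5, b6, by linarith, ?_⟩
        rw [e]; exact b8
      · right; right
        rw [Finset.disjoint_left] at b2 b3
        refine ⟨S1, R1, s, by rw [b1]; ext; simp only [Finset.mem_union]; tauto, by rw [Finset.disjoint_left]; grind,
          by rw [Finset.disjoint_left]; grind, b4, b5, b6, by linarith, ?_⟩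
        have e : W + t - (t + U) - s = W - U - s := by ring
        rw [e]; exact b8
    · push Not at htd
      refine ⟨∅, ∅, 0, 0, le_rfl, hT, le_rfl, hU, .empty _ _ (by linarith) le_rfl,
        .empty _ _ le_rfl (by linarith), by simp, by simp, by simp, Or.inr (Or.inr ?_)⟩
      exact ⟨S, R, t, by simp, by simp, by simpa using hd, by simpa using h1, h2, h3, by simpa using htd,
        by simpa using hr⟩

/-- Lemma R with explicit constants. -/
def LRP (ε : ℝ) (m : ℕ) (α : ℝ) (kR : ℕ) : Prop :=
  ∀ (ι : Type) [DecidableEq ι] (wd ht pr : ι → ℝ), (∀ i, 0 < wd i) → (∀ i, 0 < ht i) →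
    (∀ i, 0 ≤ pr i) → ∀ (S : Finset ι) (W t : ℝ), GT wd ht S W t → W ≤ 1 →
    (∀ i ∈ S, α < wd i) → Has ε wd ht pr kR (2 / m) S W t

/-- The outcome of processing the ring `R`. -/
def Good (ε : ℝ) (wd ht pr : ι → ℝ) (m k1 : ℕ) (x a b W' H' : ℝ) (R : Finset ι) : Prop :=
  ∃ X S2 S3 : Finset ι, X ⊆ R ∧ S2 ⊆ R ∧ S3 ⊆ R ∧ ∑ i ∈ X, wd i * ht i ≤ x ∧
    (2 - 4 / (m : ℝ)) * ∑ i ∈ R, pr i ≤ ∑ i ∈ S2, pr i + ∑ i ∈ S3, pr i + ∑ i ∈ X, pr i ∧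
    ∀ (k : ℕ) (S0 : Finset ι), Disjoint S0 R → CP ε wd ht k S0 W' H' →
      CP ε wd ht (k + k1) (S0 ∪ S2) a b ∧ CP ε wd ht (k + k1) (S0 ∪ S3) a b

theorem Good.swap {m k1 : ℕ} {x a b W' H' : ℝ} {R : Finset ι}
    (h : Good ε wd ht pr m k1 x a b W' H' R) : Good ε ht wd pr m k1 x b a H' W' R := by
  obtain ⟨X, S2, S3, h1, h2, h3, h4, h5, h6⟩ := h
  refine ⟨X, S2, S3, h1, h2, h3, ?_, h5, fun k S0 hd hc => ?_⟩
  · simpa [mul_comm] using h4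
  · have := h6 k S0 hd hc.swap
    exact ⟨this.1.swap, this.2.swap⟩

/-- Splitting a stack of narrow items into the low and the tall ones. -/
theorem split_low (hp : ∀ i, 0 ≤ pr i) (S : Finset ι) (c : ι → Prop) [DecidablePred c] :
    ∑ i ∈ S, pr i = ∑ i ∈ S.filter c, pr i + ∑ i ∈ S.filter (fun i => ¬ c i), pr i :=
  (Finset.sum_filter_add_sum_filter_not S c pr).symm
end GKP

namespace GKP
variable {ι : Type} [DecidableEq ι] {ε : ℝ} {wd ht pr : ι → ℝ}

theorem CP.frame (hw : ∀ i, 0 < wd i) (hh : ∀ i, 0 < ht i) {kA kB kC k : ℕ} {A B C S : Finset ι}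
    {a U V tA yB yC b : ℝ} (hA : CP ε wd ht kA A a tA) (hB : CP ε wd ht kB B U yB)
    (hC : CP ε wd ht kC C V yC) (ha : U + V ≤ a) (hb1 : tA + yB ≤ b) (hb2 : tA + yC ≤ b)
    (hd1 : Disjoint A (B ∪ C)) (hd2 : Disjoint B C) (hk : kA + (kB + kC) ≤ k)
    (hS : S = A ∪ (B ∪ C)) : CP ε wd ht k S a b := by
  have h1 : CP ε wd ht (kB + kC) (B ∪ C) (U + V) (b - tA) :=
    .v _ _ _ _ _ _ _ hd2 (hB.mono hw hh le_rfl le_rfl (by linarith))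
      (hC.mono hw hh le_rfl le_rfl (by linarith))
  have h2 := hA.h' (h1.mono hw hh le_rfl ha le_rfl) hd1 rfl hS rfl
  exact h2.mono hw hh hk le_rfl (by linarith)

theorem Disjoint_left' {A B : Finset ι} : Disjoint A B ↔ ∀ i, i ∈ A → i ∈ B → False := by
  rw [Finset.disjoint_left]

/-- Treatment of a stack of vertical strips with a slight increase of the height. -/
theorem stackV (hw : ∀ i, 0 < wd i) (hh : ∀ i, 0 < ht i) (hp : ∀ i, 0 ≤ pr i) {m : ℕ} (hm : 0 < m)
    {K0 : ℝ} {kK kR : ℕ} (hK0 : 0 < K0) (hKR : KRP ε m K0 kK) {α β : ℝ} (hLR : LRP ε m α kR)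
    (hβ : 0 < β) {S : Finset ι} {U b : ℝ} (hS : GT wd ht S U b) (hSw : ∀ i ∈ S, wd i ≤ β)
    (hb1 : b ≤ 1) (hband : ∀ i ∈ S, ht i ≤ β ∨ α < ht i) :
    ∃ X T2 T3 : Finset ι, X ⊆ S ∧ T2 ⊆ S ∧ T3 ⊆ S ∧ ∑ i ∈ X, wd i * ht i ≤ K0 * β * (4 * m) ∧
      (2 - 4 / (m : ℝ)) * ∑ i ∈ S, pr i ≤ ∑ i ∈ T2, pr i + ∑ i ∈ T3, pr i + ∑ i ∈ X, pr i ∧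
      CP ε wd ht (kK + kR) T2 U (b + K0 * β) ∧ CP ε wd ht (kK + kR) T3 U (b + K0 * β) := by
  have hmR : (0 : ℝ) < m := by exact_mod_cast hm
  have hn := hS.nonneg hw hh
  have hKβ : 0 < K0 * β := by positivity
  have hpS : 0 ≤ ∑ i ∈ S, pr i := Finset.sum_nonneg fun i _ => hp i
  have hm1 : 0 < 1 / (m : ℝ) := by positivity
  have e2 : 2 / (m : ℝ) = 2 * (1 / m) := by ring
  have e4 : 4 / (m : ℝ) = 4 * (1 / m) := by ring
  by_cases hU : K0 * β * (4 * m) ≤ U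
  · obtain ⟨T, h1, h2, h3⟩ := hKR ι ht wd pr hh hw S b U β hβ hS.swap hSw
    have h4 : CP ε wd ht (kK + kR) T U (b + K0 * β) := by
      refine h3.swap.mono hw hh (by omega) ?_ (by linarith)
      have : K0 * β ≤ 1 / (4 * m) * U := by
        rw [div_mul_eq_mul_div, le_div_iff₀ (by positivity)]; linarith
      linarith
    refine ⟨∅, T, T, by simp, h1, h1, by simpa using by positivity, ?_, h4, h4⟩
    rw [e4]
    simp only [Finset.sum_empty]
    nlinarith
  · push Not at hU
    have hlow := hS.sub hw hh (S.filter fun i => ht i ≤ β) (Finset.filter_subset _ _)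
    have htall := hS.sub hw hh (S.filter fun i => ¬ ht i ≤ β) (Finset.filter_subset _ _)
    obtain ⟨T2, h1, h2, h3⟩ := hKR ι wd ht pr hw hh _ U b β hβ hlow (by simp)
    obtain ⟨T3, g1, g2, g3⟩ := hLR ι ht wd pr hh hw hp _ b U htall.swap hb1 (by
      intro i hi
      simp only [Finset.mem_filter] at hi
      exact (hband i hi.1).resolve_left hi.2)
    refine ⟨S, T2, T3, le_rfl, h1.trans (Finset.filter_subset _ _),
      g1.trans (Finset.filter_subset _ _), ?_, ?_, h3.mono hw hh (by omega) le_rfl ?_,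
      g3.swap.mono hw hh (by omega) le_rfl (by linarith)⟩
    · have := hS.area_le hw hh
      have : U * b ≤ U * 1 := mul_le_mul_of_nonneg_left hb1 hn.1
      linarith
    · have := split_low hp S (fun i => ht i ≤ β)
      have p1 : 0 ≤ ∑ i ∈ S.filter (fun i => ht i ≤ β), pr i := Finset.sum_nonneg fun i _ => hp i
      have p2 : 0 ≤ ∑ i ∈ S.filter (fun i => ¬ ht i ≤ β), pr i := Finset.sum_nonneg fun i _ => hp i
      rw [e4]; rw [e2] at g2
      nlinarith
    · have : 0 ≤ 1 / (4 * (m : ℝ)) * b := by have := hn.2; positivity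
      linarith

set_option maxHeartbeats 4000000 in
theorem inner (hw : ∀ i, 0 < wd i) (hh : ∀ i, 0 < ht i) (hp : ∀ i, 0 ≤ pr i) {m : ℕ} (hm : 0 < m)
    {K0 : ℝ} {kK kR : ℕ} (hK0 : 0 < K0) (hKR : KRP ε m K0 kK) {α β τ : ℝ} (hLR : LRP ε m α kR)
    (hβ : 0 < β) (hτ : 0 < τ) (n : ℕ) : ∀ {a b W' H' : ℝ} {R : Finset ι},
    Ring wd ht β a b W' H' R → 0 ≤ W' → 0 ≤ H' → b ≤ 1 → b ≤ n * τ →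
    (∀ i ∈ R, ht i ≤ β ∨ α < ht i) →
    Good ε wd ht pr m ((n + 1) * (3 * kK + kR)) ((n + 1) * (K0 * β * (4 * m))) a
      (b + τ + (n + 1) * (2 * (K0 * β))) W' H' R := by
  have hmR : (0 : ℝ) < m := by exact_mod_cast hm
  have hKβ : 0 < K0 * β := by positivity
  have hm1 : 0 < 1 / (m : ℝ) := by positivity
  have e4 : 4 / (m : ℝ) = 4 * (1 / m) := by ring
  induction n with
  | zero =>
    intro a b W' H' R hR hW' hH' hb1 hbn hband
    have hle := hR.le
    have hb0 : b ≤ 0 := by simpa using hbn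
    obtain ⟨SH, SV, T, U, a1, a2, a3, a4, a5, a6, a7, a8, a9, a10⟩ :=
      hR.split hw hh hW' hH' τ a hτ.le (by linarith)
    rcases a10 with ⟨b1, b2, b3⟩ | ⟨S1, R1, s, b1, b2, b3, b4, b5, b6, b7, b8⟩ |
          ⟨S1, R1, s, b1, b2, b3, b4, b5, b6, b7, b8⟩
    · have hRe : R = ∅ := by
        rw [Finset.eq_empty_iff_forall_notMem]
        intro i hi
        rw [b1, Finset.mem_union] at hi
        have := hh i
        rcases hi with hi | hi
        · have := (a5.le hw hh i hi).2; linarith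
        · have := (a6.le hw hh i hi).2; linarith
      subst hRe
      refine ⟨∅, ∅, ∅, by simp, by simp, by simp, by simp; positivity, by simp, ?_⟩
      intro k S0 hd hc
      have : CP ε wd ht (k + (0 + 1) * (3 * kK + kR)) S0 a
        (b + τ + ((0 : ℕ) + 1) * (2 * (K0 * β))) := hc.mono hw hh (by omega) hle.1 (by
          push_cast; linarith)
      simpa using this
    · have := b8.le; linarith
    · have := b8.le; linarith
  | succ n ih =>
    intro a b W' H' R hR hW' hH' hb1 hbn hband
    have hle := hR.le
    obtain ⟨SH, SV, T, U, a1, a2, a3, a4, a5, a6, a7, a8, a9, a10⟩ :=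
      hR.split hw hh hW' hH' τ a hτ.le (by linarith)
    have hSVR : SV ⊆ R ∧ SH ⊆ R := by
        rcases a10 with ⟨h, _⟩ | ⟨_, _, _, h, _⟩ | ⟨_, _, _, h, _⟩ <;> subst h <;> grind
    obtain ⟨X, T2, T3, c1, c2, c3, c4, c5, c6, c7⟩ := stackV hw hh hp hm hK0 hKR hLR hβ a6 a8 hb1
      (fun i hi => hband i (hSVR.1 hi))
    obtain ⟨T1, d1, d2, d3⟩ := hKR ι wd ht pr hw hh SH a T β hβ a5 a7
    have d3' := d3.mono hw hh le_rfl le_rfl (show _ ≤ T + K0 * β by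
      have : 0 ≤ 1 / (4 * (m : ℝ)) * T := by positivity
      linarith)
    have pSH : 0 ≤ ∑ i ∈ SH, pr i := Finset.sum_nonneg fun i _ => hp i
    rcases a10 with ⟨b1, b2, b3⟩ | ⟨S1, R1, s, b1, b2, b3, b4, b5, b6, b7, b8⟩ |
          ⟨S1, R1, s, b1, b2, b3, b4, b5, b6, b7, b8⟩
    · subst b1
      refine ⟨X, T1 ∪ T2, T1 ∪ T3, by grind, by grind, by grind, c4.trans ?_, ?_, ?_⟩
      · have : 0 ≤ ((n + 1 : ℕ) : ℝ) * (K0 * β * (4 * m)) := by positivity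
        linarith
      · rw [Finset.sum_union a9, Finset.sum_union (a9.mono d1 c2), Finset.sum_union (a9.mono d1 c3)]
        rw [e4] at *
        nlinarith
      · intro k S0 hd hc
        have : 0 ≤ ((n + 1 : ℕ) : ℝ) * (2 * (K0 * β)) := by positivity
        rw [Finset.disjoint_left] at hd a9
        constructor
        · refine CP.frame hw hh d3' c6 hc (by linarith) (by linarith) (by linarith) ?_ ?_ ?_ ?_
          · rw [Finset.disjoint_left]; grind
          · rw [Finset.disjoint_left]; grind
          · ring_nf; omega
          · ext; simp only [Finset.mem_union]; tauto
        · refine CP.frame hw hh d3' c7 hc (by linarith) (by linarith) (by linarith) ?_ ?_ ?_ ?_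
          · rw [Finset.disjoint_left]; grind
          · rw [Finset.disjoint_left]; grind
          · ring_nf; omega
          · ext; simp only [Finset.mem_union]; tauto
    · subst b1
      have hle8 := b8.le
      obtain ⟨X', S2', S3', f1, f2, f3, f4, f5, f6⟩ := ih b8 hW' hH' (by linarith)
        (by push_cast at hbn; linarith) (fun i hi => hband i (by grind))
      obtain ⟨Q, q1, q2, q3⟩ := hKR ι wd ht pr hw hh S1 (a - U) s β hβ b4 b6
      have q3' := q3.mono hw hh le_rfl le_rfl (show _ ≤ s + K0 * β by
        have : 0 ≤ 1 / (4 * (m : ℝ)) * s := by positivity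
        linarith)
      have pS1 : 0 ≤ ∑ i ∈ S1, pr i := Finset.sum_nonneg fun i _ => hp i
      have b2' := b2
      have b3' := b3
      have a9' := a9
      rw [Finset.disjoint_left] at a9' b2' b3'
      refine ⟨X ∪ X', T1 ∪ T2 ∪ (Q ∪ S2'), T1 ∪ T3 ∪ (Q ∪ S3'), by grind, by grind, by grind,
        ?_, ?_, ?_⟩
      · rw [Finset.sum_union (by rw [Finset.disjoint_left]; grind)]
        push_cast
        linarith
      · have dQ2 : Disjoint Q S2' := by rw [Finset.disjoint_left]; grind
        have dQ3 : Disjoint Q S3' := by rw [Finset.disjoint_left]; grind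
        have dd2 : Disjoint (T1 ∪ T2) (Q ∪ S2') := by rw [Finset.disjoint_left]; grind
        have dd3 : Disjoint (T1 ∪ T3) (Q ∪ S3') := by rw [Finset.disjoint_left]; grind
        have dX : Disjoint X X' := by rw [Finset.disjoint_left]; grind
        rw [Finset.sum_union b3, Finset.sum_union b2, Finset.sum_union a9, Finset.sum_union dX,
          Finset.sum_union dd2, Finset.sum_union dd3, Finset.sum_union dQ2, Finset.sum_union dQ3,
          Finset.sum_union (a9.mono d1 c2), Finset.sum_union (a9.mono d1 c3)]
        rw [e4] at *
        nlinarith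
      · intro k S0 hd hc
        obtain ⟨g2, g3⟩ := f6 k S0 (by rw [Finset.disjoint_left] at hd ⊢; grind) hc
        have : 0 ≤ (n : ℝ) * (K0 * β) := by positivity
        rw [Finset.disjoint_left] at hd
        have r2 := q3'.h' g2 (by rw [Finset.disjoint_left]; grind) rfl rfl rfl
        have r3 := q3'.h' g3 (by rw [Finset.disjoint_left]; grind) rfl rfl rfl
        push_cast
        constructor
        · refine CP.frame hw hh d3' c6 r2 (by linarith) (by linarith) (by linarith) ?_ ?_ ?_ ?_
          · rw [Finset.disjoint_left]; grind
          · rw [Finset.disjoint_left]; grind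
          · ring_nf; omega
          · ext; simp only [Finset.mem_union]; tauto
        · refine CP.frame hw hh d3' c7 r3 (by linarith) (by linarith) (by linarith) ?_ ?_ ?_ ?_
          · rw [Finset.disjoint_left]; grind
          · rw [Finset.disjoint_left]; grind
          · ring_nf; omega
          · ext; simp only [Finset.mem_union]; tauto
    · have := b8.le; linarith
end GKP

namespace GKP
variable {ι : Type} [DecidableEq ι] {ε : ℝ} {wd ht pr : ι → ℝ}

set_option maxHeartbeats 4000000 in
theorem ring_ii (hw : ∀ i, 0 < wd i) (hh : ∀ i, 0 < ht i) (hp : ∀ i, 0 ≤ pr i) {m : ℕ} (hm : 0 < m)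
    {K0 : ℝ} {kK kR : ℕ} (hK0 : 0 < K0) (hKR : KRP ε m K0 kK) {α β τ d : ℝ} (hLR : LRP ε m α kR)
    (hβ : 0 < β) (hτ : 0 < τ) (n : ℕ) (hn : 1 ≤ n * τ)
    (hc1 : τ + (n + 1) * (2 * (K0 * β)) + 2 * (K0 * β) ≤ 1 / (4 * m) * d)
    (hc2 : d + 2 * (K0 * β) ≤ 1 / (4 * m) * α)
    {a b W' H' T U s : ℝ} {R SH SV S1 R1 : Finset ι}
    (hW' : 0 ≤ W') (hH' : 0 ≤ H') (ha1 : a ≤ 1) (hb : α < b) (hb1 : b ≤ 1)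
    (hband : ∀ i ∈ R, ht i ≤ β ∨ α < ht i)
    (a1 : 0 ≤ T) (a2 : T ≤ d) (a3 : 0 ≤ U) (a4 : U ≤ d) (a5 : GT wd ht SH a T)
    (a6 : GT wd ht SV U b) (a7 : ∀ i ∈ SH, ht i ≤ β)
    (a9 : Disjoint SH SV) (b1 : R = SH ∪ SV ∪ S1 ∪ R1) (b2 : Disjoint (SH ∪ SV) S1)
    (b3 : Disjoint (SH ∪ SV ∪ S1) R1) (b4 : GT wd ht S1 (a - U) s) (b5 : 0 ≤ s)
    (b6 : ∀ i ∈ S1, ht i ≤ β) (b7 : d < T + s)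
    (b8 : Ring wd ht β (a - U) (b - T - s) W' H' R1) :
    Good ε wd ht pr m ((n + 1) * (3 * kK + kR) + (3 * kK + kR))
      (2 * d + (n + 1) * (K0 * β * (4 * m))) a b W' H' R := by
  have hmR : (0 : ℝ) < m := by exact_mod_cast hm
  have hKβ : 0 < K0 * β := by positivity
  have hm1 : 0 < 1 / (m : ℝ) := by positivity
  have e4 : 4 / (m : ℝ) = 4 * (1 / m) := by ring
  have e2 : 2 / (m : ℝ) = 2 * (1 / m) := by ring
  subst b1
  have hle8 := b8.le
  have hlow := a6.sub hw hh (SV.filter fun i => ht i ≤ β) (Finset.filter_subset _ _)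
  have htall := a6.sub hw hh (SV.filter fun i => ¬ ht i ≤ β) (Finset.filter_subset _ _)
  obtain ⟨T2, c1, c2, c3⟩ := hKR ι wd ht pr hw hh _ U b β hβ hlow (by simp)
  obtain ⟨T3, g1, g2, g3⟩ := hLR ι ht wd pr hh hw hp _ b U htall.swap hb1 (by
      intro i hi
      simp only [Finset.mem_filter] at hi
      exact (hband i (by grind)).resolve_left hi.2)
  have c1' : T2 ⊆ SV := c1.trans (Finset.filter_subset _ _)
  have g1' : T3 ⊆ SV := g1.trans (Finset.filter_subset _ _)
  obtain ⟨T1, d1, d2, d3⟩ := hKR ι wd ht pr hw hh SH a T β hβ a5 a7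
  obtain ⟨Q, q1, q2, q3⟩ := hKR ι wd ht pr hw hh S1 (a - U) s β hβ b4 b6
  obtain ⟨X', S2', S3', f1, f2, f3, f4, f5, f6⟩ := inner (α := α) hw hh hp hm hK0 hKR hLR hβ hτ n b8
    hW' hH' (by linarith) (by linarith) (fun i hi => hband i (by grind))
  have pS1 : 0 ≤ ∑ i ∈ S1, pr i := Finset.sum_nonneg fun i _ => hp i
  have pSH : 0 ≤ ∑ i ∈ SH, pr i := Finset.sum_nonneg fun i _ => hp i
  have hlowt := split_low hp SV (fun i => ht i ≤ β)
  have p1 : 0 ≤ ∑ i ∈ SV.filter (fun i => ht i ≤ β), pr i := Finset.sum_nonneg fun i _ => hp i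
  have p2 : 0 ≤ ∑ i ∈ SV.filter (fun i => ¬ ht i ≤ β), pr i := Finset.sum_nonneg fun i _ => hp i
  have b2' := b2
  have b3' := b3
  have a9' := a9
  have hs4 : 0 < 1 / (4 * (m : ℝ)) := by positivity
  have hs41 : 1 / (4 * (m : ℝ)) ≤ 1 := by
    rw [div_le_one (by positivity)]
    have : (1 : ℝ) ≤ m := by exact_mod_cast hm
    linarith
  set σ := 1 / (4 * (m : ℝ)) with hσ
  have hσb : σ * α ≤ σ * b := mul_le_mul_of_nonneg_left hb.le hs4.le
  have hσd : σ * d ≤ σ * (T + s) := mul_le_mul_of_nonneg_left b7.le hs4.le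
  have hσT : σ * T ≤ 1 * T := mul_le_mul_of_nonneg_right hs41 a1
  have hσT0 : 0 ≤ σ * T := by positivity
  rw [Finset.disjoint_left] at a9' b2' b3'
  refine ⟨SH ∪ SV ∪ X', T1 ∪ T2 ∪ (Q ∪ S2'), T3 ∪ (Q ∪ S3'), by grind, by grind, by grind,
        ?_, ?_, ?_⟩
  · rw [Finset.sum_union (by rw [Finset.disjoint_left]; grind), Finset.sum_union a9]
    have := a5.area_le hw hh
    have := a6.area_le hw hh
    have : a * T ≤ 1 * T := mul_le_mul_of_nonneg_right ha1 a1
    have : U * b ≤ U * 1 := mul_le_mul_of_nonneg_left hb1 a3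
    linarith
  · have dQ2 : Disjoint Q S2' := by rw [Finset.disjoint_left]; grind
    have dQ3 : Disjoint Q S3' := by rw [Finset.disjoint_left]; grind
    have dd2 : Disjoint (T1 ∪ T2) (Q ∪ S2') := by rw [Finset.disjoint_left]; grind
    have dd3 : Disjoint T3 (Q ∪ S3') := by rw [Finset.disjoint_left]; grind
    have dX : Disjoint (SH ∪ SV) X' := by rw [Finset.disjoint_left]; grind
    rw [Finset.sum_union b3, Finset.sum_union b2, Finset.sum_union dX, Finset.sum_union a9,
          Finset.sum_union dd2, Finset.sum_union dd3, Finset.sum_union dQ2, Finset.sum_union dQ3,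
          Finset.sum_union (a9.mono d1 c1')]
    rw [e4] at *
    rw [e2] at *
    nlinarith
  · intro k S0 hd hc
    obtain ⟨g2, g3'⟩ := f6 k S0 (by rw [Finset.disjoint_left] at hd ⊢; grind) hc
    rw [Finset.disjoint_left] at hd
    have r2 := q3.h' g2 (by rw [Finset.disjoint_left]; grind) rfl rfl rfl
    have r3 := q3.h' g3' (by rw [Finset.disjoint_left]; grind) rfl rfl rfl
    constructor
    · refine CP.frame hw hh d3 c3 r2 (by linarith) (by linarith) (by linarith) ?_ ?_ ?_ ?_
      · rw [Finset.disjoint_left]; grind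
      · rw [Finset.disjoint_left]; grind
      · ring_nf; omega
      · ext; simp only [Finset.mem_union]; tauto
    · refine CP.frame hw hh (CP.empty 0 a 0 (by linarith) le_rfl) g3.swap r3 (by linarith)
        (by linarith) (by linarith) ?_ ?_ ?_ ?_
      · simp
      · rw [Finset.disjoint_left]; grind
      · ring_nf; omega
      · ext; simp only [Finset.mem_union, Finset.notMem_empty]; tauto

set_option maxHeartbeats 4000000 in
theorem ringLemma (hw : ∀ i, 0 < wd i) (hh : ∀ i, 0 < ht i) (hp : ∀ i, 0 ≤ pr i) {m : ℕ} (hm : 0 < m)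
    {K0 : ℝ} {kK kR : ℕ} (hK0 : 0 < K0) (hKR : KRP ε m K0 kK) {α β τ d : ℝ} (hLR : LRP ε m α kR)
    (hβ : 0 < β) (hτ : 0 < τ) (hd0 : 0 < d) (n : ℕ) (hn : 1 ≤ n * τ)
    (hc1 : τ + (n + 1) * (2 * (K0 * β)) + 2 * (K0 * β) ≤ 1 / (4 * m) * d)
    (hc2 : d + 2 * (K0 * β) ≤ 1 / (4 * m) * α)
    {a b W' H' : ℝ} {R : Finset ι} (hR : Ring wd ht β a b W' H' R)
    (hW' : 0 ≤ W') (hH' : 0 ≤ H') (ha : α < a) (ha1 : a ≤ 1) (hb : α < b) (hb1 : b ≤ 1)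
    (hbandw : ∀ i ∈ R, wd i ≤ β ∨ α < wd i) (hband : ∀ i ∈ R, ht i ≤ β ∨ α < ht i) :
    Good ε wd ht pr m ((n + 1) * (3 * kK + kR) + (3 * kK + kR))
      (2 * d + (n + 1) * (K0 * β * (4 * m))) a b W' H' R := by
  have hmR : (0 : ℝ) < m := by exact_mod_cast hm
  have hKβ : 0 < K0 * β := by positivity
  have hm1 : 0 < 1 / (m : ℝ) := by positivity
  have e4 : 4 / (m : ℝ) = 4 * (1 / m) := by ring
  have e2 : 2 / (m : ℝ) = 2 * (1 / m) := by ring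
  obtain ⟨SH, SV, T, U, a1, a2, a3, a4, a5, a6, a7, a8, a9, a10⟩ :=
      hR.split hw hh hW' hH' d d hd0.le hd0.le
  rcases a10 with ⟨b1, b2, b3⟩ | ⟨S1, R1, s, b1, b2, b3, b4, b5, b6, b7, b8⟩ |
          ⟨S1, R1, s, b1, b2, b3, b4, b5, b6, b7, b8⟩
  · subst b1
    have hlow := a6.sub hw hh (SV.filter fun i => ht i ≤ β) (Finset.filter_subset _ _)
    have htall := a6.sub hw hh (SV.filter fun i => ¬ ht i ≤ β) (Finset.filter_subset _ _)
    obtain ⟨T2, c1, c2, c3⟩ := hKR ι wd ht pr hw hh _ U b β hβ hlow (by simp)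
    obtain ⟨T3, g1, g2, g3⟩ := hLR ι ht wd pr hh hw hp _ b U htall.swap hb1 (by
      intro i hi
      simp only [Finset.mem_filter] at hi
      exact (hband i (by grind)).resolve_left hi.2)
    have c1' : T2 ⊆ SV := c1.trans (Finset.filter_subset _ _)
    have g1' : T3 ⊆ SV := g1.trans (Finset.filter_subset _ _)
    have hlow2 := a5.sub hw hh (SH.filter fun i => wd i ≤ β) (Finset.filter_subset _ _)
    have htall2 := a5.sub hw hh (SH.filter fun i => ¬ wd i ≤ β) (Finset.filter_subset _ _)
    obtain ⟨T4, u1, u2, u3⟩ := hKR ι ht wd pr hh hw _ T a β hβ hlow2.swap (by simp)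
    obtain ⟨T5, v1, v2, v3⟩ := hLR ι wd ht pr hw hh hp _ a T htall2 ha1 (by
      intro i hi
      simp only [Finset.mem_filter] at hi
      exact (hbandw i (by grind)).resolve_left hi.2)
    have u1' : T4 ⊆ SH := u1.trans (Finset.filter_subset _ _)
    have v1' : T5 ⊆ SH := v1.trans (Finset.filter_subset _ _)
    have hlowt := split_low hp SV (fun i => ht i ≤ β)
    have p1 : 0 ≤ ∑ i ∈ SV.filter (fun i => ht i ≤ β), pr i := Finset.sum_nonneg fun i _ => hp i
    have p2 : 0 ≤ ∑ i ∈ SV.filter (fun i => ¬ ht i ≤ β), pr i := Finset.sum_nonneg fun i _ => hp i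
    have hlowt2 := split_low hp SH (fun i => wd i ≤ β)
    have p3 : 0 ≤ ∑ i ∈ SH.filter (fun i => wd i ≤ β), pr i := Finset.sum_nonneg fun i _ => hp i
    have p4 : 0 ≤ ∑ i ∈ SH.filter (fun i => ¬ wd i ≤ β), pr i := Finset.sum_nonneg fun i _ => hp i
    have a9' := a9
    have hs4 : 0 < 1 / (4 * (m : ℝ)) := by positivity
    set σ := 1 / (4 * (m : ℝ)) with hσ
    have hσb : σ * α ≤ σ * b := mul_le_mul_of_nonneg_left hb.le hs4.le
    have hσa : σ * α ≤ σ * a := mul_le_mul_of_nonneg_left ha.le hs4.le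
    rw [Finset.disjoint_left] at a9'
    refine ⟨SH ∪ SV, T5 ∪ T2, T3 ∪ T4, le_rfl, by grind, by grind, ?_, ?_, ?_⟩
    · rw [Finset.sum_union a9]
      have := a5.area_le hw hh
      have := a6.area_le hw hh
      have : a * T ≤ 1 * T := mul_le_mul_of_nonneg_right ha1 a1
      have : U * b ≤ U * 1 := mul_le_mul_of_nonneg_left hb1 a3
      have : 0 ≤ ((n : ℝ) + 1) * (K0 * β * (4 * m)) := by positivity
      linarith
    · rw [Finset.sum_union (a9.mono v1' c1'), Finset.sum_union (a9.symm.mono g1' u1'),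
        Finset.sum_union a9]
      rw [e4]
      rw [e2] at g2 v2
      nlinarith
    · intro k S0 hd hc
      rw [Finset.disjoint_left] at hd
      constructor
      · refine CP.frame hw hh v3 c3 hc (by linarith) (by linarith) (by linarith) ?_ ?_ ?_ ?_
        · rw [Finset.disjoint_left]; grind
        · rw [Finset.disjoint_left]; grind
        · ring_nf; omega
        · ext; simp only [Finset.mem_union]; tauto
      · refine CP.swap (CP.frame hh hw g3 u3 hc.swap (by linarith) (by linarith) (by linarith)
          ?_ ?_ ?_ ?_)
        · rw [Finset.disjoint_left]; grind
        · rw [Finset.disjoint_left]; grind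
        · ring_nf; omega
        · ext; simp only [Finset.mem_union]; tauto
  · exact ring_ii hw hh hp hm hK0 hKR hLR hβ hτ n hn hc1 hc2 hW' hH' ha1 hb hb1 hband a1 a2 a3 a4 a5
      a6 a7 a9 b1 b2 b3 b4 b5 b6 b7 b8
  · have e : SH ∪ SV = SV ∪ SH := Finset.union_comm _ _
    rw [e] at b1 b2 b3
    exact (ring_ii hh hw hp hm hK0 hKR hLR hβ hτ n hn hc1 hc2 hH' hW' hb1 ha ha1 hbandw a3 a4 a1 a2
      a6.swap a5.swap a8 a9.symm b1 b2 b3 b4.swap b5 b6 b7 b8.swap).swap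
end GKP

namespace GKP
variable {ι : Type} [DecidableEq ι] {ε : ℝ} {wd ht pr : ι → ℝ}

/-- The terminal situations of a thick ring. -/
def Term (wd ht : ι → ℝ) (α : ℝ) (S0 : Finset ι) (W' H' : ℝ) : Prop :=
  S0 = ∅ ∨ (∃ i, S0 = {i} ∧ wd i ≤ W' ∧ ht i ≤ H') ∨
  (∃ (A B : Finset ι) (a1 a2 : ℝ), S0 = A ∪ B ∧ Disjoint A B ∧ W' = a1 + a2 ∧ α < a1 ∧ α < a2 ∧
    α < H' ∧ GT wd ht A a1 H' ∧ GT wd ht B a2 H') ∨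
  (∃ (A B : Finset ι) (b1 b2 : ℝ), S0 = A ∪ B ∧ Disjoint A B ∧ H' = b1 + b2 ∧ α < b1 ∧ α < b2 ∧
    α < W' ∧ GT wd ht A W' b1 ∧ GT wd ht B W' b2)

set_option maxHeartbeats 2000000 in
theorem thickRing (hw : ∀ i, 0 < wd i) (hh : ∀ i, 0 < ht i) {α β : ℝ} (hα : 0 < α)
    {S : Finset ι} {a b : ℝ} (h : GT wd ht S a b) : α < a → α < b →
    (∀ i ∈ S, wd i ≤ β ∨ α < wd i) → (∀ i ∈ S, ht i ≤ β ∨ α < ht i) →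
    ∃ (R S0 : Finset ι) (W' H' : ℝ), S = S0 ∪ R ∧ Disjoint S0 R ∧ Ring wd ht β a b W' H' R ∧
      0 ≤ W' ∧ 0 ≤ H' ∧ Term wd ht α S0 W' H' := by
  induction h with
  | empty a b ha hb =>
    intro _ _ _ _
    exact ⟨∅, ∅, a, b, by simp, by simp, .nil _ _, ha, hb, Or.inl rfl⟩
  | single i a b ha hb =>
    intro _ _ _ _
    exact ⟨∅, {i}, a, b, by simp, by simp, .nil _ _, (hw i).le.trans ha, (hh i).le.trans hb,
      Or.inr (Or.inl ⟨i, rfl, ha, hb⟩)⟩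
  | v S1 S2 a1 a2 b hd h1 h2 i1 i2 =>
    intro ha hb hbw hbh
    have n1 := h1.nonneg hw hh
    have n2 := h2.nonneg hw hh
    have thin : ∀ (A : Finset ι) (w : ℝ), GT wd ht A w b → A ⊆ S1 ∪ S2 → w ≤ α →
        ∀ i ∈ A, wd i ≤ β := by
      intro A w hA hsub hwα i hi
      have := (hA.le hw hh i hi).1
      exact (hbw i (hsub hi)).resolve_right (by linarith)
    by_cases ha1 : α < a1 <;> by_cases ha2 : α < a2
    · exact ⟨∅, S1 ∪ S2, a1 + a2, b, by simp, by simp, .nil _ _, by linarith, by linarith,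
        Or.inr (Or.inr (Or.inl ⟨S1, S2, a1, a2, rfl, hd, rfl, ha1, ha2, hb, h1, h2⟩))⟩
    · push Not at ha2
      obtain ⟨R, S0, W', H', g1, g2, g3, g4, g5, g6⟩ := i1 ha1 hb (fun i hi => hbw i (by simp [hi]))
        (fun i hi => hbh i (by simp [hi]))
      subst g1
      refine ⟨S2 ∪ R, S0, W', H', ?_, ?_, .consV _ _ _ _ _ _ _ h2 n2.1
        (thin S2 a2 h2 Finset.subset_union_right ha2) ?_ g3, g4, g5, g6⟩
      · ext; simp only [Finset.mem_union]; tauto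
      · rw [Finset.disjoint_left] at *; grind
      · rw [Finset.disjoint_left] at *; grind
    · push Not at ha1
      obtain ⟨R, S0, W', H', g1, g2, g3, g4, g5, g6⟩ := i2 ha2 hb (fun i hi => hbw i (by simp [hi]))
        (fun i hi => hbh i (by simp [hi]))
      subst g1
      rw [add_comm a1 a2]
      refine ⟨S1 ∪ R, S0, W', H', ?_, ?_, .consV _ _ _ _ _ _ _ h1 n1.1
        (thin S1 a1 h1 Finset.subset_union_left ha1) ?_ g3, g4, g5, g6⟩
      · ext; simp only [Finset.mem_union]; tauto
      · rw [Finset.disjoint_left] at *; grind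
      · rw [Finset.disjoint_left] at *; grind
    · push Not at ha1 ha2
      refine ⟨S1 ∪ S2, ∅, 0, b, by simp, by simp, ?_, le_rfl, by linarith, Or.inl rfl⟩
      have := Ring.consV (S1 ∪ S2) ∅ 0 b 0 b (a1 + a2) (.v _ _ _ _ _ hd h1 h2) (by linarith)
        (fun i hi => by
          rcases Finset.mem_union.1 hi with hi | hi
          · exact thin S1 a1 h1 (by simp) ha1 i hi
          · exact thin S2 a2 h2 (by simp) ha2 i hi) (by simp) (.nil (β := β) _ _)
      simpa using this
  | h S1 S2 a b1 b2 hd h1 h2 i1 i2 =>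
    intro ha hb hbw hbh
    have n1 := h1.nonneg hw hh
    have n2 := h2.nonneg hw hh
    have thin : ∀ (A : Finset ι) (t : ℝ), GT wd ht A a t → A ⊆ S1 ∪ S2 → t ≤ α →
        ∀ i ∈ A, ht i ≤ β := by
      intro A w hA hsub hwα i hi
      have := (hA.le hw hh i hi).2
      exact (hbh i (hsub hi)).resolve_right (by linarith)
    by_cases hb1 : α < b1 <;> by_cases hb2 : α < b2
    · exact ⟨∅, S1 ∪ S2, a, b1 + b2, by simp, by simp, .nil _ _, by linarith, by linarith,
        Or.inr (Or.inr (Or.inr ⟨S1, S2, b1, b2, rfl, hd, rfl, hb1, hb2, ha, h1, h2⟩))⟩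
    · push Not at hb2
      obtain ⟨R, S0, W', H', g1, g2, g3, g4, g5, g6⟩ := i1 ha hb1 (fun i hi => hbw i (by simp [hi]))
        (fun i hi => hbh i (by simp [hi]))
      subst g1
      refine ⟨S2 ∪ R, S0, W', H', ?_, ?_, .consH _ _ _ _ _ _ _ h2 n2.2
        (thin S2 b2 h2 Finset.subset_union_right hb2) ?_ g3, g4, g5, g6⟩
      · ext; simp only [Finset.mem_union]; tauto
      · rw [Finset.disjoint_left] at *; grind
      · rw [Finset.disjoint_left] at *; grind
    · push Not at hb1
      obtain ⟨R, S0, W', H', g1, g2, g3, g4, g5, g6⟩ := i2 ha hb2 (fun i hi => hbw i (by simp [hi]))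
        (fun i hi => hbh i (by simp [hi]))
      subst g1
      rw [add_comm b1 b2]
      refine ⟨S1 ∪ R, S0, W', H', ?_, ?_, .consH _ _ _ _ _ _ _ h1 n1.2
        (thin S1 b1 h1 Finset.subset_union_left hb1) ?_ g3, g4, g5, g6⟩
      · ext; simp only [Finset.mem_union]; tauto
      · rw [Finset.disjoint_left] at *; grind
      · rw [Finset.disjoint_left] at *; grind
    · push Not at hb1 hb2
      refine ⟨S1 ∪ S2, ∅, a, 0, by simp, by simp, ?_, by linarith, le_rfl, Or.inl rfl⟩
      have := Ring.consH (S1 ∪ S2) ∅ a 0 a 0 (b1 + b2) (.h _ _ _ _ _ hd h1 h2) (by linarith)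
        (fun i hi => by
          rcases Finset.mem_union.1 hi with hi | hi
          · exact thin S1 b1 h1 (by simp) hb1 i hi
          · exact thin S2 b2 h2 (by simp) hb2 i hi) (by simp) (.nil (β := β) _ _)
      simpa using this

/-- The three candidate solutions for a box. -/
def Three (ε : ℝ) (wd ht pr : ι → ℝ) (m k : ℕ) (x : ℝ) (S : Finset ι) (a b : ℝ) : Prop :=
  ∃ X S2 S3 : Finset ι, X ⊆ S ∧ S2 ⊆ S ∧ S3 ⊆ S ∧ ∑ i ∈ X, wd i * ht i ≤ x ∧
    (2 - 4 / (m : ℝ)) * ∑ i ∈ S, pr i ≤ ∑ i ∈ S2, pr i + ∑ i ∈ S3, pr i + ∑ i ∈ X, pr i ∧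
    CP ε wd ht k S2 a b ∧ CP ε wd ht k S3 a b

theorem Three.v {m k1 k2 : ℕ} {x1 x2 a1 a2 b : ℝ} {A B : Finset ι} (hd : Disjoint A B)
    (h1 : Three ε wd ht pr m k1 x1 A a1 b) (h2 : Three ε wd ht pr m k2 x2 B a2 b) :
    Three ε wd ht pr m (k1 + k2) (x1 + x2) (A ∪ B) (a1 + a2) b := by
  obtain ⟨X, S2, S3, c1, c2, c3, c4, c5, c6, c7⟩ := h1
  obtain ⟨Y, T2, T3, d1, d2, d3, d4, d5, d6, d7⟩ := h2
  refine ⟨X ∪ Y, S2 ∪ T2, S3 ∪ T3, Finset.union_subset_union c1 d1,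
    Finset.union_subset_union c2 d2, Finset.union_subset_union c3 d3, ?_, ?_,
    .v _ _ _ _ _ _ _ (hd.mono c2 d2) c6 d6, .v _ _ _ _ _ _ _ (hd.mono c3 d3) c7 d7⟩
  · rw [Finset.sum_union (hd.mono c1 d1)]; linarith
  · rw [Finset.sum_union (hd.mono c1 d1), Finset.sum_union (hd.mono c2 d2),
      Finset.sum_union (hd.mono c3 d3), Finset.sum_union hd]; linarith

theorem Three.swap {m k : ℕ} {x a b : ℝ} {S : Finset ι}
    (h : Three ε wd ht pr m k x S a b) : Three ε ht wd pr m k x S b a := by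
  obtain ⟨X, S2, S3, h1, h2, h3, h4, h5, h6, h7⟩ := h
  refine ⟨X, S2, S3, h1, h2, h3, ?_, h5, h6.swap, h7.swap⟩
  simpa [mul_comm] using h4

theorem Three.ring {m k k1 : ℕ} {x y a b W' H' : ℝ} {S0 R : Finset ι} (hd : Disjoint S0 R)
    (h1 : Three ε wd ht pr m k x S0 W' H') (h2 : Good ε wd ht pr m k1 y a b W' H' R) :
    Three ε wd ht pr m (k + k1) (x + y) (S0 ∪ R) a b := by
  obtain ⟨X, S2, S3, c1, c2, c3, c4, c5, c6, c7⟩ := h1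
  obtain ⟨Y, T2, T3, d1, d2, d3, d4, d5, d6⟩ := h2
  refine ⟨X ∪ Y, S2 ∪ T2, S3 ∪ T3, Finset.union_subset_union c1 d1,
    Finset.union_subset_union c2 d2, Finset.union_subset_union c3 d3, ?_, ?_,
    (d6 k S2 (hd.mono_left c2) c6).1, (d6 k S3 (hd.mono_left c3) c7).2⟩
  · rw [Finset.sum_union (hd.mono c1 d1)]; linarith
  · rw [Finset.sum_union (hd.mono c1 d1), Finset.sum_union (hd.mono c2 d2),
      Finset.sum_union (hd.mono c3 d3), Finset.sum_union hd]; linarith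

theorem Three.mono (hw : ∀ i, 0 < wd i) (hh : ∀ i, 0 < ht i) {m k k' : ℕ} {x x' a b : ℝ}
    {S : Finset ι} (h : Three ε wd ht pr m k x S a b) (hk : k ≤ k') (hx : x ≤ x') :
    Three ε wd ht pr m k' x' S a b := by
  obtain ⟨X, S2, S3, h1, h2, h3, h4, h5, h6, h7⟩ := h
  exact ⟨X, S2, S3, h1, h2, h3, h4.trans hx, h5, h6.mono hw hh hk le_rfl le_rfl,
    h7.mono hw hh hk le_rfl le_rfl⟩

set_option maxHeartbeats 2000000 in
theorem three_main (hw : ∀ i, 0 < wd i) (hh : ∀ i, 0 < ht i) (hp : ∀ i, 0 ≤ pr i) {m : ℕ} {kr : ℕ}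
    {α β x0 : ℝ} (hα : 0 < α) (hx0 : 0 ≤ x0)
    (hRL : ∀ {a b W' H' : ℝ} {R : Finset ι}, Ring wd ht β a b W' H' R → 0 ≤ W' → 0 ≤ H' →
      α < a → a ≤ 1 → α < b → b ≤ 1 → (∀ i ∈ R, wd i ≤ β ∨ α < wd i) →
      (∀ i ∈ R, ht i ≤ β ∨ α < ht i) → Good ε wd ht pr m kr x0 a b W' H' R) (n : ℕ) :
    ∀ {S : Finset ι} {a b : ℝ}, GT wd ht S a b → α < a → a ≤ 1 → α < b → b ≤ 1 →
      a * b ≤ n * α ^ 2 → (∀ i ∈ S, wd i ≤ β ∨ α < wd i) → (∀ i ∈ S, ht i ≤ β ∨ α < ht i) →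
      Three ε wd ht pr m (3 ^ n * (kr + 1)) (3 ^ n * x0) S a b := by
  induction n with
  | zero =>
    intro S a b _ ha _ hb _ hab
    have : 0 < a * b := mul_pos (by linarith) (by linarith)
    simp at hab; linarith
  | succ n ih =>
    intro S a b hS ha ha1 hb hb1 hab hbw hbh
    obtain ⟨R, S0, W', H', g1, g2, g3, g4, g5, g6⟩ := thickRing hw hh hα hS ha hb hbw hbh
    subst g1
    have hG := hRL g3 g4 g5 ha ha1 hb hb1 (fun i hi => hbw i (by simp [hi]))
      (fun i hi => hbh i (by simp [hi]))
    have hle := g3.le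
    have h3n : 1 ≤ 3 ^ n := Nat.one_le_pow _ _ (by norm_num)
    have h3r : (1 : ℝ) ≤ 3 ^ n := one_le_pow₀ (by norm_num)
    have harea : W' * H' ≤ a * b := mul_le_mul hle.1 hle.2 g5 (by linarith)
    have h0 : Three ε wd ht pr m (2 * (3 ^ n * (kr + 1)) + 1) (2 * (3 ^ n * x0)) S0 W' H' := by
      rcases g6 with rfl | ⟨i, rfl, q1, q2⟩ | ⟨A, B, a1, a2, rfl, q1, rfl, q2, q3, q4, q5, q6⟩ |
        ⟨A, B, b1, b2, rfl, q1, rfl, q2, q3, q4, q5, q6⟩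
      · exact ⟨∅, ∅, ∅, by simp, by simp, by simp, by simp; positivity, by simp,
          .empty _ _ _ g4 g5, .empty _ _ _ g4 g5⟩
      · have : CP ε wd ht (2 * (3 ^ n * (kr + 1)) + 1) {i} W' H' :=
          (CP.hor {i} W' H' g4 (by simpa using q1) (by simpa using q2)).mono hw hh
            (by omega) le_rfl le_rfl
        refine ⟨∅, {i}, {i}, by simp, by simp, by simp, by simp; positivity, ?_, this, this⟩
        have h4 : 0 ≤ 4 / (m : ℝ) := by positivity
        have := hp i
        simp only [Finset.sum_singleton, Finset.sum_empty]
        nlinarith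
      · have e1 : a1 * H' ≤ n * α ^ 2 := by
          push_cast at hab
          nlinarith
        have e2 : a2 * H' ≤ n * α ^ 2 := by
          push_cast at hab
          nlinarith
        have r1 := ih q5 q2 (by linarith) q4 (by linarith) e1 (fun i hi => hbw i (by simp [hi]))
          (fun i hi => hbh i (by simp [hi]))
        have r2 := ih q6 q3 (by linarith) q4 (by linarith) e2 (fun i hi => hbw i (by simp [hi]))
          (fun i hi => hbh i (by simp [hi]))
        exact (Three.v q1 r1 r2).mono hw hh (by omega) (by linarith)
      · have e1 : W' * b1 ≤ n * α ^ 2 := by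
          push_cast at hab
          nlinarith
        have e2 : W' * b2 ≤ n * α ^ 2 := by
          push_cast at hab
          nlinarith
        have r1 := ih q5 q4 (by linarith) q2 (by linarith) e1 (fun i hi => hbw i (by simp [hi]))
          (fun i hi => hbh i (by simp [hi]))
        have r2 := ih q6 q4 (by linarith) q3 (by linarith) e2 (fun i hi => hbw i (by simp [hi]))
          (fun i hi => hbh i (by simp [hi]))
        exact (Three.v q1 r1.swap r2.swap).swap.mono hw hh (by omega) (by linarith)
    refine (Three.ring g2 h0 hG).mono hw hh ?_ ?_
    · rw [pow_succ]; nlinarith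
    · rw [pow_succ]; nlinarith
end GKP

namespace GKP
variable {ι : Type} [DecidableEq ι] {ε : ℝ} {wd ht pr : ι → ℝ}

theorem params (hε : 0 < ε) (hε1 : ε < 1) {m : ℕ} (hm : 0 < m) (δ : ℝ) (hδ : 0 < δ) (α : ℝ)
    (hα : 0 < α) (hα1 : α < 1) : ∃ (β : ℝ) (k : ℕ), 0 < β ∧ β < α ∧
    ∀ (ι : Type) [DecidableEq ι] (wd ht pr : ι → ℝ), (∀ i, 0 < wd i) → (∀ i, 0 < ht i) →
    (∀ i, 0 ≤ pr i) → ∀ S : Finset ι, GT wd ht S 1 1 → (∀ i ∈ S, wd i ≤ β ∨ α < wd i) →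
    (∀ i ∈ S, ht i ≤ β ∨ α < ht i) → Three ε wd ht pr m k δ S 1 1 := by
  have hmR : (0 : ℝ) < m := by exact_mod_cast hm
  obtain ⟨K0, kK, hK0, hKR⟩ := KR m hm ε hε hε1
  have hKR' : KRP ε m K0 kK := hKR
  obtain ⟨kR, hLR⟩ := lemmaR hε hm hK0 hKR' α hα
  have hLR' : LRP ε m α kR := hLR
  obtain ⟨n1, hn1⟩ := exists_nat_gt (1 / α ^ 2)
  rw [div_lt_iff₀ (by positivity)] at hn1
  obtain ⟨d, hd0, hd1, hd2⟩ : ∃ d : ℝ, 0 < d ∧ d ≤ α / (8 * m) ∧ d ≤ δ / (4 * 3 ^ n1) :=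
    ⟨min (α / (8 * m)) (δ / (4 * 3 ^ n1)), by positivity, min_le_left _ _, min_le_right _ _⟩
  set τ := d / (8 * m) with hτdef
  have hτ : 0 < τ := by positivity
  obtain ⟨n, hn⟩ := exists_nat_gt (1 / τ)
  rw [div_lt_iff₀ hτ] at hn
  obtain ⟨β, hβ, hβ1, hβ2, hβ3⟩ : ∃ β : ℝ, 0 < β ∧ β ≤ α / 2 ∧
      β ≤ τ / ((n + 2) * (2 * K0)) ∧ β ≤ δ / (2 * (3 ^ n1 * ((n + 1) * (K0 * (4 * m))))) :=
    ⟨min (α / 2) (min (τ / ((n + 2) * (2 * K0))) (δ / (2 * (3 ^ n1 * ((n + 1) * (K0 * (4 * m))))))),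
      by positivity, min_le_left _ _, (min_le_right _ _).trans (min_le_left _ _),
      (min_le_right _ _).trans (min_le_right _ _)⟩
  rw [le_div_iff₀ (by positivity)] at hβ2 hβ3 hd2
  have hKβ : 0 < K0 * β := by positivity
  have hnKβ : 0 ≤ n * (K0 * β) := by positivity
  have e1 : 1 / (4 * (m : ℝ)) * d = 2 * τ := by rw [hτdef]; field_simp; norm_num
  have e2 : 1 / (4 * (m : ℝ)) * α = 2 * (α / (8 * m)) := by field_simp; norm_num
  have hdα : d ≤ α := by
    refine hd1.trans (div_le_self hα.le ?_)
    have : (1 : ℝ) ≤ m := by exact_mod_cast hm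
    linarith
  have hτα : τ ≤ α / (8 * m) := by
    rw [hτdef]; gcongr
  refine ⟨β, 3 ^ n1 * (((n + 1) * (3 * kK + kR) + (3 * kK + kR)) + 1), hβ, by linarith, ?_⟩
  intro ι _ wd ht pr hw hh hp S hS hbw hbh
  have key := three_main (ε := ε) (m := m) (β := β) hw hh hp hα
    (x0 := 2 * d + (n + 1) * (K0 * β * (4 * m))) (by positivity)
    (kr := (n + 1) * (3 * kK + kR) + (3 * kK + kR))
    (fun {a b W' H' R} hR hW' hH' ha ha1 hb hb1 h1 h2 =>
      ringLemma hw hh hp hm hK0 hKR' hLR' hβ hτ hd0 n hn.le (by rw [e1]; linarith)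
        (by rw [e2]; linarith) hR hW' hH' ha ha1 hb hb1 h1 h2) n1 hS hα1 le_rfl hα1 le_rfl
    (by linarith) hbw hbh
  refine key.mono hw hh le_rfl ?_
  linarith

theorem band_count (α : ℕ → ℝ) (hα : Antitone α) (m : ℕ) (v : ℝ) :
    ((Finset.range m).filter (fun j => α (j + 1) < v ∧ v ≤ α j)).card ≤ 1 := by
  rw [Finset.card_le_one]
  have aux : ∀ j j' : ℕ, j < j' → α (j + 1) < v → v ≤ α j' → False := by
    intro j j' h h1 h2
    have := hα (Nat.succ_le_of_lt h)
    simp only [Nat.succ_eq_add_one] at this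
    linarith
  intro j hj j' hj'
  simp only [Finset.mem_filter] at hj hj'
  rcases lt_trichotomy j j' with h | h | h
  · exact (aux j j' h hj.2.1 hj'.2.2).elim
  · exact h
  · exact (aux j' j h hj'.2.1 hj.2.2).elim

theorem band_sum (hp : ∀ i, 0 ≤ pr i) (α : ℕ → ℝ) (hα : Antitone α) (m : ℕ) (v : ι → ℝ)
    (S : Finset ι) : ∑ j ∈ Finset.range m,
      ∑ i ∈ S.filter (fun i => α (j + 1) < v i ∧ v i ≤ α j), pr i ≤ ∑ i ∈ S, pr i := by
  simp only [Finset.sum_filter]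
  rw [Finset.sum_comm]
  refine Finset.sum_le_sum fun i _ => ?_
  rw [← Finset.sum_filter, Finset.sum_const, nsmul_eq_mul]
  have : (((Finset.range m).filter (fun j => α (j + 1) < v i ∧ v i ≤ α j)).card : ℝ) ≤ 1 := by
    exact_mod_cast band_count α hα m (v i)
  nlinarith [hp i]

/-- The main structural result: three candidates. -/
theorem three_exists (hε : 0 < ε) (hε1 : ε < 1) {m : ℕ} (hm : 0 < m) (δ : ℝ) (hδ : 0 < δ) :
    ∃ kb : ℕ, ∀ (ι : Type) [DecidableEq ι] (wd ht pr : ι → ℝ), (∀ i, 0 < wd i) → (∀ i, 0 < ht i) →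
    (∀ i, 0 ≤ pr i) → ∀ S : Finset ι, GT wd ht S 1 1 →
    ∃ S' ⊆ S, (1 - 2 / (m : ℝ)) * ∑ i ∈ S, pr i ≤ ∑ i ∈ S', pr i ∧
      Three ε wd ht pr m kb δ S' 1 1 := by
  have hmR : (0 : ℝ) < m := by exact_mod_cast hm
  have hP : ∀ α : {x : ℝ // 0 < x ∧ x < 1}, ∃ (β : {x : ℝ // 0 < x ∧ x < 1}) (k : ℕ), β.1 < α.1 ∧
    ∀ (ι : Type) [DecidableEq ι] (wd ht pr : ι → ℝ), (∀ i, 0 < wd i) → (∀ i, 0 < ht i) →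
    (∀ i, 0 ≤ pr i) → ∀ S : Finset ι, GT wd ht S 1 1 → (∀ i ∈ S, wd i ≤ β.1 ∨ α.1 < wd i) →
    (∀ i ∈ S, ht i ≤ β.1 ∨ α.1 < ht i) → Three ε wd ht pr m k δ S 1 1 := by
    intro α
    obtain ⟨β, k, h1, h2, h3⟩ := params hε hε1 hm δ hδ α.1 α.2.1 α.2.2
    exact ⟨⟨β, h1, h2.trans α.2.2⟩, k, h2, h3⟩
  choose f k hf hk using hP
  let α : ℕ → {x : ℝ // 0 < x ∧ x < 1} := fun j => f^[j] ⟨1 / 2, by norm_num, by norm_num⟩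
  have hsucc : ∀ j, α (j + 1) = f (α j) := fun j => Function.iterate_succ_apply' _ _ _
  have hanti : Antitone (fun j => (α j).1) := antitone_nat_of_succ_le fun j => by
    rw [hsucc]; exact (hf _).le
  refine ⟨∑ j ∈ Finset.range m, k (α j), ?_⟩
  intro ι _ wd ht pr hw hh hp S hS
  have s1 := band_sum hp (fun j => (α j).1) hanti m wd S
  have s2 := band_sum hp (fun j => (α j).1) hanti m ht S
  obtain ⟨j, hj, hjle⟩ : ∃ j ∈ Finset.range m,
      ∑ i ∈ S.filter (fun i => (α (j + 1)).1 < wd i ∧ wd i ≤ (α j).1), pr i +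
      ∑ i ∈ S.filter (fun i => (α (j + 1)).1 < ht i ∧ ht i ≤ (α j).1), pr i ≤
        (2 / m) * ∑ i ∈ S, pr i := by
    apply Finset.exists_le_of_sum_le (by simpa using hm.ne')
    rw [Finset.sum_add_distrib, Finset.sum_const, Finset.card_range, nsmul_eq_mul]
    have : (m : ℝ) * (2 / m * ∑ i ∈ S, pr i) = 2 * ∑ i ∈ S, pr i := by field_simp
    rw [this]; linarith
  refine ⟨S.filter (fun i => ¬ (((α (j + 1)).1 < wd i ∧ wd i ≤ (α j).1) ∨
    ((α (j + 1)).1 < ht i ∧ ht i ≤ (α j).1))), Finset.filter_subset _ _, ?_, ?_⟩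
  · have h1 := Finset.sum_filter_add_sum_filter_not S (fun i =>
      (((α (j + 1)).1 < wd i ∧ wd i ≤ (α j).1) ∨ ((α (j + 1)).1 < ht i ∧ ht i ≤ (α j).1))) pr
    have h2 : ∑ i ∈ S.filter (fun i =>
      (((α (j + 1)).1 < wd i ∧ wd i ≤ (α j).1) ∨ ((α (j + 1)).1 < ht i ∧ ht i ≤ (α j).1))), pr i ≤
      ∑ i ∈ S.filter (fun i => (α (j + 1)).1 < wd i ∧ wd i ≤ (α j).1), pr i +
      ∑ i ∈ S.filter (fun i => (α (j + 1)).1 < ht i ∧ ht i ≤ (α j).1), pr i := by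
      rw [Finset.filter_or, ← Finset.sum_union_inter]
      have : 0 ≤ ∑ i ∈ (S.filter (fun i => (α (j + 1)).1 < wd i ∧ wd i ≤ (α j).1)) ∩
        (S.filter (fun i => (α (j + 1)).1 < ht i ∧ ht i ≤ (α j).1)), pr i :=
        Finset.sum_nonneg fun i _ => hp i
      linarith
    linarith
  · refine (hk (α j) ι wd ht pr hw hh hp _ (hS.sub hw hh _ (Finset.filter_subset _ _)) ?_ ?_).mono
      hw hh (Finset.single_le_sum (f := fun j => k (α j)) (fun _ _ => Nat.zero_le _) hj) le_rfl
    · intro i hi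
      rw [← hsucc]
      simp only [Finset.mem_filter] at hi
      by_contra hcon
      push Not at hcon
      exact hi.2 (Or.inl hcon)
    · intro i hi
      rw [← hsucc]
      simp only [Finset.mem_filter] at hi
      by_contra hcon
      push Not at hcon
      exact hi.2 (Or.inr hcon)
end GKP

namespace GKP
variable {ι : Type} [DecidableEq ι] {ε : ℝ} {wd ht pr : ι → ℝ}

/-- Long items peeled off one by one. -/
inductive Fit (wd ht : ι → ℝ) : Finset ι → ℝ → ℝ → Prop
  | nil (a b : ℝ) (ha : 0 ≤ a) (hb : 0 ≤ b) : Fit wd ht ∅ a b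
  | wide (i : ι) (S : Finset ι) (a b : ℝ) (h1 : 1 / 2 < wd i) (h2 : wd i ≤ a) (hi : i ∉ S)
      (h : Fit wd ht S a b) : Fit wd ht (insert i S) a (b + ht i)
  | tall (i : ι) (S : Finset ι) (a b : ℝ) (h0 : ¬ 1 / 2 < wd i) (h1 : 1 / 2 < ht i) (h2 : ht i ≤ b)
      (hi : i ∉ S) (h : Fit wd ht S a b) : Fit wd ht (insert i S) (a + wd i) b

/-- An L-part followed by a container packing. -/
inductive LCP (ε M : ℝ) (wd ht : ι → ℝ) (k : ℕ) : Finset ι → ℝ → ℝ → Prop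
  | base (S : Finset ι) (a b : ℝ) (h : CP ε wd ht k S a b) : LCP ε M wd ht k S a b
  | wide (i : ι) (S : Finset ι) (a b : ℝ) (h1 : M < wd i) (h2 : wd i ≤ a) (hi : i ∉ S)
      (h : LCP ε M wd ht k S a b) : LCP ε M wd ht k (insert i S) a (b + ht i)
  | tall (i : ι) (S : Finset ι) (a b : ℝ) (h0 : ¬ M < wd i) (h1 : M < ht i) (h2 : ht i ≤ b)
      (hi : i ∉ S) (h : LCP ε M wd ht k S a b) : LCP ε M wd ht k (insert i S) (a + wd i) b

theorem LCP.scale {k : ℕ} {M : ℝ} {S : Finset ι} {a b : ℝ} (h : LCP ε M wd ht k S a b) (c : ℝ)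
    (hc : 0 < c) : LCP ε (c * M) (fun i => c * wd i) (fun i => c * ht i) k S (c * a) (c * b) := by
  induction h with
  | base S a b h => exact .base _ _ _ (h.scale c c hc.le hc.le)
  | wide i S a b h1 h2 hi h ih =>
    rw [mul_add]
    exact .wide i S _ _ (by gcongr) (by gcongr) hi ih
  | tall i S a b h0 h1 h2 hi h ih =>
    rw [mul_add]
    refine .tall i S _ _ ?_ (by gcongr) (by gcongr) hi ih
    intro h
    exact h0 (lt_of_mul_lt_mul_left h hc.le)

theorem Fit.mono {S : Finset ι} {a b : ℝ} (h : Fit wd ht S a b) :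
    ∀ {a' b' : ℝ}, a ≤ a' → b ≤ b' → Fit wd ht S a' b' := by
  induction h with
  | nil a b ha hb => intro a' b' h1 h2; exact .nil _ _ (by linarith) (by linarith)
  | wide i S a b h1 h2 hi h ih =>
    intro a' b' ha hb
    have := Fit.wide i S a' (b' - ht i) h1 (by linarith) hi (ih ha (by linarith))
    simpa using this
  | tall i S a b h0 h1 h2 hi h ih =>
    intro a' b' ha hb
    have := Fit.tall i S (a' - wd i) b' h0 h1 (by linarith) hi (ih (by linarith) hb)
    simpa using this

theorem Fit.prependTall {S2 : Finset ι} {a b : ℝ} (h : Fit wd ht S2 a b) (S1 : Finset ι)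
    (h0 : ∀ i ∈ S1, ¬ 1 / 2 < wd i) (h1 : ∀ i ∈ S1, 1 / 2 < ht i) (h2 : ∀ i ∈ S1, ht i ≤ b)
    (hd : Disjoint S1 S2) : Fit wd ht (S1 ∪ S2) (a + ∑ i ∈ S1, wd i) b := by
  induction S1 using Finset.induction_on with
  | empty => simpa using h
  | insert i S hi ih =>
    rw [Finset.disjoint_insert_left] at hd
    have := ih (fun j hj => h0 j (by simp [hj])) (fun j hj => h1 j (by simp [hj]))
      (fun j hj => h2 j (by simp [hj])) hd.2
    rw [Finset.insert_union, Finset.sum_insert hi]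
    have := Fit.tall i (S ∪ S2) _ b (h0 i (by simp)) (h1 i (by simp)) (h2 i (by simp))
      (by simp [hi, hd.1]) this
    rw [add_assoc, add_comm _ (wd i)] at this
    exact this

theorem Fit.prependWide {S2 : Finset ι} {a b : ℝ} (h : Fit wd ht S2 a b) (S1 : Finset ι)
    (h1 : ∀ i ∈ S1, 1 / 2 < wd i) (h2 : ∀ i ∈ S1, wd i ≤ a)
    (hd : Disjoint S1 S2) : Fit wd ht (S1 ∪ S2) a (b + ∑ i ∈ S1, ht i) := by
  induction S1 using Finset.induction_on with
  | empty => simpa using h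
  | insert i S hi ih =>
    rw [Finset.disjoint_insert_left] at hd
    have := ih (fun j hj => h1 j (by simp [hj]))
      (fun j hj => h2 j (by simp [hj])) hd.2
    rw [Finset.insert_union, Finset.sum_insert hi]
    have := Fit.wide i (S ∪ S2) a _ (h1 i (by simp)) (h2 i (by simp))
      (by simp [hi, hd.1]) this
    rw [add_assoc, add_comm _ (ht i)] at this
    exact this

theorem GT.tall_sum (hw : ∀ i, 0 < wd i) (hh : ∀ i, 0 < ht i) {S : Finset ι} {a b : ℝ}
    (h : GT wd ht S a b) : b ≤ 1 → (∀ i ∈ S, 1 / 2 < ht i) → ∑ i ∈ S, wd i ≤ a := by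
  induction h with
  | empty a b ha hb => intro _ _; simpa using ha
  | single i a b ha hb => intro _ _; simpa using ha
  | v S1 S2 a1 a2 b hd h1 h2 i1 i2 =>
    intro hb hS
    rw [Finset.sum_union hd]
    have := i1 hb fun i hi => hS i (by simp [hi])
    have := i2 hb fun i hi => hS i (by simp [hi])
    linarith
  | h S1 S2 a b1 b2 hd h1 h2 i1 i2 =>
    intro hb hS
    have n1 := h1.nonneg hw hh
    have n2 := h2.nonneg hw hh
    by_cases hb1 : b1 ≤ 1 / 2
    · have : S1 = ∅ := by
        rw [Finset.eq_empty_iff_forall_notMem]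
        intro i hi
        have := (h1.le hw hh i hi).2
        have := hS i (by simp [hi])
        linarith
      subst this
      simpa using i2 (by linarith) fun i hi => hS i (by simp [hi])
    · have : S2 = ∅ := by
        rw [Finset.eq_empty_iff_forall_notMem]
        intro i hi
        have := (h2.le hw hh i hi).2
        have := hS i (by simp [hi])
        linarith
      subst this
      simpa using i1 (by linarith) fun i hi => hS i (by simp [hi])

theorem GT.fit (hw : ∀ i, 0 < wd i) (hh : ∀ i, 0 < ht i) {S : Finset ι} {a b : ℝ}
    (h : GT wd ht S a b) : a ≤ 1 → b ≤ 1 → (∀ i ∈ S, 1 / 2 < wd i ∨ 1 / 2 < ht i) →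
    Fit wd ht S a b := by
  induction h with
  | empty a b ha hb => intro _ _ _; exact .nil _ _ ha hb
  | single i a b ha hb =>
    intro ha1 hb1 hS
    have hwi := hw i
    have hhi := hh i
    by_cases hc : 1 / 2 < wd i
    · have := Fit.wide (ht := ht) i ∅ a (b - ht i) hc ha (by simp)
        (.nil _ _ (by linarith) (by linarith))
      simpa using this
    · have := Fit.tall (ht := ht) i ∅ (a - wd i) b hc ((hS i (by simp)).resolve_left hc) hb (by simp)
        (.nil _ _ (by linarith) (by linarith))
      simpa using this
  | v S1 S2 a1 a2 b hd h1 h2 i1 i2 =>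
    intro ha hb hS
    have n1 := h1.nonneg hw hh
    have n2 := h2.nonneg hw hh
    by_cases ha1 : a1 ≤ 1 / 2
    · have w1 : ∀ i ∈ S1, ¬ 1 / 2 < wd i := fun i hi => by
        have := (h1.le hw hh i hi).1
        linarith
      have t1 : ∀ i ∈ S1, 1 / 2 < ht i := fun i hi =>
        (hS i (by simp [hi])).resolve_left (w1 i hi)
      have := (i2 (by linarith) hb fun i hi => hS i (by simp [hi])).prependTall S1 w1 t1
        (fun i hi => (h1.le hw hh i hi).2) hd
      exact this.mono (by linarith [h1.tall_sum hw hh hb t1]) le_rfl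
    · have w1 : ∀ i ∈ S2, ¬ 1 / 2 < wd i := fun i hi => by
        have := (h2.le hw hh i hi).1
        linarith
      have t1 : ∀ i ∈ S2, 1 / 2 < ht i := fun i hi =>
        (hS i (by simp [hi])).resolve_left (w1 i hi)
      have := (i1 (by linarith) hb fun i hi => hS i (by simp [hi])).prependTall S2 w1 t1
        (fun i hi => (h2.le hw hh i hi).2) hd.symm
      rw [Finset.union_comm]
      exact this.mono (by linarith [h2.tall_sum hw hh hb t1]) le_rfl
  | h S1 S2 a b1 b2 hd h1 h2 i1 i2 =>
    intro ha hb hS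
    have n1 := h1.nonneg hw hh
    have n2 := h2.nonneg hw hh
    by_cases hb1 : b1 ≤ 1 / 2
    · have w1 : ∀ i ∈ S1, ¬ 1 / 2 < ht i := fun i hi => by
        have := (h1.le hw hh i hi).2
        linarith
      have t1 : ∀ i ∈ S1, 1 / 2 < wd i := fun i hi =>
        (hS i (by simp [hi])).resolve_right (w1 i hi)
      have := (i2 ha (by linarith) fun i hi => hS i (by simp [hi])).prependWide S1 t1
        (fun i hi => (h1.le hw hh i hi).1) hd
      exact this.mono le_rfl (by linarith [h1.swap.tall_sum hh hw ha t1])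
    · have w1 : ∀ i ∈ S2, ¬ 1 / 2 < ht i := fun i hi => by
        have := (h2.le hw hh i hi).2
        linarith
      have t1 : ∀ i ∈ S2, 1 / 2 < wd i := fun i hi =>
        (hS i (by simp [hi])).resolve_right (w1 i hi)
      have := (i1 ha (by linarith) fun i hi => hS i (by simp [hi])).prependWide S2 t1
        (fun i hi => (h2.le hw hh i hi).1) hd.symm
      rw [Finset.union_comm]
      exact this.mono le_rfl (by linarith [h2.swap.tall_sum hh hw ha t1])

theorem Fit.lcp (hw : ∀ i, 0 < wd i) (hh : ∀ i, 0 < ht i) {S : Finset ι} {a b : ℝ}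
    (h : Fit wd ht S a b) {k : ℕ} {T : Finset ι} {a' b' : ℝ} (hT : CP ε wd ht k T a' b')
     : Disjoint S T → a' + ∑ i ∈ S.filter (fun i => ¬ 1 / 2 < wd i), wd i ≤ a →
    b' + ∑ i ∈ S.filter (fun i => 1 / 2 < wd i), ht i ≤ b → LCP ε (1 / 2) wd ht k (S ∪ T) a b := by
  induction h with
  | nil a b ha hb =>
    intro _ h1 h2
    refine .base _ _ _ ?_
    simp only [Finset.filter_empty, Finset.sum_empty, add_zero] at h1 h2
    simpa using hT.mono hw hh le_rfl h1 h2
  | wide i S a b h1 h2 hi h ih =>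
    intro hd g1 g2
    rw [Finset.disjoint_insert_left] at hd
    rw [Finset.filter_insert, if_neg (by simpa using h1)] at g1
    rw [Finset.filter_insert, if_pos h1, Finset.sum_insert (by simp [hi])] at g2
    rw [Finset.insert_union]
    exact .wide i _ a b h1 h2 (by simp [hi, hd.1]) (ih hd.2 g1 (by linarith))
  | tall i S a b h0 h1 h2 hi h ih =>
    intro hd g1 g2
    rw [Finset.disjoint_insert_left] at hd
    rw [Finset.filter_insert, if_pos h0, Finset.sum_insert (by simp [hi])] at g1
    rw [Finset.filter_insert, if_neg h0] at g2
    rw [Finset.insert_union]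
    exact .tall i _ a b h0 h1 h2 (by simp [hi, hd.1]) (ih hd.2 (by linarith) g2)

/-- If all items of `S` have width larger than `c`, the total height is bounded by the area. -/
theorem sum_ht_le (hw : ∀ i, 0 < wd i) (hh : ∀ i, 0 < ht i) {X S : Finset ι} (hS : S ⊆ X) {c δ : ℝ}
    (hc : 0 < c) (h : ∀ i ∈ S, c < wd i) (hX : ∑ i ∈ X, wd i * ht i ≤ δ) :
    ∑ i ∈ S, ht i ≤ δ / c := by
  rw [le_div_iff₀ hc, Finset.sum_mul]
  refine le_trans (Finset.sum_le_sum fun i hi => ?_)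
    ((Finset.sum_le_sum_of_subset_of_nonneg hS fun i _ _ => (mul_pos (hw i) (hh i)).le).trans hX)
  rw [mul_comm]
  exact mul_le_mul_of_nonneg_right (h i hi).le (hh i).le

theorem tiny_lcp (hw : ∀ i, 0 < wd i) (hh : ∀ i, 0 < ht i) (hε : 0 < ε) (hε1 : ε < 1)
    {X : Finset ι} (hX : GT wd ht X 1 1) (hA : ∑ i ∈ X, wd i * ht i ≤ ε / 64) :
    LCP ε (1 / 2) wd ht 3 X 1 1 := by
  have hA' : ∑ i ∈ X, ht i * wd i ≤ ε / 64 := by simpa [mul_comm] using hA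
  set L := X.filter (fun i => 1 / 2 < wd i ∨ 1 / 2 < ht i) with hL
  set Q := X.filter (fun i => ¬ (1 / 2 < wd i ∨ 1 / 2 < ht i)) with hQ
  have hLQ : X = L ∪ Q := (Finset.filter_union_filter_not_eq _ _).symm
  have hd : Disjoint L Q := Finset.disjoint_filter_filter_not _ _ _
  have hfit : Fit wd ht L 1 1 := (hX.sub hw hh L (Finset.filter_subset _ _)).fit hw hh le_rfl le_rfl
    (by simp [hL])
  have s1 : ∑ i ∈ L.filter (fun i => 1 / 2 < wd i), ht i ≤ (ε / 64) / (1 / 2) :=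
    sum_ht_le hw hh ((Finset.filter_subset _ _).trans (Finset.filter_subset _ _)) (by norm_num)
      (by simp) hA
  have s2 : ∑ i ∈ L.filter (fun i => ¬ 1 / 2 < wd i), wd i ≤ (ε / 64) / (1 / 2) := by
    refine sum_ht_le hh hw ((Finset.filter_subset _ _).trans (Finset.filter_subset _ _))
      (by norm_num) ?_ hA'
    intro i hi
    simp only [hL, Finset.mem_filter] at hi
    exact hi.1.2.resolve_left hi.2
  set A := Q.filter (fun i => ε / 4 < wd i) with hAdef
  set Q' := Q.filter (fun i => ¬ ε / 4 < wd i) with hQ'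
  set B := Q'.filter (fun i => ε / 4 < ht i) with hB
  set C := Q'.filter (fun i => ¬ ε / 4 < ht i) with hC
  have e1 : Q = A ∪ Q' := (Finset.filter_union_filter_not_eq _ _).symm
  have e2 : Q' = B ∪ C := (Finset.filter_union_filter_not_eq _ _).symm
  have d1 : Disjoint A Q' := Finset.disjoint_filter_filter_not _ _ _
  have d2 : Disjoint B C := Finset.disjoint_filter_filter_not _ _ _
  have hQX : Q ⊆ X := Finset.filter_subset _ _
  have hQ'Q : Q' ⊆ Q := Finset.filter_subset _ _
  have hsh : ∀ i ∈ Q, wd i ≤ 1 / 2 ∧ ht i ≤ 1 / 2 := by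
    intro i hi
    simp only [hQ, Finset.mem_filter, not_or, not_lt] at hi
    exact hi.2
  have s3 : ∑ i ∈ A, ht i ≤ (ε / 64) / (ε / 4) :=
    sum_ht_le hw hh ((Finset.filter_subset _ _).trans hQX) (by positivity) (by simp [hAdef]) hA
  have s4 : ∑ i ∈ B, wd i ≤ (ε / 64) / (ε / 4) :=
    sum_ht_le hh hw ((Finset.filter_subset _ _).trans (hQ'Q.trans hQX)) (by positivity)
      (by simp [hB]) hA'
  have e3 : (ε / 64) / (ε / 4) = 1 / 16 := by field_simp; norm_num
  rw [e3] at s3 s4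
  have cA : CP ε wd ht 1 A (1 / 2) (1 / 16) :=
    .hor _ _ _ (by norm_num) (fun i hi => (hsh i (Finset.filter_subset _ _ hi)).1) s3
  have cB : CP ε wd ht 1 B (1 / 16) (1 / 2) :=
    .ver _ _ _ (by norm_num) (fun i hi => (hsh i (hQ'Q (Finset.filter_subset _ _ hi))).2) s4
  have hCs : ∀ i ∈ C, wd i ≤ ε / 4 ∧ ht i ≤ ε / 4 := by
    intro i hi
    simp only [hC, hQ', Finset.mem_filter, not_lt] at hi
    exact ⟨hi.1.2, hi.2⟩
  have cC : CP ε wd ht 1 C (1 / 2) (1 / 2) := by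
    refine .area _ _ _ ?_ fun i hi => ⟨by linarith [(hCs i hi).1], by linarith [(hCs i hi).2]⟩
    have := nfdh hw hh (1 / 2) (ε / 4) (by positivity) (by linarith) C.card C (ε / 4) le_rfl
      (by positivity) (fun i hi => (hCs i hi).1) (fun i hi => (hCs i hi).2)
    refine this.mono hw hh le_rfl ?_
    have hCA : ∑ i ∈ C, wd i * ht i ≤ ε / 64 :=
      (Finset.sum_le_sum_of_subset_of_nonneg ((Finset.filter_subset _ _).trans (hQ'Q.trans hQX))
        fun i _ _ => (mul_pos (hw i) (hh i)).le).trans hA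
    have : (∑ i ∈ C, wd i * ht i) / (1 / 2 - ε / 4) ≤ 1 / 4 := by
      rw [div_le_iff₀ (by linarith)]
      linarith
    linarith
  have cQ : CP ε wd ht 3 Q (1 - ε / 64 / (1 / 2)) (1 - ε / 64 / (1 / 2)) := by
    refine CP.frame hw hh (cA.mono hw hh le_rfl (?_ : (1 : ℝ) / 2 ≤ _) le_rfl) cB cC ?_ ?_ ?_
      ?_ d2 (by norm_num) ?_
    · linarith
    · linarith
    · linarith
    · linarith
    · rw [← e2]; exact d1
    · rw [← e2]; exact e1
  rw [hLQ]
  exact hfit.lcp hw hh cQ hd (by linarith) (by linarith)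
end GKP

namespace GKP
variable {ι : Type} [DecidableEq ι] {ε : ℝ} {wd ht pr : ι → ℝ}

theorem gt_of_sep {place : ι → Rect} {P : Rect} {S : Finset ι} (h : GuillotineSep place P S) :
    IsPacking wd ht S place P → P.x1 ≤ P.x2 → P.y1 ≤ P.y2 → GT wd ht S P.width P.height := by
  induction h with
  | base P S hS =>
    intro hp hx hy
    rcases Nat.le_one_iff_eq_zero_or_eq_one.1 hS with h | h
    · rw [Finset.card_eq_zero] at h
      subst h
      exact .empty _ _ (sub_nonneg.2 hx) (sub_nonneg.2 hy)
    · rw [Finset.card_eq_one] at h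
      obtain ⟨i, rfl⟩ := h
      have h1 := hp.hw i (by simp)
      have h2 := hp.hh i (by simp)
      have h3 := hp.hin i (by simp)
      obtain ⟨q1, q2, q3, q4⟩ := h3
      refine .single _ _ _ ?_ ?_
      · rw [← h1]; unfold Rect.width; linarith
      · rw [← h2]; unfold Rect.height; linarith
  | vcut P S c h1 h2 hcross hL hR iL iR =>
    intro hp hx hy
    have g1 := iL ⟨fun i hi => hp.hw i (Finset.filter_subset _ _ hi),
      fun i hi => hp.hh i (Finset.filter_subset _ _ hi), fun i hi => by
        simp only [Finset.mem_filter] at hi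
        obtain ⟨q1, q2, q3, q4⟩ := hp.hin i hi.1
        exact ⟨q1, hi.2, q3, q4⟩,
      fun i hi j hj => hp.hdisj i (Finset.filter_subset _ _ hi) j (Finset.filter_subset _ _ hj)⟩
      h1.le hy
    have g2 := iR ⟨fun i hi => hp.hw i (Finset.filter_subset _ _ hi),
      fun i hi => hp.hh i (Finset.filter_subset _ _ hi), fun i hi => by
        simp only [Finset.mem_filter] at hi
        obtain ⟨q1, q2, q3, q4⟩ := hp.hin i hi.1
        exact ⟨(hcross i hi.1).resolve_left hi.2, q2, q3, q4⟩,
      fun i hi j hj => hp.hdisj i (Finset.filter_subset _ _ hi) j (Finset.filter_subset _ _ hj)⟩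
      h2.le hy
    refine g1.v' g2 (Finset.disjoint_filter_filter_not _ _ _)
      (Finset.filter_union_filter_not_eq _ _).symm ?_
    simp only [Rect.width]; ring
  | hcut P S c h1 h2 hcross hL hR iL iR =>
    intro hp hx hy
    have g1 := iL ⟨fun i hi => hp.hw i (Finset.filter_subset _ _ hi),
      fun i hi => hp.hh i (Finset.filter_subset _ _ hi), fun i hi => by
        simp only [Finset.mem_filter] at hi
        obtain ⟨q1, q2, q3, q4⟩ := hp.hin i hi.1
        exact ⟨q1, q2, q3, hi.2⟩,
      fun i hi j hj => hp.hdisj i (Finset.filter_subset _ _ hi) j (Finset.filter_subset _ _ hj)⟩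
      hx h1.le
    have g2 := iR ⟨fun i hi => hp.hw i (Finset.filter_subset _ _ hi),
      fun i hi => hp.hh i (Finset.filter_subset _ _ hi), fun i hi => by
        simp only [Finset.mem_filter] at hi
        obtain ⟨q1, q2, q3, q4⟩ := hp.hin i hi.1
        exact ⟨q1, q2, (hcross i hi.1).resolve_left hi.2, q4⟩,
      fun i hi j hj => hp.hdisj i (Finset.filter_subset _ _ hi) j (Finset.filter_subset _ _ hj)⟩
      hx h2.le
    refine g1.h' g2 (Finset.disjoint_filter_filter_not _ _ _)
      (Finset.filter_union_filter_not_eq _ _).symm ?_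
    simp only [Rect.height]; ring

theorem sep_congr {place place' : ι → Rect} {P : Rect} {S : Finset ι}
    (h : GuillotineSep place P S) :
    (∀ i ∈ S, place i = place' i) → GuillotineSep place' P S := by
  induction h with
  | base P S hS => intro _; exact .base P S hS
  | vcut P S c h1 h2 hcross hL hR iL iR =>
    intro he
    refine .vcut P S c h1 h2 (fun i hi => by rw [← he i hi]; exact hcross i hi) ?_ ?_
    · have e : S.filter (fun i => (place' i).x2 ≤ c) =
          S.filter (fun i => (place i).x2 ≤ c) :=
        Finset.filter_congr (fun i hi => by rw [he i hi])
      rw [e]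
      exact iL fun i hi => he i (Finset.filter_subset _ _ hi)
    · have e : S.filter (fun i => ¬ (place' i).x2 ≤ c) =
          S.filter (fun i => ¬ (place i).x2 ≤ c) :=
        Finset.filter_congr (fun i hi => by rw [he i hi])
      rw [e]
      exact iR fun i hi => he i (Finset.filter_subset _ _ hi)
  | hcut P S c h1 h2 hcross hL hR iL iR =>
    intro he
    refine .hcut P S c h1 h2 (fun i hi => by rw [← he i hi]; exact hcross i hi) ?_ ?_
    · have e : S.filter (fun i => (place' i).y2 ≤ c) =
          S.filter (fun i => (place i).y2 ≤ c) :=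
        Finset.filter_congr (fun i hi => by rw [he i hi])
      rw [e]
      exact iL fun i hi => he i (Finset.filter_subset _ _ hi)
    · have e : S.filter (fun i => ¬ (place' i).y2 ≤ c) =
          S.filter (fun i => ¬ (place i).y2 ≤ c) :=
        Finset.filter_congr (fun i hi => by rw [he i hi])
      rw [e]
      exact iR fun i hi => he i (Finset.filter_subset _ _ hi)

theorem sep_mono {place : ι → Rect} {P : Rect} {S : Finset ι}
    (h : GuillotineSep place P S) :
    ∀ {P' : Rect}, P.SubRect P' → GuillotineSep place P' S := by
  induction h with
  | base P S hS => intro P' _; exact .base P' S hS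
  | vcut P S c h1 h2 hcross hL hR iL iR =>
    rintro P' ⟨q1, q2, q3, q4⟩
    exact .vcut P' S c (lt_of_le_of_lt q1 h1) (lt_of_lt_of_le h2 q2) hcross
      (iL ⟨q1, le_rfl, q3, q4⟩) (iR ⟨le_rfl, q2, q3, q4⟩)
  | hcut P S c h1 h2 hcross hL hR iL iR =>
    rintro P' ⟨q1, q2, q3, q4⟩
    exact .hcut P' S c (lt_of_le_of_lt q3 h1) (lt_of_lt_of_le h2 q4) hcross
      (iL ⟨q1, q2, q3, le_rfl⟩) (iR ⟨q1, q2, le_rfl, q4⟩)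

theorem SubRect_trans {r s t : Rect} (h1 : r.SubRect s) (h2 : s.SubRect t) : r.SubRect t :=
  ⟨h2.1.trans h1.1, h1.2.1.trans h2.2.1, h2.2.2.1.trans h1.2.2.1, h1.2.2.2.trans h2.2.2.2⟩

theorem SubRect_toSet {r s : Rect} (h : r.SubRect s) : r.toSet ⊆ s.toSet := by
  rintro p ⟨h1, h2, h3, h4⟩
  exact ⟨lt_of_le_of_lt h.1 h1, lt_of_lt_of_le h2 h.2.1, lt_of_le_of_lt h.2.2.1 h3,
    lt_of_lt_of_le h4 h.2.2.2⟩

theorem disj_v {r s : Rect} (h : r.x2 ≤ s.x1) : Disjoint r.toSet s.toSet := by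
  rw [Set.disjoint_left]
  rintro p ⟨h1, h2, h3, h4⟩ ⟨g1, g2, g3, g4⟩
  linarith

theorem disj_h {r s : Rect} (h : r.y2 ≤ s.y1) : Disjoint r.toSet s.toSet := by
  rw [Set.disjoint_left]
  rintro p ⟨h1, h2, h3, h4⟩ ⟨g1, g2, g3, g4⟩
  linarith

theorem gp_congr {place place' : ι → Rect} {P : Rect} {S : Finset ι}
    (h : GuillotinePacking wd ht S place P) (he : ∀ i ∈ S, place i = place' i) :
    GuillotinePacking wd ht S place' P := by
  refine ⟨⟨fun i hi => ?_, fun i hi => ?_, fun i hi => ?_, fun i hi j hj hij => ?_⟩,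
    sep_congr h.2 he⟩
  · rw [← he i hi]; exact h.1.hw i hi
  · rw [← he i hi]; exact h.1.hh i hi
  · rw [← he i hi]; exact h.1.hin i hi
  · rw [← he i hi, ← he j hj]; exact h.1.hdisj i hi j hj hij

theorem gp_mono {place : ι → Rect} {P P' : Rect} {S : Finset ι}
    (h : GuillotinePacking wd ht S place P) (hP : P.SubRect P') :
    GuillotinePacking wd ht S place P' :=
  ⟨⟨h.1.hw, h.1.hh, fun i hi => SubRect_trans (h.1.hin i hi) hP, h.1.hdisj⟩, sep_mono h.2 hP⟩

theorem gp_union {place : ι → Rect} {P P1 P2 : Rect} {S1 S2 : Finset ι}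
    (h1 : IsPacking wd ht S1 place P1) (h2 : IsPacking wd ht S2 place P2) (hP1 : P1.SubRect P)
    (hP2 : P2.SubRect P) (hd : Disjoint P1.toSet P2.toSet) :
    IsPacking wd ht (S1 ∪ S2) place P := by
  refine ⟨fun i hi => ?_, fun i hi => ?_, fun i hi => ?_, fun i hi j hj hij => ?_⟩
  · rcases Finset.mem_union.1 hi with hi | hi
    · exact h1.hw i hi
    · exact h2.hw i hi
  · rcases Finset.mem_union.1 hi with hi | hi
    · exact h1.hh i hi
    · exact h2.hh i hi
  · rcases Finset.mem_union.1 hi with hi | hi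
    · exact SubRect_trans (h1.hin i hi) hP1
    · exact SubRect_trans (h2.hin i hi) hP2
  · rcases Finset.mem_union.1 hi with hi | hi <;> rcases Finset.mem_union.1 hj with hj | hj
    · exact h1.hdisj i hi j hj hij
    · exact hd.mono (SubRect_toSet (h1.hin i hi)) (SubRect_toSet (h2.hin j hj))
    · exact hd.symm.mono (SubRect_toSet (h2.hin i hi)) (SubRect_toSet (h1.hin j hj))
    · exact h2.hdisj i hi j hj hij

theorem gp_v (hw : ∀ i, 0 < wd i) {place : ι → Rect} {x1 c x2 y1 y2 : ℝ} {S1 S2 : Finset ι}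
    (h1 : GuillotinePacking wd ht S1 place ⟨x1, c, y1, y2⟩)
    (h2 : GuillotinePacking wd ht S2 place ⟨c, x2, y1, y2⟩) (hc1 : x1 ≤ c) (hc2 : c ≤ x2) :
    GuillotinePacking wd ht (S1 ∪ S2) place ⟨x1, x2, y1, y2⟩ := by
  have s1 : Rect.SubRect ⟨x1, c, y1, y2⟩ ⟨x1, x2, y1, y2⟩ := ⟨le_rfl, hc2, le_rfl, le_rfl⟩
  have s2 : Rect.SubRect ⟨c, x2, y1, y2⟩ ⟨x1, x2, y1, y2⟩ := ⟨hc1, le_rfl, le_rfl, le_rfl⟩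
  rcases S1.eq_empty_or_nonempty with rfl | ⟨i1, hi1⟩
  · simpa using gp_mono h2 s2
  rcases S2.eq_empty_or_nonempty with rfl | ⟨i2, hi2⟩
  · simpa using gp_mono h1 s1
  refine ⟨gp_union h1.1 h2.1 s1 s2 (disj_v le_rfl), ?_⟩
  have f1 : ∀ i ∈ S1, (place i).x2 ≤ c := fun i hi => (h1.1.hin i hi).2.1
  have f2 : ∀ i ∈ S2, c ≤ (place i).x1 := fun i hi => (h2.1.hin i hi).1
  have f3 : ∀ i ∈ S2, ¬ (place i).x2 ≤ c := fun i hi => by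
    have a1 := h2.1.hw i hi
    have a2 := f2 i hi
    have a3 := hw i
    unfold Rect.width at a1
    linarith
  have l1 : x1 < c := by
    have a1 := h1.1.hw i1 hi1
    have a2 := f1 i1 hi1
    have a3 := hw i1
    have a4 := (h1.1.hin i1 hi1).1
    unfold Rect.width at a1
    simp only at a4
    linarith
  have l2 : c < x2 := by
    have a1 := f3 i2 hi2
    have a4 := (h2.1.hin i2 hi2).2.1
    simp only at a4
    linarith
  have e1 : (S1 ∪ S2).filter (fun i => (place i).x2 ≤ c) = S1 := by
    ext i; simp only [Finset.mem_filter, Finset.mem_union]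
    constructor
    · rintro ⟨h | h, h'⟩
      · exact h
      · exact (f3 i h h').elim
    · exact fun h => ⟨Or.inl h, f1 i h⟩
  have e2 : (S1 ∪ S2).filter (fun i => ¬ (place i).x2 ≤ c) = S2 := by
    ext i; simp only [Finset.mem_filter, Finset.mem_union]
    constructor
    · rintro ⟨h | h, h'⟩
      · exact (h' (f1 i h)).elim
      · exact h
    · exact fun h => ⟨Or.inr h, f3 i h⟩
  refine .vcut _ _ c l1 l2 (fun i hi => ?_) ?_ ?_
  · rcases Finset.mem_union.1 hi with hi | hi
    · exact Or.inl (f1 i hi)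
    · exact Or.inr (f2 i hi)
  · rw [e1]; exact h1.2
  · rw [e2]; exact h2.2

theorem gp_h (hh : ∀ i, 0 < ht i) {place : ι → Rect} {x1 c x2 y1 y2 : ℝ} {S1 S2 : Finset ι}
    (h1 : GuillotinePacking wd ht S1 place ⟨x1, x2, y1, c⟩)
    (h2 : GuillotinePacking wd ht S2 place ⟨x1, x2, c, y2⟩) (hc1 : y1 ≤ c) (hc2 : c ≤ y2) :
    GuillotinePacking wd ht (S1 ∪ S2) place ⟨x1, x2, y1, y2⟩ := by
  have s1 : Rect.SubRect ⟨x1, x2, y1, c⟩ ⟨x1, x2, y1, y2⟩ := ⟨le_rfl, le_rfl, le_rfl, hc2⟩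
  have s2 : Rect.SubRect ⟨x1, x2, c, y2⟩ ⟨x1, x2, y1, y2⟩ := ⟨le_rfl, le_rfl, hc1, le_rfl⟩
  rcases S1.eq_empty_or_nonempty with rfl | ⟨i1, hi1⟩
  · simpa using gp_mono h2 s2
  rcases S2.eq_empty_or_nonempty with rfl | ⟨i2, hi2⟩
  · simpa using gp_mono h1 s1
  refine ⟨gp_union h1.1 h2.1 s1 s2 (disj_h le_rfl), ?_⟩
  have f1 : ∀ i ∈ S1, (place i).y2 ≤ c := fun i hi => (h1.1.hin i hi).2.2.2
  have f2 : ∀ i ∈ S2, c ≤ (place i).y1 := fun i hi => (h2.1.hin i hi).2.2.1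
  have f3 : ∀ i ∈ S2, ¬ (place i).y2 ≤ c := fun i hi => by
    have a1 := h2.1.hh i hi
    have a2 := f2 i hi
    have a3 := hh i
    unfold Rect.height at a1
    linarith
  have l1 : y1 < c := by
    have a1 := h1.1.hh i1 hi1
    have a2 := f1 i1 hi1
    have a3 := hh i1
    have a4 := (h1.1.hin i1 hi1).2.2.1
    unfold Rect.height at a1
    simp only at a4
    linarith
  have l2 : c < y2 := by
    have a1 := f3 i2 hi2
    have a4 := (h2.1.hin i2 hi2).2.2.2
    simp only at a4
    linarith
  have e1 : (S1 ∪ S2).filter (fun i => (place i).y2 ≤ c) = S1 := by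
    ext i; simp only [Finset.mem_filter, Finset.mem_union]
    constructor
    · rintro ⟨h | h, h'⟩
      · exact h
      · exact (f3 i h h').elim
    · exact fun h => ⟨Or.inl h, f1 i h⟩
  have e2 : (S1 ∪ S2).filter (fun i => ¬ (place i).y2 ≤ c) = S2 := by
    ext i; simp only [Finset.mem_filter, Finset.mem_union]
    constructor
    · rintro ⟨h | h, h'⟩
      · exact (h' (f1 i h)).elim
      · exact h
    · exact fun h => ⟨Or.inr h, f3 i h⟩
  refine .hcut _ _ c l1 l2 (fun i hi => ?_) ?_ ?_
  · rcases Finset.mem_union.1 hi with hi | hi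
    · exact Or.inl (f1 i hi)
    · exact Or.inr (f2 i hi)
  · rw [e1]; exact h1.2
  · rw [e2]; exact h2.2

theorem gp_single {place : ι → Rect} {P : Rect} (i : ι) (h1 : (place i).width = wd i)
    (h2 : (place i).height = ht i) (h3 : (place i).SubRect P) :
    GuillotinePacking wd ht {i} place P :=
  ⟨⟨by simpa using h1, by simpa using h2, by simpa using h3, by
    intro i1 hi1 j hj hij
    simp only [Finset.mem_singleton] at hi1 hj
    exact (hij (hi1.trans hj.symm)).elim⟩, .base _ _ (by simp)⟩

theorem gp_empty (place : ι → Rect) (P : Rect) : GuillotinePacking wd ht ∅ place P :=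
  ⟨⟨by simp, by simp, by simp, by simp⟩, .base _ _ (by simp)⟩

/-- Merging two placements. -/
def merge (S1 : Finset ι) (p1 p2 : ι → Rect) : ι → Rect := fun i => if i ∈ S1 then p1 i else p2 i

theorem merge_left {S1 : Finset ι} {p1 p2 : ι → Rect} : ∀ i ∈ S1, p1 i = merge S1 p1 p2 i := by
  intro i hi; simp [merge, hi]

theorem merge_right {S1 S2 : Finset ι} {p1 p2 : ι → Rect} (hd : Disjoint S1 S2) :
    ∀ i ∈ S2, p2 i = merge S1 p1 p2 i := by
  intro i hi
  have : i ∉ S1 := fun h => Finset.disjoint_left.1 hd h hi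
  simp [merge, this]

theorem GT.real (hw : ∀ i, 0 < wd i) (hh : ∀ i, 0 < ht i) {S : Finset ι} {a b : ℝ}
    (h : GT wd ht S a b) : ∀ x y : ℝ, ∃ place,
      GuillotinePacking wd ht S place ⟨x, x + a, y, y + b⟩ := by
  induction h with
  | empty a b ha hb => intro x y; exact ⟨fun _ => ⟨0, 0, 0, 0⟩, gp_empty _ _⟩
  | single i a b ha hb =>
    intro x y
    exact ⟨fun _ => ⟨x, x + wd i, y, y + ht i⟩, gp_single i (by simp [Rect.width])
      (by simp [Rect.height]) ⟨le_rfl, by simpa using ha, le_rfl, by simpa using hb⟩⟩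
  | v S1 S2 a1 a2 b hd h1 h2 i1 i2 =>
    intro x y
    obtain ⟨p1, g1⟩ := i1 x y
    obtain ⟨p2, g2⟩ := i2 (x + a1) y
    have n1 := h1.nonneg hw hh
    have n2 := h2.nonneg hw hh
    refine ⟨merge S1 p1 p2, ?_⟩
    rw [← add_assoc]
    exact gp_v hw (gp_congr g1 merge_left) (gp_congr g2 (merge_right hd)) (by linarith)
      (by linarith)
  | h S1 S2 a b1 b2 hd h1 h2 i1 i2 =>
    intro x y
    obtain ⟨p1, g1⟩ := i1 x y
    obtain ⟨p2, g2⟩ := i2 x (y + b1)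
    have n1 := h1.nonneg hw hh
    have n2 := h2.nonneg hw hh
    refine ⟨merge S1 p1 p2, ?_⟩
    rw [← add_assoc]
    exact gp_h hh (gp_congr g1 merge_left) (gp_congr g2 (merge_right hd)) (by linarith)
      (by linarith)

theorem hor_real (hh : ∀ i, 0 < ht i) (S : Finset ι) (a : ℝ)
    (hS : ∀ i ∈ S, wd i ≤ a) (x : ℝ) : ∀ y b : ℝ, ∑ i ∈ S, ht i ≤ b → ∃ place,
      GuillotinePacking wd ht S place ⟨x, x + a, y, y + b⟩ ∧
      ∀ i ∈ S, ∀ i' ∈ S, i ≠ i' → (place i).y2 ≤ (place i').y1 ∨ (place i').y2 ≤ (place i).y1 := by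
  induction S using Finset.induction_on with
  | empty => intro y b _; exact ⟨fun _ => ⟨0, 0, 0, 0⟩, gp_empty _ _, by simp⟩
  | insert i S hi ih =>
    intro y b hb
    rw [Finset.sum_insert hi] at hb
    obtain ⟨p2, g2, g3⟩ := ih (fun j hj => hS j (by simp [hj])) (y + ht i) (b - ht i) (by linarith)
    have e : y + ht i + (b - ht i) = y + b := by ring
    rw [e] at g2
    have hd : Disjoint {i} S := by simpa using hi
    have hs0 : 0 ≤ ∑ i ∈ S, ht i := Finset.sum_nonneg fun i _ => (hh i).le
    have h1 : GuillotinePacking wd ht {i} (fun _ => ⟨x, x + wd i, y, y + ht i⟩)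
        ⟨x, x + a, y, y + ht i⟩ := gp_single i (by simp [Rect.width])
      (by simp [Rect.height]) ⟨le_rfl, by simpa using hS i (by simp), le_rfl, le_rfl⟩
    have hhi := hh i
    have h2 := gp_congr g2 (merge_right (p1 := (fun _ => ⟨x, x + wd i, y, y + ht i⟩)) hd)
    refine ⟨merge {i} (fun _ => ⟨x, x + wd i, y, y + ht i⟩) p2, ?_, ?_⟩
    · rw [Finset.insert_eq]
      exact gp_h hh (gp_congr h1 merge_left) h2 (by linarith) (by linarith)
    · have key : ∀ j ∈ S, (merge {i} (fun _ => ⟨x, x + wd i, y, y + ht i⟩) p2 i).y2 ≤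
          (merge {i} (fun _ => ⟨x, x + wd i, y, y + ht i⟩) p2 j).y1 := by
        intro j hj
        have := (h2.1.hin j hj).2.2.1
        simpa [merge] using this
      intro j hj j' hj' hne
      rcases Finset.mem_insert.1 hj with rfl | hk <;> rcases Finset.mem_insert.1 hj' with rfl | hk'
      · exact (hne rfl).elim
      · exact Or.inl (key _ hk')
      · exact Or.inr (key _ hk)
      · rw [← merge_right hd j hk, ← merge_right hd j' hk']
        exact g3 j hk j' hk' hne

theorem ver_real (hw : ∀ i, 0 < wd i) (S : Finset ι) (b : ℝ)
    (hS : ∀ i ∈ S, ht i ≤ b) (y : ℝ) : ∀ x a : ℝ, ∑ i ∈ S, wd i ≤ a → ∃ place,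
      GuillotinePacking wd ht S place ⟨x, x + a, y, y + b⟩ ∧
      ∀ i ∈ S, ∀ i' ∈ S, i ≠ i' → (place i).x2 ≤ (place i').x1 ∨ (place i').x2 ≤ (place i).x1 := by
  induction S using Finset.induction_on with
  | empty => intro x a _; exact ⟨fun _ => ⟨0, 0, 0, 0⟩, gp_empty _ _, by simp⟩
  | insert i S hi ih =>
    intro x a ha
    rw [Finset.sum_insert hi] at ha
    obtain ⟨p2, g2, g3⟩ := ih (fun j hj => hS j (by simp [hj])) (x + wd i) (a - wd i) (by linarith)
    have e : x + wd i + (a - wd i) = x + a := by ring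
    rw [e] at g2
    have hd : Disjoint {i} S := by simpa using hi
    have hs0 : 0 ≤ ∑ i ∈ S, wd i := Finset.sum_nonneg fun i _ => (hw i).le
    have h1 : GuillotinePacking wd ht {i} (fun _ => ⟨x, x + wd i, y, y + ht i⟩)
        ⟨x, x + wd i, y, y + b⟩ := gp_single i (by simp [Rect.width])
      (by simp [Rect.height]) ⟨le_rfl, le_rfl, le_rfl, by simpa using hS i (by simp)⟩
    have hhi := hw i
    have h2 := gp_congr g2 (merge_right (p1 := (fun _ => ⟨x, x + wd i, y, y + ht i⟩)) hd)
    refine ⟨merge {i} (fun _ => ⟨x, x + wd i, y, y + ht i⟩) p2, ?_, ?_⟩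
    · rw [Finset.insert_eq]
      exact gp_v hw (gp_congr h1 merge_left) h2 (by linarith) (by linarith)
    · have key : ∀ j ∈ S, (merge {i} (fun _ => ⟨x, x + wd i, y, y + ht i⟩) p2 i).x2 ≤
          (merge {i} (fun _ => ⟨x, x + wd i, y, y + ht i⟩) p2 j).x1 := by
        intro j hj
        have := (h2.1.hin j hj).1
        simpa [merge] using this
      intro j hj j' hj' hne
      rcases Finset.mem_insert.1 hj with rfl | hk <;> rcases Finset.mem_insert.1 hj' with rfl | hk'
      · exact (hne rfl).elim
      · exact Or.inl (key _ hk')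
      · exact Or.inr (key _ hk)
      · rw [← merge_right hd j hk, ← merge_right hd j' hk']
        exact g3 j hk j' hk' hne
end GKP

namespace GKP
variable {ι : Type} [DecidableEq ι] {ε : ℝ} {wd ht pr : ι → ℝ}

/-- A realized container packing. -/
def CPReal (ε : ℝ) (wd ht : ι → ℝ) (k : ℕ) (S : Finset ι) (place : ι → Rect) (cont : ℕ → Rect)
    (lab : ℕ → CLabel) (asg : ι → ℕ) (P : Rect) : Prop :=
  GuillotinePacking wd ht S place P ∧ (∀ j < k, (cont j).SubRect P) ∧
  (∀ j < k, ∀ j' < k, j ≠ j' → Disjoint (cont j).toSet (cont j').toSet) ∧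
  (∀ i ∈ S, asg i < k ∧ (place i).SubRect (cont (asg i))) ∧
  ContainerLabelOK S place k cont lab asg ε

theorem CPReal.join {k1 k2 : ℕ} {S1 S2 : Finset ι} {p1 p2 : ι → Rect} {c1 c2 : ℕ → Rect}
    {l1 l2 : ℕ → CLabel} {a1 a2 : ι → ℕ} {P P1 P2 : Rect}
    (h1 : CPReal ε wd ht k1 S1 p1 c1 l1 a1 P1) (h2 : CPReal ε wd ht k2 S2 p2 c2 l2 a2 P2)
    (s1 : P1.SubRect P) (s2 : P2.SubRect P) (hP : Disjoint P1.toSet P2.toSet)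
    (hd : Disjoint S1 S2) (hg : GuillotinePacking wd ht (S1 ∪ S2) (merge S1 p1 p2) P) :
    ∃ place cont lab asg, CPReal ε wd ht (k1 + k2) (S1 ∪ S2) place cont lab asg P := by
  obtain ⟨g1, cs1, cd1, ca1, cl1⟩ := h1
  obtain ⟨g2, cs2, cd2, ca2, cl2⟩ := h2
  let cont : ℕ → Rect := fun j => if j < k1 then c1 j else c2 (j - k1)
  let lab : ℕ → CLabel := fun j => if j < k1 then l1 j else l2 (j - k1)
  let asg : ι → ℕ := fun i => if i ∈ S1 then a1 i else k1 + a2 i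
  have C1 : ∀ j, j < k1 → cont j = c1 j := fun j h => by simp [cont, h]
  have C2 : ∀ j, ¬ j < k1 → cont j = c2 (j - k1) := fun j h => by simp [cont, h]
  have L1 : ∀ j, j < k1 → lab j = l1 j := fun j h => by simp [lab, h]
  have L2 : ∀ j, ¬ j < k1 → lab j = l2 (j - k1) := fun j h => by simp [lab, h]
  have A1 : ∀ i ∈ S1, asg i = a1 i := fun i h => by simp [asg, h]
  have A2 : ∀ i ∈ S2, asg i = k1 + a2 i := fun i h => by
    have : i ∉ S1 := fun h' => Finset.disjoint_left.1 hd h' h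
    simp [asg, this]
  have K1 : ∀ j, j < k1 → ∀ i ∈ S1 ∪ S2, asg i = j →
      i ∈ S1 ∧ a1 i = j ∧ merge S1 p1 p2 i = p1 i := by
    intro j hj i hi hij
    rcases Finset.mem_union.1 hi with hi | hi
    · exact ⟨hi, by rw [← A1 i hi, hij], (merge_left i hi).symm⟩
    · have := A2 i hi; omega
  have K2 : ∀ j, ¬ j < k1 → ∀ i ∈ S1 ∪ S2, asg i = j →
      i ∈ S2 ∧ a2 i = j - k1 ∧ merge S1 p1 p2 i = p2 i := by
    intro j hj i hi hij
    rcases Finset.mem_union.1 hi with hi | hi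
    · have := A1 i hi; have := (ca1 i hi).1; omega
    · exact ⟨hi, by have := A2 i hi; omega, (merge_right hd i hi).symm⟩
  refine ⟨merge S1 p1 p2, cont, lab, asg, hg, ?_, ?_, ?_, ?_, ?_, ?_, ?_⟩
  · intro j hj
    by_cases h : j < k1
    · rw [C1 j h]; exact SubRect_trans (cs1 j h) s1
    · rw [C2 j h]; exact SubRect_trans (cs2 _ (by omega)) s2
  · intro j hj j' hj' hne
    by_cases h : j < k1 <;> by_cases h' : j' < k1
    · rw [C1 j h, C1 j' h']; exact cd1 j h j' h' hne
    · rw [C1 j h, C2 j' h']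
      exact hP.mono (SubRect_toSet (cs1 j h)) (SubRect_toSet (cs2 _ (by omega)))
    · rw [C2 j h, C1 j' h']
      exact hP.symm.mono (SubRect_toSet (cs2 _ (by omega))) (SubRect_toSet (cs1 j' h'))
    · rw [C2 j h, C2 j' h']; exact cd2 _ (by omega) _ (by omega) (by omega)
  · intro i hi
    rcases Finset.mem_union.1 hi with hi | hi
    · have := ca1 i hi
      rw [A1 i hi, C1 _ this.1, ← merge_left i hi]
      exact ⟨by omega, this.2⟩
    · have := ca2 i hi
      rw [A2 i hi, C2 _ (by omega), ← merge_right hd i hi, Nat.add_sub_cancel_left]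
      exact ⟨by omega, this.2⟩
  · intro j hj hl i hi i' hi' e e'
    by_cases h : j < k1
    · rw [L1 j h] at hl
      obtain ⟨q1, q2, q3⟩ := K1 j h i hi e
      obtain ⟨r1, r2, r3⟩ := K1 j h i' hi' e'
      exact cl1.1 j h hl i q1 i' r1 q2 r2
    · rw [L2 j h] at hl
      obtain ⟨q1, q2, q3⟩ := K2 j h i hi e
      obtain ⟨r1, r2, r3⟩ := K2 j h i' hi' e'
      exact cl2.1 _ (by omega) hl i q1 i' r1 q2 r2
  · intro j hj hl i hi i' hi' e e' hne
    by_cases h : j < k1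
    · rw [L1 j h] at hl
      obtain ⟨q1, q2, q3⟩ := K1 j h i hi e
      obtain ⟨r1, r2, r3⟩ := K1 j h i' hi' e'
      rw [q3, r3]
      exact cl1.2.1 j h hl i q1 i' r1 q2 r2 hne
    · rw [L2 j h] at hl
      obtain ⟨q1, q2, q3⟩ := K2 j h i hi e
      obtain ⟨r1, r2, r3⟩ := K2 j h i' hi' e'
      rw [q3, r3]
      exact cl2.2.1 _ (by omega) hl i q1 i' r1 q2 r2 hne
  · intro j hj hl i hi i' hi' e e' hne
    by_cases h : j < k1
    · rw [L1 j h] at hl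
      obtain ⟨q1, q2, q3⟩ := K1 j h i hi e
      obtain ⟨r1, r2, r3⟩ := K1 j h i' hi' e'
      rw [q3, r3]
      exact cl1.2.2.1 j h hl i q1 i' r1 q2 r2 hne
    · rw [L2 j h] at hl
      obtain ⟨q1, q2, q3⟩ := K2 j h i hi e
      obtain ⟨r1, r2, r3⟩ := K2 j h i' hi' e'
      rw [q3, r3]
      exact cl2.2.2.1 _ (by omega) hl i q1 i' r1 q2 r2 hne
  · intro j hj hl i hi e
    by_cases h : j < k1
    · rw [L1 j h] at hl
      obtain ⟨q1, q2, q3⟩ := K1 j h i hi e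
      rw [q3, C1 j h]
      exact cl1.2.2.2 j h hl i q1 q2
    · rw [L2 j h] at hl
      obtain ⟨q1, q2, q3⟩ := K2 j h i hi e
      rw [q3, C2 j h]
      exact cl2.2.2.2 _ (by omega) hl i q1 q2

theorem CP.real (hw : ∀ i, 0 < wd i) (hh : ∀ i, 0 < ht i) {k : ℕ} {S : Finset ι} {a b : ℝ}
    (h : CP ε wd ht k S a b) : ∀ x y : ℝ, ∃ place cont lab asg,
      CPReal ε wd ht k S place cont lab asg ⟨x, x + a, y, y + b⟩ := by
  induction h with
  | empty k a b ha hb =>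
    intro x y
    refine ⟨fun _ => ⟨0, 0, 0, 0⟩, fun _ => ⟨x, x, y, y⟩, fun _ => .large, fun _ => 0,
      gp_empty _ _, fun j _ => ⟨le_rfl, by simpa using ha, le_rfl, by simpa using hb⟩,
      fun j _ j' _ _ => disj_v le_rfl, by simp, by simp [ContainerLabelOK]⟩
  | hor S a b ha hw' hb =>
    intro x y
    obtain ⟨place, g1, g2⟩ := hor_real hh S a hw' x y b hb
    refine ⟨place, fun _ => ⟨x, x + a, y, y + b⟩, fun _ => .horizontal, fun _ => 0, g1,
      fun j _ => ⟨le_rfl, le_rfl, le_rfl, le_rfl⟩, fun j hj j' hj' hne => by omega,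
      fun i hi => ⟨Nat.one_pos, g1.1.hin i hi⟩, ?_, ?_, ?_, ?_⟩
    · intro j _ h; cases h
    · intro j _ _ i hi i' hi' _ _ hne; exact g2 i hi i' hi' hne
    · intro j _ h; cases h
    · intro j _ h; cases h
  | ver S a b hb hh' ha =>
    intro x y
    obtain ⟨place, g1, g2⟩ := ver_real hw S b hh' y x a ha
    refine ⟨place, fun _ => ⟨x, x + a, y, y + b⟩, fun _ => .vertical, fun _ => 0, g1,
      fun j _ => ⟨le_rfl, le_rfl, le_rfl, le_rfl⟩, fun j hj j' hj' hne => by omega,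
      fun i hi => ⟨Nat.one_pos, g1.1.hin i hi⟩, ?_, ?_, ?_, ?_⟩
    · intro j _ h; cases h
    · intro j _ h; cases h
    · intro j _ _ i hi i' hi' _ _ hne; exact g2 i hi i' hi' hne
    · intro j _ h; cases h
  | area S a b hg hs =>
    intro x y
    obtain ⟨place, g1⟩ := hg.real hw hh x y
    refine ⟨place, fun _ => ⟨x, x + a, y, y + b⟩, fun _ => .area, fun _ => 0, g1,
      fun j _ => ⟨le_rfl, le_rfl, le_rfl, le_rfl⟩, fun j hj j' hj' hne => by omega,
      fun i hi => ⟨Nat.one_pos, g1.1.hin i hi⟩, ?_, ?_, ?_, ?_⟩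
    · intro j _ h; cases h
    · intro j _ h; cases h
    · intro j _ h; cases h
    · intro j _ _ i hi _
      rw [g1.1.hw i hi, g1.1.hh i hi]
      simpa [Rect.width, Rect.height] using hs i hi
  | v k1 k2 S1 S2 a1 a2 b hd h1 h2 i1 i2 =>
    intro x y
    obtain ⟨p1, c1, l1, as1, r1⟩ := i1 x y
    obtain ⟨p2, c2, l2, as2, r2⟩ := i2 (x + a1) y
    have n1 := h1.nonneg hw hh
    have n2 := h2.nonneg hw hh
    rw [← add_assoc]
    exact r1.join r2 ⟨le_rfl, by simp; linarith, le_rfl, le_rfl⟩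
      ⟨by simp; linarith, le_rfl, le_rfl, le_rfl⟩ (disj_v le_rfl) hd
      (gp_v hw (gp_congr r1.1 merge_left) (gp_congr r2.1 (merge_right hd)) (by linarith)
      (by linarith))
  | h k1 k2 S1 S2 a b1 b2 hd h1 h2 i1 i2 =>
    intro x y
    obtain ⟨p1, c1, l1, as1, r1⟩ := i1 x y
    obtain ⟨p2, c2, l2, as2, r2⟩ := i2 x (y + b1)
    have n1 := h1.nonneg hw hh
    have n2 := h2.nonneg hw hh
    rw [← add_assoc]
    exact r1.join r2 ⟨le_rfl, le_rfl, le_rfl, by simp; linarith⟩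
      ⟨le_rfl, le_rfl, by simp; linarith, le_rfl⟩ (disj_h le_rfl) hd
      (gp_h hh (gp_congr r1.1 merge_left) (gp_congr r2.1 (merge_right hd)) (by linarith)
      (by linarith))

theorem label_congr {T : Finset ι} {place place' : ι → Rect} {k : ℕ} {cont : ℕ → Rect}
    {lab : ℕ → CLabel} {asg : ι → ℕ} (h : ContainerLabelOK T place k cont lab asg ε)
    (he : ∀ i ∈ T, place i = place' i) : ContainerLabelOK T place' k cont lab asg ε := by
  refine ⟨h.1, ?_, ?_, ?_⟩
  · intro j hj hl i hi i' hi'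
    rw [← he i hi, ← he i' hi']
    exact h.2.1 j hj hl i hi i' hi'
  · intro j hj hl i hi i' hi'
    rw [← he i hi, ← he i' hi']
    exact h.2.2.1 j hj hl i hi i' hi'
  · intro j hj hl i hi
    rw [← he i hi]
    exact h.2.2.2 j hj hl i hi

/-- A realized packing with an L-part. -/
def LReal (ε M : ℝ) (wd ht : ι → ℝ) (k : ℕ) (S : Finset ι) (x0 x1 y0 y1 : ℝ) : Prop :=
  ∃ (place : ι → Rect) (N1 N2 : ℝ) (SL : Finset ι) (cont : ℕ → Rect) (lab : ℕ → CLabel)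
    (asg : ι → ℕ),
    GuillotinePacking wd ht S place ⟨x0, x1, y0, y1⟩ ∧
    y0 ≤ N1 ∧ N1 ≤ y1 ∧ x0 ≤ N2 ∧ N2 ≤ x1 ∧ SL ⊆ S ∧
    (∀ i ∈ SL, M < wd i ∨ M < ht i) ∧
    (∀ i ∈ SL, M < wd i → (place i).y2 ≤ N1) ∧
    (∀ i ∈ SL, ¬ M < wd i → (place i).x2 ≤ N2) ∧
    (∀ j < k, (cont j).SubRect ⟨N2, x1, N1, y1⟩) ∧
    (∀ j < k, ∀ j' < k, j ≠ j' → Disjoint (cont j).toSet (cont j').toSet) ∧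
    (∀ i ∈ S \ SL, asg i < k ∧ (place i).SubRect (cont (asg i))) ∧
    ContainerLabelOK (S \ SL) place k cont lab asg ε

theorem LReal.add {M : ℝ} {k : ℕ} {S : Finset ι} {x0 x1 y0 y1 X0 Y0 : ℝ} {i : ι} (hi : i ∉ S)
    (h : LReal ε M wd ht k S x0 x1 y0 y1) (hl : M < wd i ∨ M < ht i)
    (hx : X0 ≤ x0) (hy : Y0 ≤ y0)
    (hW : M < wd i → Y0 + ht i ≤ y0) (hT : ¬ M < wd i → X0 + wd i ≤ x0)
    (hg : ∀ place, GuillotinePacking wd ht S place ⟨x0, x1, y0, y1⟩ →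
      GuillotinePacking wd ht (insert i S)
        (merge {i} (fun _ => ⟨X0, X0 + wd i, Y0, Y0 + ht i⟩) place) ⟨X0, x1, Y0, y1⟩) :
    LReal ε M wd ht k (insert i S) X0 x1 Y0 y1 := by
  obtain ⟨place, N1, N2, SL, cont, lab, asg, g, b1, b2, b3, b4, sl, f1, f2, f3, f4, f5, f6, f7⟩ := h
  have hd : Disjoint {i} S := by simpa using hi
  have hm := merge_right (p1 := (fun _ => ⟨X0, X0 + wd i, Y0, Y0 + ht i⟩)) (p2 := place) hd
  have hmi := merge_left (S1 := {i}) (p1 := (fun _ => ⟨X0, X0 + wd i, Y0, Y0 + ht i⟩))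
    (p2 := place) i (by simp)
  have e : insert i S \ insert i SL = S \ SL := by
    ext j; simp only [Finset.mem_sdiff, Finset.mem_insert]
    constructor
    · rintro ⟨h1 | h1, h2⟩
      · exact (h2 (Or.inl h1)).elim
      · exact ⟨h1, fun h => h2 (Or.inr h)⟩
    · rintro ⟨h1, h2⟩
      refine ⟨Or.inr h1, ?_⟩
      rintro (h | h)
      · exact hi (h ▸ h1)
      · exact h2 h
  refine ⟨merge {i} (fun _ => ⟨X0, X0 + wd i, Y0, Y0 + ht i⟩) place, N1, N2, insert i SL, cont,
    lab, asg, hg place g, by linarith, b2, by linarith, b4, Finset.insert_subset_insert _ sl,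
    ?_, ?_, ?_, f4, f5, ?_, ?_⟩
  · intro j hj
    rcases Finset.mem_insert.1 hj with rfl | hj
    · exact hl
    · exact f1 j hj
  · intro j hj hM
    rcases Finset.mem_insert.1 hj with rfl | hj
    · rw [← hmi]; exact (hW hM).trans b1
    · rw [← hm j (sl hj)]; exact f2 j hj hM
  · intro j hj hM
    rcases Finset.mem_insert.1 hj with rfl | hj
    · rw [← hmi]; exact (hT hM).trans b3
    · rw [← hm j (sl hj)]; exact f3 j hj hM
  · rw [e]
    intro j hj
    rw [← hm j (Finset.mem_sdiff.1 hj).1]; exact f6 j hj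
  · rw [e]
    exact label_congr f7 fun j hj => hm j (Finset.mem_sdiff.1 hj).1

theorem LCP.nonneg (hw : ∀ i, 0 < wd i) (hh : ∀ i, 0 < ht i) {k : ℕ} {M : ℝ} {S : Finset ι}
    {a b : ℝ} (h : LCP ε M wd ht k S a b) : 0 ≤ a ∧ 0 ≤ b := by
  induction h with
  | base S a b h => exact h.nonneg hw hh
  | wide i S a b h1 h2 hi h ih => exact ⟨ih.1, add_nonneg ih.2 (hh i).le⟩
  | tall i S a b h0 h1 h2 hi h ih => exact ⟨add_nonneg ih.1 (hw i).le, ih.2⟩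

theorem LCP.real (hw : ∀ i, 0 < wd i) (hh : ∀ i, 0 < ht i) {k : ℕ} {M : ℝ} {S : Finset ι}
    {a b : ℝ} (h : LCP ε M wd ht k S a b) :
    ∀ x y : ℝ, LReal ε M wd ht k S x (x + a) y (y + b) := by
  induction h with
  | base S a b h =>
    intro x y
    obtain ⟨p, c, l, as, g1, g2, g3, g4, g5⟩ := h.real hw hh x y
    have n := h.nonneg hw hh
    exact ⟨p, y, x, ∅, c, l, as, g1, le_rfl, by linarith, le_rfl, by linarith, by simp, by simp,
      by simp, by simp, g2, g3, by simpa using g4, by simpa using g5⟩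
  | wide i S a b h1 h2 hi h ih =>
    intro x y
    have n := h.nonneg hw hh
    have hi0 := hh i
    have r := ih x (y + ht i)
    have e : y + ht i + b = y + (b + ht i) := by ring
    rw [e] at r
    refine r.add hi (Or.inl h1) le_rfl (by linarith) (fun _ => le_rfl) (fun h => (h h1).elim) ?_
    intro place g
    have hd : Disjoint {i} S := by simpa using hi
    have h1 : GuillotinePacking wd ht {i} (fun _ => ⟨x, x + wd i, y, y + ht i⟩)
        ⟨x, x + a, y, y + ht i⟩ := gp_single i (by simp [Rect.width])
      (by simp [Rect.height]) ⟨le_rfl, by simpa using h2, le_rfl, le_rfl⟩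
    rw [Finset.insert_eq]
    exact gp_h hh (gp_congr h1 merge_left) (gp_congr g (merge_right hd)) (by linarith)
      (by linarith)
  | tall i S a b h0 h1 h2 hi h ih =>
    intro x y
    have n := h.nonneg hw hh
    have hi0 := hw i
    have r := ih (x + wd i) y
    have e : x + wd i + a = x + (a + wd i) := by ring
    rw [e] at r
    refine r.add hi (Or.inr h1) (by linarith) le_rfl (fun h => (h0 h).elim) (fun _ => le_rfl) ?_
    intro place g
    have hd : Disjoint {i} S := by simpa using hi
    have h1 : GuillotinePacking wd ht {i} (fun _ => ⟨x, x + wd i, y, y + ht i⟩)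
        ⟨x, x + wd i, y, y + b⟩ := gp_single i (by simp [Rect.width])
      (by simp [Rect.height]) ⟨le_rfl, le_rfl, le_rfl, by simpa using h2⟩
    rw [Finset.insert_eq]
    exact gp_v hw (gp_congr h1 merge_left) (gp_congr g (merge_right hd)) (by linarith)
      (by linarith)

theorem LCP.isLC (hw : ∀ i, 0 < wd i) (hh : ∀ i, 0 < ht i) {k : ℕ} {N : ℝ} {S : Finset ι}
    (h : LCP ε (N / 2) wd ht k S N N) : ∃ place, IsLCPacking wd ht N ε S place k := by
  obtain ⟨place, N1, N2, SL, cont, lab, asg, g, b1, b2, b3, b4, sl, f1, f2, f3, f4, f5, f6, f7⟩ :=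
    h.real hw hh 0 0
  simp only [zero_add] at g b2 b4 f4
  refine ⟨place, N1, N2, SL, cont, lab, asg, b1, b2, b3, b4, sl, g.1, g.2, f1, ?_, ?_, ?_, ?_,
    f5, f6, f7⟩
  · intro i hi hM
    obtain ⟨q1, q2, q3, q4⟩ := g.1.hin i (sl hi)
    exact ⟨q1, q2, q3, f2 i hi hM⟩
  · intro i hi hM
    obtain ⟨q1, q2, q3, q4⟩ := g.1.hin i (sl hi)
    exact ⟨q1, f3 i hi hM, q3, q4⟩
  · intro j hj
    exact SubRect_trans (f4 j hj) ⟨b3, le_rfl, b1, le_rfl⟩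
  · intro j hj
    obtain ⟨q1, q2, q3, q4⟩ := f4 j hj
    rw [Set.disjoint_union_right]
    exact ⟨(disj_h q3).symm, (disj_v q1).symm⟩

theorem lc_congr {wd' ht' : ι → ℝ} {k : ℕ} {N : ℝ} {S : Finset ι} {place : ι → Rect}
    (h : IsLCPacking wd ht N ε S place k) (hw : ∀ i ∈ S, wd i = wd' i)
    (hh : ∀ i ∈ S, ht i = ht' i) : IsLCPacking wd' ht' N ε S place k := by
  obtain ⟨N1, N2, SL, cont, lab, asg, b1, b2, b3, b4, sl, p, g, f1, f2, f3, f4⟩ := h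
  refine ⟨N1, N2, SL, cont, lab, asg, b1, b2, b3, b4, sl, ⟨fun i hi => ?_, fun i hi => ?_, p.hin,
    p.hdisj⟩, g, ?_, ?_, ?_, f4⟩
  · rw [← hw i hi]; exact p.hw i hi
  · rw [← hh i hi]; exact p.hh i hi
  · intro i hi; rw [← hw i (sl hi), ← hh i (sl hi)]; exact f1 i hi
  · intro i hi; rw [← hw i (sl hi)]; exact f2 i hi
  · intro i hi; rw [← hw i (sl hi)]; exact f3 i hi

theorem lc_back {k : ℕ} {N : ℝ} (hN : 0 < N) (hw : ∀ i, 0 < wd i) (hh : ∀ i, 0 < ht i)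
    {S : Finset ι}
    (h : LCP ε (1 / 2) (fun i => 1 / N * wd i) (fun i => 1 / N * ht i) k S 1 1) :
    ∃ place, IsLCPacking wd ht N ε S place k := by
  have h' := h.scale N hN
  have e : ∀ f : ι → ℝ, (fun i => N * (1 / N * f i)) = f := by
    intro f; funext i; field_simp
  rw [e, e, mul_one, mul_one_div] at h'
  exact h'.isLC hw hh

theorem lc_main : ∃ C : ℝ, 0 < C ∧
    ∀ ε : ℝ, 0 < ε → ε < 1 →
    ∃ kb : ℕ,
    ∀ (ι : Type) [DecidableEq ι] (items : Finset ι) (wd ht pr : ι → ℕ) (N : ℕ),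
      0 < N →
      (∀ i ∈ items, 0 < wd i ∧ 0 < ht i) →
      ∀ OPT : Finset ι, OPT ⊆ items →
        (∃ place, GuillotinePacking (fun i => (wd i : ℝ)) (fun i => (ht i : ℝ))
            OPT place (knapsack (N : ℝ))) →
        ∃ (S : Finset ι) (place : ι → Rect) (k : ℕ),
          S ⊆ items ∧ k ≤ kb ∧
          IsLCPacking (fun i => (wd i : ℝ)) (fun i => (ht i : ℝ)) (N : ℝ) ε S place k ∧
          (2 / 3 - C * ε) * (∑ i ∈ OPT, (pr i : ℝ)) ≤ ∑ i ∈ S, (pr i : ℝ) := by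
  refine ⟨20, by norm_num, fun ε hε hε1 => ?_⟩
  obtain ⟨m, hm⟩ := exists_nat_gt (1 / ε)
  have hm0 : 0 < m := by
    have : (0 : ℝ) < m := lt_trans (by positivity) hm
    exact_mod_cast this
  have hmR : (0 : ℝ) < m := by exact_mod_cast hm0
  have hme : 1 / (m : ℝ) ≤ ε := by
    rw [div_lt_iff₀ hε] at hm
    rw [div_le_iff₀ hmR]; linarith
  obtain ⟨kb, hkb⟩ := three_exists hε hε1 hm0 (ε / 64) (by positivity)
  refine ⟨kb + 3, ?_⟩
  intro ι _ items wd ht pr N hN hpos OPT hO ⟨place, hp, hs⟩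
  have hNR : (0 : ℝ) < N := by exact_mod_cast hN
  set W : ι → ℝ := fun i => ((max 1 (wd i) : ℕ) : ℝ) with hWdef
  set H : ι → ℝ := fun i => ((max 1 (ht i) : ℕ) : ℝ) with hHdef
  have hW : ∀ i, 0 < W i := fun i => by
    have : 0 < max 1 (wd i) := by omega
    simp only [hWdef]; exact_mod_cast this
  have hH : ∀ i, 0 < H i := fun i => by
    have : 0 < max 1 (ht i) := by omega
    simp only [hHdef]; exact_mod_cast this
  have eW : ∀ i ∈ items, W i = (wd i : ℝ) := fun i hi => by
    have := hpos i hi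
    have : max 1 (wd i) = wd i := by omega
    simp only [hWdef, this]
  have eH : ∀ i ∈ items, H i = (ht i : ℝ) := fun i hi => by
    have := hpos i hi
    have : max 1 (ht i) = ht i := by omega
    simp only [hHdef, this]
  have hp' : IsPacking W H OPT place (knapsack (N : ℝ)) :=
    ⟨fun i hi => by rw [eW i (hO hi)]; exact hp.hw i hi,
      fun i hi => by rw [eH i (hO hi)]; exact hp.hh i hi, hp.hin, hp.hdisj⟩
  have g := gt_of_sep hs hp' hNR.le hNR.le
  have g1 := g.scale (1 / (N : ℝ)) (1 / (N : ℝ)) (by positivity) (by positivity)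
  have ew : 1 / (N : ℝ) * (knapsack (N : ℝ)).width = 1 := by
    simp [knapsack, Rect.width, hNR.ne']
  have eh : 1 / (N : ℝ) * (knapsack (N : ℝ)).height = 1 := by
    simp [knapsack, Rect.height, hNR.ne']
  rw [ew, eh] at g1
  have hW' : ∀ i, 0 < 1 / (N : ℝ) * W i := fun i => mul_pos (by positivity) (hW i)
  have hH' : ∀ i, 0 < 1 / (N : ℝ) * H i := fun i => mul_pos (by positivity) (hH i)
  obtain ⟨S', hS', hpS', X, S2, S3, hX, hS2, hS3, hXa, hpr, c2, c3⟩ :=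
    hkb ι (fun i => 1 / (N : ℝ) * W i) (fun i => 1 / (N : ℝ) * H i) (fun i => (pr i : ℝ)) hW' hH'
      (fun i => Nat.cast_nonneg _) OPT g1
  have tX := tiny_lcp hW' hH' hε hε1 (g1.sub hW' hH' X (hX.trans hS')) hXa
  have l2 := LCP.base (M := 1 / 2) _ _ _ c2
  have l3 := LCP.base (M := 1 / 2) _ _ _ c3
  have fin : ∀ (k : ℕ) (S : Finset ι), k ≤ kb + 3 → S ⊆ S' →
      LCP ε (1 / 2) (fun i => 1 / (N : ℝ) * W i) (fun i => 1 / (N : ℝ) * H i) k S 1 1 →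
      (2 / 3 - 20 * ε) * (∑ i ∈ OPT, (pr i : ℝ)) ≤ ∑ i ∈ S, (pr i : ℝ) →
      ∃ (S : Finset ι) (place : ι → Rect) (k : ℕ),
          S ⊆ items ∧ k ≤ kb + 3 ∧
          IsLCPacking (fun i => (wd i : ℝ)) (fun i => (ht i : ℝ)) (N : ℝ) ε S place k ∧
          (2 / 3 - 20 * ε) * (∑ i ∈ OPT, (pr i : ℝ)) ≤ ∑ i ∈ S, (pr i : ℝ) := by
    intro k S hk hS hL hq
    obtain ⟨pl, hpl⟩ := lc_back hNR hW hH hL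
    have hSi : S ⊆ items := hS.trans (hS'.trans hO)
    exact ⟨S, pl, k, hSi, hk, lc_congr hpl (fun i hi => eW i (hSi hi)) (fun i hi => eH i (hSi hi)),
      hq⟩
  have hQ : 0 ≤ ∑ i ∈ OPT, (pr i : ℝ) := Finset.sum_nonneg fun i _ => Nat.cast_nonneg _
  have hQ' : ∑ i ∈ S', (pr i : ℝ) ≤ ∑ i ∈ OPT, (pr i : ℝ) :=
    Finset.sum_le_sum_of_subset_of_nonneg hS' fun i _ _ => Nat.cast_nonneg _
  have key : 3 * ((2 / 3 - 20 * ε) * (∑ i ∈ OPT, (pr i : ℝ))) ≤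
      ∑ i ∈ S2, (pr i : ℝ) + ∑ i ∈ S3, (pr i : ℝ) + ∑ i ∈ X, (pr i : ℝ) := by
    set Q := ∑ i ∈ OPT, (pr i : ℝ)
    set Q' := ∑ i ∈ S', (pr i : ℝ)
    have hQ0 : 0 ≤ Q' := Finset.sum_nonneg fun i _ => Nat.cast_nonneg _
    refine le_trans ?_ hpr
    have e1 : 2 / (m : ℝ) = 2 * (1 / m) := by ring
    have e2 : 4 / (m : ℝ) = 4 * (1 / m) := by ring
    rw [e1] at hpS'
    rw [e2]
    have a1 : 1 / (m : ℝ) * Q ≤ ε * Q := mul_le_mul_of_nonneg_right hme hQ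
    have a2 : 1 / (m : ℝ) * Q' ≤ ε * Q := 
      (mul_le_mul_of_nonneg_left hQ' (by positivity)).trans a1
    have a3 : 0 ≤ ε * Q := by positivity
    nlinarith
  by_cases q2 : (2 / 3 - 20 * ε) * (∑ i ∈ OPT, (pr i : ℝ)) ≤ ∑ i ∈ S2, (pr i : ℝ)
  · exact fin kb S2 (by omega) hS2 l2 q2
  by_cases q3 : (2 / 3 - 20 * ε) * (∑ i ∈ OPT, (pr i : ℝ)) ≤ ∑ i ∈ S3, (pr i : ℝ)
  · exact fin kb S3 (by omega) hS3 l3 q3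
  exact fin 3 X (by omega) hX tX (by linarith)
end GKP

/-- For weighted 2GGK with guillotine cuts, a most profitable
guillotine-separable `L&C` packing has profit at least `(2/3 - O(ε))` times the
optimum. -/
theorem LC_packing_two_thirds_weighted :
    ∃ C : ℝ, 0 < C ∧
    ∀ ε : ℝ, 0 < ε → ε < 1 →
    ∃ kb : ℕ,
    ∀ (ι : Type) [DecidableEq ι] (items : Finset ι) (wd ht pr : ι → ℕ) (N : ℕ),
      0 < N →
      (∀ i ∈ items, 0 < wd i ∧ 0 < ht i) →
      ∀ OPT : Finset ι, OPT ⊆ items →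
        (∃ place, GuillotinePacking (fun i => (wd i : ℝ)) (fun i => (ht i : ℝ))
            OPT place (knapsack (N : ℝ))) →
        (∀ T : Finset ι, T ⊆ items →
          (∃ place, GuillotinePacking (fun i => (wd i : ℝ)) (fun i => (ht i : ℝ))
              T place (knapsack (N : ℝ))) →
          (∑ i ∈ T, (pr i : ℝ)) ≤ ∑ i ∈ OPT, (pr i : ℝ)) →
        ∃ (S : Finset ι) (place : ι → Rect) (k : ℕ),
          S ⊆ items ∧ k ≤ kb ∧
          IsLCPacking (fun i => (wd i : ℝ)) (fun i => (ht i : ℝ)) (N : ℝ) ε S place k ∧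
          (2 / 3 - C * ε) * (∑ i ∈ OPT, (pr i : ℝ)) ≤ ∑ i ∈ S, (pr i : ℝ) := by
  obtain ⟨C, hC, h⟩ := GKP.lc_main
  refine ⟨C, hC, fun ε hε hε1 => ?_⟩
  obtain ⟨kb, hkb⟩ := h ε hε hε1
  exact ⟨kb, fun ι _ items wd ht pr N hN hpos OPT hO hp _ =>
    hkb ι items wd ht pr N hN hpos OPT hO hp⟩
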